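/- arXiv:2508.07463 — 5 statements merged into one kernel-verified Lean document; each statement's English description precedes it below -/
import Mathlib

section
/- For all n ≥ 0 and 0 ≤ k ≤ n!, T(n,k) = Σ_{ν₁,ν₂ ⊢ n} (1/(z_{ν₁} z_{ν₂})) · Σ_{λ ⊢ k} ∏_{j=1}^{k} binom(|T_{ν₁,ν₂}(j)|/j, m_j(λ)), where |T_{ν₁,ν₂}(j)| = Σ_{m | j} μ(j/m) · z_{ν₁^m} · δ_{ν₁^m, ν₂^m}, with μ the Möbius function, δ the Kronecker delta, the outer sum over ordered pairs of partitions of n, the inner sum over partitions λ of k, m_j(λ) the number of parts of λ equal to j, and binom(a,b) := 0 if a < b. -/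
open Equiv Finset

/-- Two `k`-subsets of `Sₙ` are equivalent if one is obtained from the other by
two-sided multiplication `σ ↦ g₁ * σ * g₂` for some pair `(g₁, g₂)`. -/
def permSetRel (n k : ℕ) (x y : {s : Finset (Perm (Fin n)) // s.card = k}) : Prop :=
  ∃ g₁ g₂ : Perm (Fin n),
    (x : Finset (Perm (Fin n))).image (fun σ => g₁ * σ * g₂) = (y : Finset (Perm (Fin n)))

/-- `T n k` is the number of orbits of the action of `Sₙ × Sₙ` on the family of
`k`-element subsets of `Sₙ`. -/
noncomputable def T (n k : ℕ) : ℕ := Nat.card (Quot (permSetRel n k))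

/-- For a partition given as a multiset `ν` of parts, `zPart ν = ∏_j j^{m_j(ν)}·m_j(ν)!`,
where `m_j(ν)` is the number of parts of `ν` equal to `j`. -/
def zPart (ν : Multiset ℕ) : ℕ :=
  ∏ j ∈ ν.toFinset, j ^ ν.count j * (ν.count j).factorial

/-- `powPartition ν m` is the cycle type `ν^m` of `g^m` for any permutation `g` of cycle
type `ν`: each part `ℓ` splits into `gcd(ℓ,m)` parts of size `ℓ/gcd(ℓ,m)`. -/
def powPartition (ν : Multiset ℕ) (m : ℕ) : Multiset ℕ :=
  ν.bind fun ℓ => Multiset.replicate (ℓ.gcd m) (ℓ / ℓ.gcd m)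

/-- `|T_{ν₁,ν₂}(j)| = Σ_{m ∣ j} μ(j/m)·z_{ν₁^m}·δ_{ν₁^m,ν₂^m}`. -/
def TpairCard (n : ℕ) (ν₁ ν₂ : Nat.Partition n) (j : ℕ) : ℤ :=
  ∑ m ∈ j.divisors, ArithmeticFunction.moebius (j / m) *
    (zPart (powPartition ν₁.parts m) : ℤ) *
    (if powPartition ν₁.parts m = powPartition ν₂.parts m then 1 else 0)


theorem minPer_support {α : Type*} [Fintype α] [DecidableEq α] (g : Perm α) (x : α)
    (hx : x ∈ g.support) : Function.minimalPeriod g x = (g.cycleOf x).support.card := by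
  have hc := g.isCycleOn_support_cycleOf x
  have hm : x ∈ (g.cycleOf x).support := by
    rw [Perm.mem_support_cycleOf_iff]; exact ⟨Perm.SameCycle.refl _ _, hx⟩
  have key : ∀ m : ℕ, Function.minimalPeriod g x ∣ m ↔ (g.cycleOf x).support.card ∣ m := by
    intro m
    rw [← hc.pow_apply_eq hm, ← Function.isPeriodicPt_iff_minimalPeriod_dvd, Function.IsPeriodicPt,
      Function.IsFixedPt, Perm.iterate_eq_pow]
  exact Nat.dvd_antisymm ((key _).2 dvd_rfl) ((key _).1 dvd_rfl)

theorem count_parts {α : Type*} [Fintype α] [DecidableEq α] (g : Perm α) (j : ℕ) (hj : 0 < j) :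
    j * g.partition.parts.count j = (univ.filter fun x => Function.minimalPeriod g x = j).card := by
  rw [Perm.parts_partition, Multiset.count_add, Multiset.count_replicate]
  by_cases h1 : j = 1
  · subst h1
    have : Multiset.count 1 g.cycleType = 0 := by
      rw [Multiset.count_eq_zero]
      intro h
      have := Perm.two_le_of_mem_cycleType h
      omega
    rw [this]
    simp only [if_true, zero_add, one_mul]
    rw [← Finset.card_compl]
    congr 1
    ext x
    simp [Function.minimalPeriod_eq_one_iff_isFixedPt, Function.IsFixedPt]
  · rw [if_neg (Ne.symm h1), add_zero, Perm.cycleType_def, Multiset.count_map]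
    have e : (univ.filter fun x => Function.minimalPeriod g x = j) =
        (g.cycleFactorsFinset.filter fun c => j = c.support.card).biUnion (fun c => c.support) := by
      ext x
      simp only [mem_filter, mem_univ, true_and, mem_biUnion]
      constructor
      · intro h
        have hx : x ∈ g.support := by
          rw [Perm.mem_support]
          intro h'
          exact h1 (h ▸ Function.minimalPeriod_eq_one_iff_isFixedPt.2 h')
        refine ⟨g.cycleOf x, ⟨Perm.cycleOf_mem_cycleFactorsFinset_iff.2 hx, ?_⟩, ?_⟩
        · rw [← h, minPer_support g x hx]
        · rw [Perm.mem_support_cycleOf_iff]; exact ⟨Perm.SameCycle.refl _ _, hx⟩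
      · rintro ⟨c, ⟨hc, hj⟩, hx⟩
        have := (Perm.eq_cycleOf_of_mem_cycleFactorsFinset_iff g c hc x).2 hx
        rw [minPer_support g x (Perm.mem_cycleFactorsFinset_support_le hc hx), ← this, hj]
    rw [e, Finset.card_biUnion]
    · rw [Finset.sum_congr rfl (g := fun _ => j)]
      · rw [Finset.sum_const, smul_eq_mul, mul_comm]; rfl
      · intro c hc
        exact (mem_filter.1 hc).2.symm
    · intro c hc d hd hcd
      have := g.cycleFactorsFinset_pairwise_disjoint (mem_filter.1 hc).1 (mem_filter.1 hd).1 hcd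
      exact Perm.disjoint_iff_disjoint_support.1 this

theorem zPart_parts {α : Type*} [Fintype α] [DecidableEq α] (g : Perm α) :
    zPart g.partition.parts = Nat.card (Subgroup.centralizer {g}) := by
  have h1 : 1 ∉ g.cycleType := fun h => by
    have := Perm.two_le_of_mem_cycleType h
    omega
  have h1' : 1 ∉ g.cycleType.toFinset := by simpa using h1
  rw [Perm.nat_card_centralizer, zPart, Perm.parts_partition, Perm.sum_cycleType]
  set r := Fintype.card α - g.support.card
  rw [Finset.prod_subset (s₂ := insert 1 g.cycleType.toFinset)]
  · rw [Finset.prod_insert h1', Finset.prod_multiset_count, mul_assoc r.factorial,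
      ← Finset.prod_mul_distrib]
    congr 1
    · simp [Multiset.count_eq_zero_of_notMem h1]
    · refine Finset.prod_congr rfl fun j hj => ?_
      have : j ≠ 1 := fun h => h1' (h ▸ hj)
      simp [Multiset.count_replicate, this.symm]
  · intro x
    simp only [Multiset.mem_toFinset, Multiset.mem_add, mem_insert]
    rintro (h | h)
    · exact Or.inr h
    · exact Or.inl (Multiset.eq_of_mem_replicate h)
  · intro x _ hx
    rw [Multiset.mem_toFinset] at hx
    rw [Multiset.count_eq_zero_of_notMem hx]; simp

theorem parts_pow {α : Type*} [Fintype α] [DecidableEq α] (g : Perm α) (m : ℕ) (hm : 0 < m) :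
    (g ^ m).partition.parts = powPartition g.partition.parts m := by
  ext j
  rcases Nat.eq_zero_or_pos j with rfl | hj
  · rw [Multiset.count_eq_zero_of_notMem, Multiset.count_eq_zero_of_notMem]
    · intro h
      obtain ⟨l, hl, h⟩ := Multiset.mem_bind.1 h
      have := Multiset.eq_of_mem_replicate h
      have hl := g.partition.parts_pos hl
      have := Nat.div_pos (Nat.gcd_le_left m hl) (Nat.gcd_pos_of_pos_left m hl)
      omega
    · intro h
      have := (g ^ m).partition.parts_pos h
      omega
  · apply Nat.eq_of_mul_eq_mul_left hj
    rw [count_parts _ _ hj, powPartition, Multiset.count_bind]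
    have hper : ∀ x, Function.minimalPeriod (g ^ m : Perm α) x =
        Function.minimalPeriod g x / (Function.minimalPeriod g x).gcd m := by
      intro x
      rw [← Function.minimalPeriod_iterate_eq_div_gcd hm.ne', Perm.iterate_eq_pow]
    rw [Finset.sum_multiset_map_count, Finset.mul_sum]
    have hpos : ∀ x, 0 < Function.minimalPeriod g x := by
      intro x
      apply Function.minimalPeriod_pos_of_mem_periodicPts
      exact Function.Injective.mem_periodicPts g.injective x
    rw [Finset.card_eq_sum_card_fiberwise (f := fun x => Function.minimalPeriod g x)
      (t := g.partition.parts.toFinset)]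
    · refine Finset.sum_congr rfl fun l hl => ?_
      have hl := g.partition.parts_pos (Multiset.mem_toFinset.1 hl)
      rw [Finset.filter_filter, Multiset.count_replicate]
      by_cases h : l / l.gcd m = j
      · rw [if_pos h, smul_eq_mul]
        have : (univ.filter fun x => Function.minimalPeriod (g ^ m : Perm α) x = j ∧
            Function.minimalPeriod g x = l) = univ.filter fun x => Function.minimalPeriod g x = l := by
          ext x
          simp only [mem_filter, mem_univ, true_and, hper]
          constructor
          · exact fun h => h.2
          · intro h'
            rw [h']; exact ⟨h, rfl⟩
        rw [this, ← count_parts _ _ hl, mul_comm (Multiset.count _ _), ← mul_assoc, ← h,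
          Nat.div_mul_cancel (Nat.gcd_dvd_left l m)]
      · rw [if_neg h, smul_zero, mul_zero, Finset.card_eq_zero, Finset.filter_eq_empty_iff]
        rintro x - ⟨h2, h3⟩
        rw [hper, h3] at h2
        exact h h2
    · intro x _
      simp only [SetLike.mem_coe, Multiset.mem_toFinset]
      rw [← Multiset.count_pos]
      by_contra hc
      have := count_parts g _ (hpos x)
      rw [Nat.eq_zero_of_not_pos hc, mul_zero, eq_comm, Finset.card_eq_zero,
        Finset.filter_eq_empty_iff] at this
      exact this (mem_univ x) rfl

theorem card_conj {α : Type*} [Fintype α] [DecidableEq α] (a b : Perm α) :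
    (univ.filter fun σ : Perm α => a * σ * b⁻¹ = σ).card =
      if a.partition.parts = b.partition.parts then zPart a.partition.parts else 0 := by
  have hiff : a.partition.parts = b.partition.parts ↔ IsConj b a := by
    rw [Perm.partition_eq_of_isConj, Nat.Partition.ext_iff, eq_comm]
  split_ifs with h
  · obtain ⟨τ, hτ⟩ := isConj_iff.1 (hiff.1 h)
    classical
    rw [zPart_parts, Nat.card_eq_fintype_card, Fintype.card_subtype]
    refine Finset.card_bij' (fun σ _ => σ * τ⁻¹) (fun σ _ => σ * τ) ?_ ?_ ?_ ?_
    · intro σ hσ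
      simp only [mem_filter, mem_univ, true_and] at hσ ⊢
      rw [Subgroup.mem_centralizer_singleton_iff]
      rw [mul_inv_eq_iff_eq_mul] at hσ
      rw [← mul_assoc, hσ, ← hτ]; group
    · intro σ hσ
      simp only [mem_filter, mem_univ, true_and] at hσ ⊢
      rw [Subgroup.mem_centralizer_singleton_iff] at hσ
      rw [mul_inv_eq_iff_eq_mul, ← mul_assoc, ← hσ, ← hτ]; group
    · intros; group
    · intros; group
  · rw [Finset.card_eq_zero, Finset.filter_eq_empty_iff]
    intro σ _ hσ
    apply h
    rw [hiff, isConj_iff]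
    refine ⟨σ, ?_⟩
    rw [mul_inv_eq_iff_eq_mul] at hσ
    rw [← hσ]; group

/-- partition of n -/
def partn {n : ℕ} (g : Perm (Fin n)) : Nat.Partition n :=
  ⟨g.partition.parts, g.partition.parts_pos, g.partition.parts_sum.trans (Fintype.card_fin n)⟩

theorem partn_surj {n : ℕ} (ν : Nat.Partition n) : ∃ g : Perm (Fin n), partn g = ν := by
  have hs : (ν.parts.filter (fun l => 2 ≤ l)).sum + (ν.parts.filter (fun l => ¬ 2 ≤ l)).sum = n := by
    rw [← Multiset.sum_add, Multiset.filter_add_not, ν.parts_sum]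
  have hr : ν.parts.filter (fun l => ¬ 2 ≤ l) =
      Multiset.replicate (Multiset.card (ν.parts.filter (fun l => ¬ 2 ≤ l))) 1 := by
    rw [Multiset.eq_replicate_card]
    intro b hb
    have h := Multiset.mem_filter.1 hb
    have := ν.parts_pos h.1
    omega
  obtain ⟨g, hg⟩ := (Perm.exists_with_cycleType_iff (Fin n)
    (m := ν.parts.filter (fun l => 2 ≤ l))).2 ⟨by simp; omega, fun a ha => (Multiset.mem_filter.1 ha).2⟩
  refine ⟨g, ?_⟩
  rw [Nat.Partition.ext_iff]
  change g.partition.parts = _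
  rw [Perm.parts_partition, ← Perm.sum_cycleType, hg, Fintype.card_fin]
  conv_rhs => rw [← Multiset.filter_add_not (fun l => 2 ≤ l) ν.parts]
  congr 1
  generalize Multiset.card (ν.parts.filter (fun l => ¬ 2 ≤ l)) = c at hr
  rw [hr] at hs ⊢
  simp only [Multiset.sum_replicate, smul_eq_mul, mul_one] at hs
  congr 1
  omega

theorem card_partn {n : ℕ} (ν : Nat.Partition n) :
    (univ.filter fun g : Perm (Fin n) => partn g = ν).card * zPart ν.parts = n.factorial := by
  obtain ⟨g, rfl⟩ := partn_surj ν
  have := Perm.card_isConj_mul_eq g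
  rw [← Perm.nat_card_centralizer, ← zPart_parts] at this
  have h2 : n.factorial = (Fintype.card (Fin n)).factorial := by rw [Fintype.card_fin]
  rw [h2, ← this]
  congr 1
  classical
  rw [Nat.card_eq_fintype_card, Fintype.card_subtype]
  congr 1
  ext h
  simp only [mem_filter, mem_univ, true_and, Set.mem_ofPred_eq]
  rw [Perm.partition_eq_of_isConj, Nat.Partition.ext_iff, Nat.Partition.ext_iff, eq_comm]
  rfl

theorem minPer_cycleOn {α : Type*} (g : Perm α) (s : Finset α) (x : α)
    (hc : g.IsCycleOn s) (hm : x ∈ s) : Function.minimalPeriod g x = s.card := by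
  have key : ∀ m : ℕ, Function.minimalPeriod g x ∣ m ↔ s.card ∣ m := by
    intro m
    rw [← hc.pow_apply_eq hm, ← Function.isPeriodicPt_iff_minimalPeriod_dvd, Function.IsPeriodicPt,
      Function.IsFixedPt, Perm.iterate_eq_pow]
  exact Nat.dvd_antisymm ((key _).2 dvd_rfl) ((key _).1 dvd_rfl)

theorem card_map_eq {Q : Type*} [Fintype Q] [DecidableEq Q] (w : Q → ℕ) (k : ℕ)
    (p : Nat.Partition k) :
    (univ.filter fun A : Finset Q => A.val.map w = p.parts).card =
      ∏ j ∈ Finset.Icc 1 k, (univ.filter fun q => w q = j).card.choose (p.parts.count j) := by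
  have hp : ∀ j ∈ p.parts, j ∈ Finset.Icc 1 k := by
    intro j hj
    rw [Finset.mem_Icc]
    refine ⟨p.parts_pos hj, ?_⟩
    have := Multiset.le_sum_of_mem hj
    rwa [p.parts_sum] at this
  have hcount : ∀ (A : Finset Q) (j : ℕ), (A.val.map w).count j = (A.filter fun q => w q = j).card := by
    intro A j
    rw [Multiset.count_map, Finset.card_def, Finset.filter_val]
    simp only [eq_comm]
  have : ∏ j ∈ Finset.Icc 1 k, (univ.filter fun q => w q = j).card.choose (p.parts.count j) =
      ((Finset.Icc 1 k).pi fun j => (univ.filter fun q => w q = j).powersetCard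
        (p.parts.count j)).card := by
    rw [Finset.card_pi]
    simp only [Finset.card_powersetCard]
  rw [this]
  refine Finset.card_bij' (fun A _ => fun j _ => A.filter fun q => w q = j)
    (fun f _ => univ.filter fun q => ∃ h : w q ∈ Finset.Icc 1 k, q ∈ f (w q) h) ?_ ?_ ?_ ?_
  · intro A hA
    simp only [mem_filter, mem_univ, true_and] at hA
    rw [Finset.mem_pi]
    intro j hj
    rw [Finset.mem_powersetCard, ← hcount, hA]
    exact ⟨Finset.filter_subset_filter _ (Finset.subset_univ A), rfl⟩
  · intro f hf
    rw [Finset.mem_pi] at hf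
    simp only [mem_filter, mem_univ, true_and]
    ext j
    rw [hcount]
    by_cases hj : j ∈ Finset.Icc 1 k
    · have h := Finset.mem_powersetCard.1 (hf j hj)
      rw [← h.2]
      congr 1
      ext q
      simp only [mem_filter, mem_univ, true_and]
      constructor
      · rintro ⟨⟨h1, h2⟩, rfl⟩
        exact h2
      · intro hq
        have := h.1 hq
        simp only [mem_filter, mem_univ, true_and] at this
        subst this
        exact ⟨⟨hj, hq⟩, rfl⟩
    · rw [Multiset.count_eq_zero_of_notMem (fun h => hj (hp j h)), Finset.card_eq_zero,
        Finset.filter_eq_empty_iff]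
      intro q hq h
      simp only [mem_filter, mem_univ, true_and] at hq
      exact hj (h ▸ hq.1)
  · intro A hA
    simp only [mem_filter, mem_univ, true_and] at hA
    ext q
    simp only [mem_filter, mem_univ, true_and, and_true, exists_prop]
    constructor
    · exact fun h => h.2
    · intro h
      refine ⟨hp _ ?_, h⟩
      rw [← hA]
      exact Multiset.mem_map_of_mem w h
  · intro f hf
    rw [Finset.mem_pi] at hf
    funext j hj
    ext q
    simp only [mem_filter, mem_univ, true_and]
    constructor
    · rintro ⟨⟨h1, h2⟩, rfl⟩
      exact h2
    · intro hq
      have := (Finset.mem_powersetCard.1 (hf j hj)).1 hq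
      simp only [mem_filter, mem_univ, true_and] at this
      subst this
      exact ⟨⟨hj, hq⟩, rfl⟩

theorem card_sum_eq {Q : Type*} [Fintype Q] [DecidableEq Q] (w : Q → ℕ) (hw : ∀ q, 0 < w q) (k : ℕ) :
    (univ.filter fun A : Finset Q => ∑ q ∈ A, w q = k).card =
      ∑ p : Nat.Partition k, ∏ j ∈ Finset.Icc 1 k,
        (univ.filter fun q => w q = j).card.choose (p.parts.count j) := by
  simp_rw [← card_map_eq]
  rw [← Finset.card_biUnion]
  · congr 1
    ext A
    simp only [mem_filter, mem_univ, true_and, mem_biUnion]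
    constructor
    · intro h
      refine ⟨⟨A.val.map w, ?_, h⟩, rfl⟩
      intro i hi
      obtain ⟨q, _, rfl⟩ := Multiset.mem_map.1 hi
      exact hw q
    · rintro ⟨p, h⟩
      rw [← p.parts_sum, ← h]; rfl
  · intro p _ p' _ hpp
    change Disjoint _ _
    rw [Finset.disjoint_left]
    intro A h h'
    simp only [mem_filter, mem_univ, true_and] at h h'
    exact hpp (Nat.Partition.ext (h.symm.trans h'))

theorem card_fixed {X : Type*} [Fintype X] [DecidableEq X] (h : Perm X) (k : ℕ) :
    (univ.filter fun S : Finset X => S.card = k ∧ S.image h = S).card =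
      ∑ p : Nat.Partition k, ∏ j ∈ Finset.Icc 1 k,
        ((univ.filter fun x => Function.minimalPeriod h x = j).card / j).choose
          (p.parts.count j) := by
  classical
  let mk : X → Quotient (Perm.SameCycle.setoid h) := Quotient.mk _
  have hmk : ∀ x y, mk x = mk y ↔ h.SameCycle x y := fun x y => Quotient.eq
  let w : Quotient (Perm.SameCycle.setoid h) → ℕ := fun q => (univ.filter fun x => mk x = q).card
  have hcyc : ∀ x, h.IsCycleOn (univ.filter fun y => mk y = mk x : Finset X) := by
    intro x
    refine ⟨h.bijOn ?_, ?_⟩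
    · intro y
      simp [hmk]
    · intro y hy z hz
      simp only [coe_filter, mem_univ, true_and, Set.mem_ofPred_eq, hmk] at hy hz
      exact hy.trans hz.symm
  have hwp : ∀ x, Function.minimalPeriod h x = w (mk x) := fun x =>
    minPer_cycleOn h _ x (hcyc x) (by simp)
  have hw : ∀ q, 0 < w q := by
    intro q
    induction q using Quotient.inductionOn with
    | _ x => exact Finset.card_pos.2 ⟨x, by simp [mk]⟩
  have hc : ∀ j, 0 < j → (univ.filter fun x => Function.minimalPeriod h x = j).card / j =
      (univ.filter fun q => w q = j).card := by
    intro j hj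
    apply Nat.div_eq_of_eq_mul_left hj
    rw [Finset.card_eq_sum_card_fiberwise (f := mk) (t := univ.filter fun q => w q = j)]
    · rw [Finset.sum_congr rfl (g := fun _ => j)]
      · rw [Finset.sum_const, smul_eq_mul]
      · intro q hq
        simp only [mem_filter, mem_univ, true_and] at hq
        rw [← hq, Finset.filter_filter]
        congr 1
        ext x
        simp only [mem_filter, mem_univ, true_and, hwp]
        constructor
        · exact fun h => h.2
        · intro hx
          exact ⟨by rw [hx, hq], hx⟩
    · intro x hx
      simp only [coe_filter, mem_univ, true_and, Set.mem_ofPred_eq] at hx ⊢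
      rw [← hwp, hx]
  have e1 : ∑ p : Nat.Partition k, ∏ j ∈ Finset.Icc 1 k,
        ((univ.filter fun x => Function.minimalPeriod h x = j).card / j).choose
          (p.parts.count j) = ∑ p : Nat.Partition k, ∏ j ∈ Finset.Icc 1 k,
        (univ.filter fun q => w q = j).card.choose (p.parts.count j) := by
    refine Finset.sum_congr rfl fun p _ => Finset.prod_congr rfl fun j hj => ?_
    rw [hc j (Finset.mem_Icc.1 hj).1]
  rw [e1, ← card_sum_eq w hw]
  have hback : ∀ S : Finset X, S.image h = S → (univ.filter fun x => mk x ∈ S.image mk) = S := by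
    intro S hS
    ext x
    simp only [mem_filter, mem_univ, true_and, mem_image]
    constructor
    · rintro ⟨y, hy, hyx⟩
      rw [hmk] at hyx
      obtain ⟨i, rfl⟩ := hyx.exists_nat_pow_eq
      clear hyx
      induction i with
      | zero => simpa using hy
      | succ i ih =>
        rw [pow_succ', Perm.mul_apply, ← hS]
        exact Finset.mem_image_of_mem _ ih
    · exact fun hx => ⟨x, hx, rfl⟩
  have hcard : ∀ A : Finset (Quotient (Perm.SameCycle.setoid h)),
      (univ.filter fun x => mk x ∈ A).card = ∑ q ∈ A, w q := by
    intro A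
    rw [Finset.card_eq_sum_card_fiberwise (f := mk) (t := A)]
    · refine Finset.sum_congr rfl fun q hq => ?_
      rw [Finset.filter_filter]
      congr 1
      ext x
      simp only [mem_filter, mem_univ, true_and]
      constructor
      · exact fun h => h.2
      · intro hx
        exact ⟨by rwa [hx], hx⟩
    · intro x hx
      simpa using hx
  refine Finset.card_bij' (fun S _ => S.image mk) (fun A _ => univ.filter fun x => mk x ∈ A)
    ?_ ?_ ?_ ?_
  · intro S hS
    simp only [mem_filter, mem_univ, true_and] at hS ⊢
    rw [← hcard, hback S hS.2, hS.1]
  · intro A hA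
    simp only [mem_filter, mem_univ, true_and] at hA ⊢
    refine ⟨by rw [hcard, hA], ?_⟩
    apply Finset.eq_of_subset_of_card_le
    · intro y hy
      obtain ⟨x, hx, rfl⟩ := Finset.mem_image.1 hy
      simp only [mem_filter, mem_univ, true_and] at hx ⊢
      have : mk (h x) = mk x := by
        rw [hmk, Perm.sameCycle_apply_left]
      rwa [this]
    · rw [Finset.card_image_of_injective _ h.injective]
  · intro S hS
    simp only [mem_filter, mem_univ, true_and] at hS
    exact hback S hS.2
  · intro A hA
    ext q
    simp only [mem_image, mem_filter, mem_univ, true_and]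
    constructor
    · rintro ⟨x, hx, rfl⟩
      exact hx
    · intro hq
      induction q using Quotient.inductionOn with
      | _ x => exact ⟨x, hq, rfl⟩

/-- two-sided multiplication -/
def twoSided {n : ℕ} (g₁ g₂ : Perm (Fin n)) : Perm (Perm (Fin n)) :=
  Equiv.mulLeft g₁ * Equiv.mulRight g₂⁻¹

theorem twoSided_apply {n : ℕ} (g₁ g₂ σ : Perm (Fin n)) : twoSided g₁ g₂ σ = g₁ * σ * g₂⁻¹ := by
  simp [twoSided, mul_assoc]

theorem twoSided_pow {n : ℕ} (g₁ g₂ σ : Perm (Fin n)) (m : ℕ) :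
    (twoSided g₁ g₂ ^ m) σ = g₁ ^ m * σ * (g₂ ^ m)⁻¹ := by
  induction m with
  | zero => simp
  | succ m ih =>
    rw [pow_succ', Perm.mul_apply, ih, twoSided_apply, pow_succ', pow_succ']
    group

theorem Tpair_eq {n : ℕ} (g₁ g₂ : Perm (Fin n)) (j : ℕ) (hj : 0 < j) :
    TpairCard n (partn g₁) (partn g₂) j =
      ((univ.filter fun σ => Function.minimalPeriod (twoSided g₁ g₂) σ = j).card : ℤ) := by
  have key := (ArithmeticFunction.sum_eq_iff_sum_mul_moebius_eq (R := ℤ)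
    (f := fun j => ((univ.filter fun σ => Function.minimalPeriod (twoSided g₁ g₂) σ = j).card : ℤ))
    (g := fun m => ((univ.filter fun σ : Perm (Fin n) => g₁ ^ m * σ * (g₂ ^ m)⁻¹ = σ).card : ℤ))).1 ?_ j hj
  · simp only [Int.cast_id] at key
    rw [← key, TpairCard, Nat.sum_divisorsAntidiagonal' (f := fun a b =>
      (ArithmeticFunction.moebius a : ℤ) *
        ((univ.filter fun σ : Perm (Fin n) => g₁ ^ b * σ * (g₂ ^ b)⁻¹ = σ).card : ℤ))]
    refine Finset.sum_congr rfl fun m hm => ?_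
    have hm := Nat.pos_of_mem_divisors hm
    rw [card_conj, parts_pow _ _ hm, parts_pow _ _ hm]
    change _ * ((zPart (powPartition g₁.partition.parts m) : ℕ) : ℤ) *
      (if powPartition g₁.partition.parts m = powPartition g₂.partition.parts m then 1 else 0) = _
    split_ifs <;> simp
  · intro m hm
    rw [← Nat.cast_sum, Nat.cast_inj]
    rw [← Finset.card_biUnion]
    · congr 1
      ext σ
      simp only [mem_filter, mem_univ, true_and, mem_biUnion, Nat.mem_divisors]
      rw [← twoSided_pow, ← Perm.iterate_eq_pow]
      change _ ↔ Function.IsPeriodicPt _ _ _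
      rw [Function.isPeriodicPt_iff_minimalPeriod_dvd]
      constructor
      · rintro ⟨a, ⟨h, _⟩, rfl⟩
        exact h
      · exact fun h => ⟨_, ⟨h, hm.ne'⟩, rfl⟩
    · intro a _ b _ hab
      change Disjoint _ _
      rw [Finset.disjoint_left]
      intro σ h h'
      simp only [mem_filter, mem_univ, true_and] at h h'
      exact hab (h.symm.trans h')

/-- the action -/
@[reducible] def actSets (n k : ℕ) :
    MulAction (Perm (Fin n) × Perm (Fin n)) {s : Finset (Perm (Fin n)) // s.card = k} where
  smul g x := ⟨x.1.image (twoSided g.1 g.2), by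
    rw [Finset.card_image_of_injective _ (twoSided g.1 g.2).injective, x.2]⟩
  one_smul x := by
    apply Subtype.ext
    change x.1.image (twoSided 1 1) = x.1
    have : (twoSided 1 1 : Perm (Fin n) → Perm (Fin n)) = id := by
      funext σ; simp [twoSided_apply]
    rw [this, Finset.image_id]
  mul_smul g h x := by
    apply Subtype.ext
    change x.1.image (twoSided (g.1 * h.1) (g.2 * h.2)) =
      (x.1.image (twoSided h.1 h.2)).image (twoSided g.1 g.2)
    rw [Finset.image_image]
    refine congrArg (fun f => x.1.image f) ?_
    funext σ
    simp only [Function.comp, twoSided_apply]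
    group

theorem burnside (n k : ℕ) :
    T n k * (n.factorial * n.factorial) = ∑ g₁ : Perm (Fin n), ∑ g₂ : Perm (Fin n),
      (univ.filter fun S : Finset (Perm (Fin n)) =>
        S.card = k ∧ S.image (twoSided g₁ g₂) = S).card := by
  classical
  let _ := actSets n k
  have hB := MulAction.sum_card_fixedBy_eq_card_orbits_mul_card_group
    (Perm (Fin n) × Perm (Fin n)) {s : Finset (Perm (Fin n)) // s.card = k}
  have hT : T n k = Fintype.card (Quotient (MulAction.orbitRel (Perm (Fin n) × Perm (Fin n))
      {s : Finset (Perm (Fin n)) // s.card = k})) := by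
    rw [T, ← Nat.card_eq_fintype_card]
    refine Nat.card_congr (Quot.congrRight fun x y => ?_)
    change _ ↔ x ∈ MulAction.orbit _ y
    rw [MulAction.mem_orbit_symm]
    constructor
    · rintro ⟨g₁, g₂, h⟩
      refine ⟨(g₁, g₂⁻¹), Subtype.ext ?_⟩
      change x.1.image (twoSided g₁ g₂⁻¹) = y.1
      rw [← h]
      refine congrArg (fun f => x.1.image f) ?_
      funext σ
      simp [twoSided_apply]
    · rintro ⟨⟨g₁, g₂⟩, h⟩
      refine ⟨g₁, g₂⁻¹, ?_⟩
      have h' : x.1.image (twoSided g₁ g₂) = y.1 := congrArg Subtype.val h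
      rw [← h']
      refine congrArg (fun f => x.1.image f) ?_
      funext σ
      simp [twoSided_apply]
  rw [← hT, Fintype.card_prod, Fintype.card_perm, Fintype.card_fin] at hB
  rw [← hB, Fintype.sum_prod_type]
  refine Finset.sum_congr rfl fun g₁ _ => Finset.sum_congr rfl fun g₂ _ => ?_
  rw [← Fintype.card_subtype]
  refine Fintype.card_congr
    { toFun := fun x => ⟨x.1.1, x.1.2, congrArg Subtype.val x.2⟩
      invFun := fun S => ⟨⟨S.1, S.2.1⟩, Subtype.ext S.2.2⟩
      left_inv := fun x => rfl
      right_inv := fun x => rfl }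

theorem sum_partn {n : ℕ} (F : Nat.Partition n → ℚ) :
    ∑ g : Perm (Fin n), F (partn g) =
      ∑ ν : Nat.Partition n, (n.factorial : ℚ) / (zPart ν.parts : ℚ) * F ν := by
  rw [← Finset.sum_fiberwise (s := univ) (g := fun g : Perm (Fin n) => partn g)]
  refine Finset.sum_congr rfl fun ν _ => ?_
  rw [Finset.sum_congr rfl (g := fun _ => F ν)]
  · rw [Finset.sum_const, nsmul_eq_mul]
    congr 1
    have h := card_partn ν
    have hz : (zPart ν.parts : ℚ) ≠ 0 := by
      intro h0
      have h0 : zPart ν.parts = 0 := by exact_mod_cast h0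
      rw [h0, mul_zero] at h
      exact n.factorial_ne_zero h.symm
    rw [eq_div_iff hz]
    exact_mod_cast h
  · intro g hg
    rw [(mem_filter.1 hg).2]

/-- The orbit-counting formula:
`T(n,k) = Σ_{ν₁,ν₂ ⊢ n} (1/(z_{ν₁}z_{ν₂})) Σ_{λ ⊢ k} ∏_{j=1}^k binom(|T_{ν₁,ν₂}(j)|/j, m_j(λ))`. -/
theorem orbit_count_formula (n k : ℕ) (hk : k ≤ n.factorial) :
    (T n k : ℚ) = ∑ ν₁ : Nat.Partition n, ∑ ν₂ : Nat.Partition n,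
      (1 / ((zPart ν₁.parts : ℚ) * (zPart ν₂.parts : ℚ))) *
        ∑ p : Nat.Partition k, ∏ j ∈ Finset.Icc 1 k,
          (Nat.choose ((TpairCard n ν₁ ν₂ j).toNat / j) (Multiset.count j p.parts) : ℚ) := by
  have hn : (n.factorial : ℚ) ≠ 0 := by exact_mod_cast n.factorial_ne_zero
  have hB : (T n k : ℚ) * (n.factorial * n.factorial) =
      ∑ g₁ : Perm (Fin n), ∑ g₂ : Perm (Fin n),
        ∑ p : Nat.Partition k, ∏ j ∈ Finset.Icc 1 k,
          (Nat.choose ((TpairCard n (partn g₁) (partn g₂) j).toNat / j)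
            (Multiset.count j p.parts) : ℚ) := by
    have := congrArg (Nat.cast (R := ℚ)) (burnside n k)
    push_cast at this
    rw [this]
    refine Finset.sum_congr rfl fun g₁ _ => Finset.sum_congr rfl fun g₂ _ => ?_
    rw [card_fixed]
    push_cast
    refine Finset.sum_congr rfl fun p _ => Finset.prod_congr rfl fun j hj => ?_
    rw [Tpair_eq _ _ _ (Finset.mem_Icc.1 hj).1, Int.toNat_natCast]
  rw [← mul_left_inj' (mul_ne_zero hn hn), hB]
  generalize hG : (fun ν₁ ν₂ : Nat.Partition n => ∑ p : Nat.Partition k, ∏ j ∈ Finset.Icc 1 k,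
    (Nat.choose ((TpairCard n ν₁ ν₂ j).toNat / j) (Multiset.count j p.parts) : ℚ)) = G
  have hG' := fun a b => congrFun (congrFun hG a) b
  simp only [hG']
  rw [Finset.sum_congr rfl fun g₁ _ => sum_partn (G (partn g₁)),
    sum_partn (fun ν₁ => ∑ ν₂ : Nat.Partition n, (n.factorial : ℚ) / (zPart ν₂.parts : ℚ) * G ν₁ ν₂)]
  rw [Finset.sum_mul]
  refine Finset.sum_congr rfl fun ν₁ _ => ?_
  rw [Finset.sum_mul, Finset.mul_sum]
  refine Finset.sum_congr rfl fun ν₂ _ => ?_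
  simp only [div_eq_mul_inv, mul_inv]
  ring
end

section
/- Let p be a prime number, let n ≥ 1, and let ν be an integer partition of n. Then z_{ν^p} ≤ n! · p^{(1−n)/p} · z_ν, where p^{(1−n)/p} is the real power. Equivalently, for every σ ∈ Sₙ, z_{cycleType(σ^p)} ≤ n! · p^{(1−n)/p} · z_{cycleType(σ)}. -/
open Equiv Finset

/-- The cycle type of a permutation of `Fin n` as a partition of `n`: the lengths of all
cycles, with fixed points counted as parts of size `1`. -/
def fullCycleType {n : ℕ} (σ : Perm (Fin n)) : Multiset ℕ :=
  σ.cycleType + Multiset.replicate (n - σ.cycleType.sum) 1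

lemma aux_two_fact (a b : ℕ) :
    2 * ((a+1).factorial * (b+1).factorial) ≤ (a+1+(b+1)).factorial := by
  have h1 : a.factorial * (b+1).factorial ≤ (a+(b+1)).factorial :=
    Nat.le_of_dvd (Nat.factorial_pos _) (Nat.factorial_mul_factorial_dvd_factorial_add _ _)
  have h2 : (a+1).factorial * b.factorial ≤ (a+1+b).factorial :=
    Nat.le_of_dvd (Nat.factorial_pos _) (Nat.factorial_mul_factorial_dvd_factorial_add _ _)
  have e1 : (a+1+(b+1)).factorial = (a+1+b+1) * (a+1+b).factorial := Nat.factorial_succ _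
  have e2 : a + (b+1) = a+1+b := by ring
  rw [e2] at h1
  have e3 := Nat.factorial_succ a
  have e4 := Nat.factorial_succ b
  rw [e1]
  have h3 := Nat.mul_le_mul_left (a+1) h1
  have h4 := Nat.mul_le_mul_left (b+1) h2
  have h5 : (a+1) * (a.factorial * (b+1).factorial) = (a+1).factorial * (b+1).factorial := by
    rw [e3]; ring
  have h6 : (b+1) * ((a+1).factorial * b.factorial) = (a+1).factorial * (b+1).factorial := by
    rw [e4]; ring
  nlinarith

lemma aux_super (q : ℝ) (h1 : 1 ≤ q) (h2 : q ≤ 2) (N₁ N₂ : ℕ) (P₁ P₂ Q₁ Q₂ : ℝ)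
    (hP₁ : 0 ≤ P₁) (hP₂ : 0 ≤ P₂) (hQ₁ : 0 ≤ Q₁) (hQ₂ : 0 ≤ Q₂)
    (H₁ : P₁ * q ^ (N₁ - 1) ≤ N₁.factorial * Q₁) (H₂ : P₂ * q ^ (N₂ - 1) ≤ N₂.factorial * Q₂) :
    (P₁ * P₂) * q ^ (N₁ + N₂ - 1) ≤ (N₁ + N₂).factorial * (Q₁ * Q₂) := by
  have q0 : 0 ≤ q := by linarith
  have H := mul_le_mul H₁ H₂ (by positivity) (by positivity)
  rcases N₁ with _ | a
  · simp at H ⊢; linarith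
  rcases N₂ with _ | b
  · simp at H ⊢; linarith
  have hf : (2:ℝ) * ((a+1).factorial * (b+1).factorial) ≤ (a+1+(b+1)).factorial := by
    exact_mod_cast aux_two_fact a b
  have e : a + 1 + (b+1) - 1 = a + b + 1 := by omega
  rw [e]
  simp only [Nat.add_sub_cancel] at H
  calc P₁ * P₂ * q ^ (a+b+1) = q * (P₁ * q ^ a * (P₂ * q ^ b)) := by ring
    _ ≤ 2 * (((a+1).factorial * Q₁) * ((b+1).factorial * Q₂)) :=
      mul_le_mul h2 H (by positivity) (by norm_num)
    _ = (2 * ((a+1).factorial * (b+1).factorial)) * (Q₁ * Q₂) := by ring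
    _ ≤ _ := mul_le_mul_of_nonneg_right hf (by positivity)

lemma aux_fact (q : ℝ) (h1 : 1 ≤ q) (h2 : q ≤ 2) (c : ℕ) : q ^ (c - 1) ≤ c.factorial := by
  have : (2:ℕ) ^ (c-1) ≤ c.factorial := by
    rcases c with _ | c
    · simp
    · have := Nat.factorial_mul_pow_le_factorial (m := 1) (n := c)
      simpa [add_comm] using this
  calc q ^ (c-1) ≤ 2 ^ (c-1) := pow_le_pow_left₀ (by linarith) h2 _
    _ ≤ _ := by exact_mod_cast this

lemma aux_local (p : ℕ) (hp : 1 ≤ p) (q : ℝ) (h1 : 1 ≤ q) (h2 : q ≤ 2) (hq : q ^ p = p)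
    (j c b : ℕ) (hj : 1 ≤ j) :
    ((j:ℝ) ^ (c + p * b) * (c + p * b).factorial) * q ^ (j * (c + p * b) - 1) ≤
      (j * (c + p * b)).factorial *
        (((j:ℝ) ^ c * c.factorial) * (((p:ℝ) * j) ^ b * b.factorial)) := by
  have q0 : 0 ≤ q := by linarith
  have hM : q ^ (c + p * b - 1) ≤ c.factorial * ((p:ℝ) ^ b * b.factorial) := by
    calc q ^ (c + p * b - 1) ≤ q ^ ((c - 1) + p * b) := pow_le_pow_right₀ h1 (by omega)
      _ = q ^ (c-1) * (p:ℝ) ^ b := by rw [pow_add, pow_mul, hq]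
      _ ≤ c.factorial * (p:ℝ) ^ b :=
        mul_le_mul_of_nonneg_right (aux_fact q h1 h2 c) (by positivity)
      _ ≤ _ := by
        have : (1:ℝ) ≤ b.factorial := by exact_mod_cast Nat.factorial_pos b
        gcongr
        exact le_mul_of_one_le_right (by positivity) this
  obtain ⟨M, hMdef⟩ : ∃ M, M = c + p * b := ⟨_, rfl⟩
  rw [← hMdef] at hM ⊢
  rcases Nat.eq_zero_or_pos M with h0 | hpos
  · have hc : c = 0 := by omega
    have hb : b = 0 := by
      rcases Nat.mul_eq_zero.mp (show p * b = 0 by omega) with h | h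
      · omega
      · exact h
    subst hc hb h0; simp
  rcases Nat.lt_or_ge j 2 with hj2 | hj2
  · have : j = 1 := by omega
    subst this
    simp only [Nat.cast_one, one_pow, one_mul, mul_one]
    gcongr
  obtain ⟨k, rfl⟩ : ∃ k, j = k + 2 := ⟨j - 2, by omega⟩
  have hfac : M.factorial * 2 ^ (k * M) * ((k+1) * M + 1) ^ M ≤ ((k+2) * M).factorial := by
    calc _ ≤ M.factorial * (M+1) ^ (k * M) * ((k+1) * M + 1) ^ M := by
          gcongr; omega
      _ ≤ (M + k * M).factorial * ((k+1) * M + 1) ^ M := by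
          gcongr; exact Nat.factorial_mul_pow_le_factorial
      _ = ((k+1) * M).factorial * ((k+1) * M + 1) ^ M := by ring_nf
      _ ≤ ((k+1) * M + M).factorial := Nat.factorial_mul_pow_le_factorial
      _ = _ := by ring_nf
  obtain ⟨X, hX⟩ : ∃ X, X = (k+1) * M + 1 := ⟨_, rfl⟩
  rw [← hX] at hfac
  have hXj : k + 2 ≤ X := by rw [hX]; nlinarith
  have hXb : p ^ b ≤ X ^ b := by
    rcases Nat.eq_zero_or_pos b with h | h
    · simp [h]
    · apply Nat.pow_le_pow_left
      rw [hX, hMdef]; nlinarith [Nat.mul_le_mul_left p h, Nat.zero_le (k * (c + p * b))]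
  have hXq : q ≤ X := by
    have : (2:ℝ) ≤ X := by exact_mod_cast (by omega : 2 ≤ X)
    linarith
  have hXj' : ((k+2:ℕ):ℝ) ≤ X := by exact_mod_cast hXj
  have hXb' : (p:ℝ)^b ≤ (X:ℝ)^b := by exact_mod_cast hXb
  have hfac' : (M.factorial:ℝ) * 2 ^ (k * M) * (X:ℝ) ^ M ≤ ((k+2) * M).factorial := by
    exact_mod_cast hfac
  obtain ⟨r, rfl⟩ : ∃ r, p = r + 1 := ⟨p - 1, by omega⟩
  obtain ⟨J, hJ⟩ : ∃ J : ℝ, J = ((k+2:ℕ):ℝ) := ⟨_, rfl⟩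
  have hJ0 : 0 ≤ J := by rw [hJ]; positivity
  rw [← hJ] at hXj' ⊢
  have key : J ^ ((r+1) * b) * q ^ M ≤ (X:ℝ) ^ M * J ^ b := by
    calc J ^ ((r+1) * b) * q ^ M = J ^ (r*b) * q ^ c * ((r+1:ℕ):ℝ) ^ b * J ^ b := by
          rw [hMdef, pow_add, pow_mul q, hq]; ring
      _ ≤ (X:ℝ) ^ (r * b) * (X:ℝ) ^ c * (X:ℝ) ^ b * J ^ b := by gcongr
      _ = _ := by rw [hMdef]; ring
  have e : (k+2) * M - 1 = (M - 1) + k * M + M := by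
    have : (k+2) * M = k * M + M + M := by ring
    omega
  rw [e]
  calc J ^ M * M.factorial * q ^ (M - 1 + k * M + M)
      = J ^ c * M.factorial * q ^ (k*M) * q ^ (M-1) * (J ^ ((r+1) * b) * q ^ M) := by
        nth_rewrite 1 [hMdef]; ring
    _ ≤ J ^ c * M.factorial * 2 ^ (k*M) * (c.factorial * (((r+1:ℕ):ℝ) ^ b * b.factorial)) *
        ((X:ℝ) ^ M * J ^ b) := by gcongr
    _ = (M.factorial * 2 ^ (k*M) * (X:ℝ)^M) *
        (J ^ c * c.factorial * ((((r+1:ℕ):ℝ) * J) ^ b * b.factorial)) := by ring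
    _ ≤ _ := by gcongr

lemma aux_prod (q : ℝ) (h1 : 1 ≤ q) (h2 : q ≤ 2) (S : Finset ℕ) (N : ℕ → ℕ) (P Q : ℕ → ℝ)
    (hP : ∀ j, 0 ≤ P j) (hQ : ∀ j, 0 ≤ Q j)
    (H : ∀ j ∈ S, P j * q ^ (N j - 1) ≤ (N j).factorial * Q j) :
    (∏ j ∈ S, P j) * q ^ (∑ j ∈ S, N j - 1) ≤ (∑ j ∈ S, N j).factorial * ∏ j ∈ S, Q j := by
  classical
  induction S using Finset.induction_on with
  | empty => simp
  | insert a s ha ih =>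
    rw [Finset.prod_insert ha, Finset.prod_insert ha, Finset.sum_insert ha]
    exact aux_super q h1 h2 _ _ _ _ _ _ (hP a) (Finset.prod_nonneg fun i _ => hP i) (hQ a)
      (Finset.prod_nonneg fun i _ => hQ i) (H a (by simp)) (ih fun j hj => H j (by simp [hj]))

lemma aux_split {α : Type*} [CommMonoid α] (p n : ℕ) (hp : 1 ≤ p) (g : ℕ → α)
    (hg : ∀ j, n < j → g j = 1) :
    ∏ j ∈ Icc 1 n, g j =
      ∏ j ∈ Icc 1 n, ((if p ∣ j then 1 else g j) * g (p * j)) := by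
  rw [Finset.prod_mul_distrib, ← Finset.prod_filter_mul_prod_filter_not (Icc 1 n) (p ∣ ·), mul_comm]
  congr 1
  · rw [Finset.prod_filter]
    exact Finset.prod_congr rfl fun j _ => by split_ifs <;> simp_all
  · symm
    refine Finset.prod_bij_ne_one (fun k _ _ => p * k) ?_ ?_ ?_ ?_
    · intro k hk h
      have : p * k ≤ n := by
        by_contra h'
        exact h (hg _ (by omega))
      simp only [Finset.mem_filter, Finset.mem_Icc] at hk ⊢
      exact ⟨⟨by nlinarith, this⟩, dvd_mul_right _ _⟩
    · intro a _ _ b _ _ h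
      exact Nat.eq_of_mul_eq_mul_left hp h
    · intro b hb h
      simp only [Finset.mem_filter, Finset.mem_Icc] at hb
      obtain ⟨⟨h1, h2⟩, k, rfl⟩ := hb
      refine ⟨k, ?_, h, rfl⟩
      simp only [Finset.mem_Icc]
      exact ⟨by rcases k with _ | k <;> simp_all, by nlinarith⟩
    · intros; rfl

lemma aux_count (p : ℕ) (hp : p.Prime) (ν : Multiset ℕ) (j : ℕ) :
    (powPartition ν p).count j = (if p ∣ j then 0 else ν.count j) + p * ν.count (p * j) := by
  induction ν using Multiset.induction_on with
  | empty => simp [powPartition]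
  | cons a s ih =>
    have : powPartition (a ::ₘ s) p = Multiset.replicate (a.gcd p) (a / a.gcd p) + powPartition s p := by
      simp [powPartition]
    rw [this, Multiset.count_add, ih, Multiset.count_replicate, Multiset.count_cons, Multiset.count_cons]
    by_cases ha : p ∣ a
    · obtain ⟨k, rfl⟩ := ha
      have hg : (p * k).gcd p = p := Nat.gcd_eq_right (dvd_mul_right _ _)
      rw [hg, Nat.mul_div_cancel_left _ hp.pos]
      have h1 : (p * j = p * k) ↔ k = j := by
        rw [Nat.mul_right_inj hp.ne_zero]; exact eq_comm
      by_cases hpj : p ∣ j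
      · simp only [h1, hpj, if_true]; split_ifs <;> ring
      · have h2 : j ≠ p * k := by rintro rfl; exact hpj (dvd_mul_right _ _)
        simp only [h1, hpj, if_false, h2]; split_ifs <;> ring
    · have hg : a.gcd p = 1 := ((Nat.Prime.coprime_iff_not_dvd hp).2 ha).symm
      have h2 : p * j ≠ a := by rintro rfl; exact ha (dvd_mul_right _ _)
      rw [hg, Nat.div_one]
      simp only [h2, if_false]
      by_cases hpj : p ∣ j
      · have : a ≠ j := by rintro rfl; exact ha hpj
        simp [hpj, this]
      · simp only [hpj, if_false, eq_comm (a := a)]; split_ifs <;> ring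

lemma aux_zPart (n : ℕ) (ν : Multiset ℕ) (h : ∀ i ∈ ν, i ∈ Icc 1 n) :
    zPart ν = ∏ j ∈ Icc 1 n, j ^ ν.count j * (ν.count j).factorial := by
  unfold zPart
  refine Finset.prod_subset (fun i hi => h i (by simpa using hi)) ?_
  intro i _ hi
  have : ν.count i = 0 := Multiset.count_eq_zero.2 (by simpa using hi)
  simp [this]

lemma aux_part1 (p n : ℕ) (hp : p.Prime) (hn : 1 ≤ n) (ν : Nat.Partition n) :
      (zPart (powPartition ν.parts p) : ℝ) ≤
        (n.factorial : ℝ) * (p : ℝ) ^ ((1 - (n : ℝ)) / (p : ℝ)) * (zPart ν.parts : ℝ) := by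
  have hp1 : 1 ≤ p := hp.one_lt.le
  have hmem : ∀ i ∈ ν.parts, i ∈ Icc 1 n := fun i hi => by
    have h1 := ν.parts_pos hi
    have h2 := Multiset.le_sum_of_mem hi
    rw [ν.parts_sum] at h2
    simp; omega
  have hcz : ∀ j, n < j → ν.parts.count j = 0 := fun j hj =>
    Multiset.count_eq_zero.2 fun h => by have := hmem j h; simp at this; omega
  have hmem' : ∀ i ∈ powPartition ν.parts p, i ∈ Icc 1 n := by
    intro i hi
    simp only [powPartition, Multiset.mem_bind, Multiset.mem_replicate] at hi
    obtain ⟨a, ha, h0, rfl⟩ := hi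
    have := hmem a ha
    simp only [Finset.mem_Icc] at this ⊢
    exact ⟨Nat.div_pos (Nat.gcd_le_left _ this.1) (by omega), (Nat.div_le_self _ _).trans this.2⟩
  let c : ℕ → ℕ := fun j => if p ∣ j then 0 else ν.parts.count j
  let b : ℕ → ℕ := fun j => ν.parts.count (p * j)
  have hz1 : zPart (powPartition ν.parts p) =
      ∏ j ∈ Icc 1 n, j ^ (c j + p * b j) * (c j + p * b j).factorial := by
    rw [aux_zPart n _ hmem']
    exact Finset.prod_congr rfl fun j _ => by rw [aux_count p hp]
  have hz2 : zPart ν.parts =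
      ∏ j ∈ Icc 1 n, (j ^ c j * (c j).factorial) * ((p * j) ^ b j * (b j).factorial) := by
    rw [aux_zPart n _ hmem, aux_split p n hp1 _ (fun j hj => by simp [hcz j hj])]
    refine Finset.prod_congr rfl fun j _ => ?_
    simp only [c, b]
    congr 1
    split_ifs <;> simp
  have hsum : ∑ j ∈ Icc 1 n, j * (c j + p * b j) = n := by
    have h1 : ∑ j ∈ Icc 1 n, j * ν.parts.count j = n := by
      conv_rhs => rw [← ν.parts_sum, Finset.sum_multiset_count]
      simp only [smul_eq_mul]
      symm
      rw [Finset.sum_subset (s₂ := Icc 1 n) (fun i hi => hmem i (by simpa using hi))]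
      · exact Finset.sum_congr rfl fun j _ => mul_comm _ _
      · intro i _ hi
        have : ν.parts.count i = 0 := Multiset.count_eq_zero.2 (by simpa using hi)
        simp [this]
    have h2 := aux_split (α := Multiplicative ℕ) p n hp1
      (fun j => Multiplicative.ofAdd (j * ν.parts.count j))
      (fun j hj => by simp [hcz j hj])
    have h3 : ∑ j ∈ Icc 1 n, j * ν.parts.count j =
      ∑ j ∈ Icc 1 n, ((if p ∣ j then 0 else j * ν.parts.count j) + (p * j) * ν.parts.count (p * j)) := by
      exact h2
    rw [h1] at h3
    refine Eq.trans (Finset.sum_congr rfl fun j _ => ?_) h3.symm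
    simp only [c, b]
    split_ifs <;> ring
  obtain ⟨q, hqd⟩ : ∃ q : ℝ, q = (p:ℝ) ^ ((1:ℝ) / p) := ⟨_, rfl⟩
  have hp0 : (0:ℝ) < p := by exact_mod_cast hp.pos
  have hq : q ^ p = p := by
    rw [hqd, ← Real.rpow_natCast, ← Real.rpow_mul hp0.le, one_div_mul_cancel hp0.ne', Real.rpow_one]
  have hq1 : 1 ≤ q := by
    rw [hqd]; exact Real.one_le_rpow (by exact_mod_cast hp1) (by positivity)
  have hq2 : q ≤ 2 := by
    refine le_of_pow_le_pow_left₀ hp.ne_zero (by norm_num) ?_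
    rw [hq]; exact_mod_cast (Nat.lt_two_pow_self (n := p)).le
  have main := aux_prod q hq1 hq2 (Icc 1 n) (fun j => j * (c j + p * b j))
    (fun j => (j:ℝ) ^ (c j + p * b j) * (c j + p * b j).factorial)
    (fun j => ((j:ℝ) ^ c j * (c j).factorial) * (((p:ℝ) * j) ^ b j * (b j).factorial))
    (fun j => by positivity) (fun j => by positivity)
    (fun j hj => aux_local p hp1 q hq1 hq2 hq j (c j) (b j) (by simp at hj; omega))
  simp only [hsum] at main
  have hexp : (p : ℝ) ^ ((1 - (n : ℝ)) / (p : ℝ)) = (q ^ (n-1))⁻¹ := by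
    rw [hqd, ← Real.rpow_natCast, ← Real.rpow_mul hp0.le, ← Real.rpow_neg hp0.le]
    congr 1
    push_cast [Nat.cast_sub hn]
    field_simp
    ring
  have hqpos : 0 < q ^ (n-1) := by positivity
  rw [hexp, hz1, hz2]
  push_cast
  rw [mul_right_comm, ← div_eq_mul_inv, le_div_iff₀ hqpos]
  exact main

lemma aux_cycle {α : Type*} [Fintype α] [DecidableEq α] (σ : Perm α) (hσ : σ.IsCycle) (m : ℕ) :
    (σ ^ m).cycleType = (powPartition σ.cycleType m).filter (· ≠ 1) := by
  have hP : powPartition σ.cycleType m = Multiset.replicate ((orderOf σ).gcd m)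
      (orderOf σ / (orderOf σ).gcd m) := by
    rw [hσ.cycleType, ← hσ.orderOf]; simp [powPartition]
  have hopos : 0 < orderOf σ := orderOf_pos σ
  have hgpos : 0 < (orderOf σ).gcd m := Nat.gcd_pos_of_pos_left _ hopos
  have hord : orderOf (σ ^ m) = orderOf σ / (orderOf σ).gcd m := orderOf_pow σ
  rw [hP, ← hord]
  by_cases h1 : σ ^ m = 1
  · rw [h1, Perm.cycleType_one, orderOf_one]
    symm
    rw [Multiset.filter_eq_nil]
    intro a ha
    simpa using Multiset.eq_of_mem_replicate ha
  · have hne : orderOf (σ ^ m) ≠ 1 := by rwa [Ne, orderOf_eq_one_iff]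
    rw [Multiset.filter_eq_self.2 (fun a ha => by rw [Multiset.eq_of_mem_replicate ha]; exact hne)]
    have hall : ∀ d ∈ (σ ^ m).cycleType, d = orderOf (σ ^ m) := by
      intro d hd
      refine Nat.dvd_antisymm (Perm.dvd_of_mem_cycleType hd) ?_
      obtain ⟨c, τ, hc, hdis, hcyc, hcard⟩ := Perm.mem_cycleType_iff.1 hd
      obtain ⟨x, hx⟩ := hcyc.nonempty_support
      have hτx : τ x = x := (hdis x).resolve_left (Perm.mem_support.1 hx)
      have hfix : ((σ ^ m) ^ d) x = x := by
        rw [hc, hdis.commute.mul_pow, Perm.mul_apply,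
          Perm.pow_apply_eq_self_of_apply_eq_self hτx, ← hcard, ← hcyc.orderOf, pow_orderOf_eq_one]
        rfl
      have hσx : σ x ≠ x := by
        intro h
        have h2 : (σ ^ m) x = x := Perm.pow_apply_eq_self_of_apply_eq_self h m
        rw [hc, Perm.mul_apply, hτx] at h2
        exact Perm.mem_support.1 hx h2
      rw [← pow_mul] at hfix
      have := (hσ.pow_eq_one_iff' hσx).2 hfix
      rw [pow_mul] at this
      exact orderOf_dvd_of_pow_eq_one this
    have hrep := Multiset.eq_replicate_of_mem hall
    have hsupp : (σ ^ m).support = σ.support :=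
      hσ.support_pow_eq_iff.2 fun h => h1 (orderOf_dvd_iff_pow_eq_one.1 h)
    have hs : (σ ^ m).cycleType.sum = orderOf σ := by
      rw [Perm.sum_cycleType, hsupp, hσ.orderOf]
    rw [hrep, Multiset.sum_replicate, smul_eq_mul] at hs
    rw [hrep]
    congr 1
    have h3 : (orderOf σ).gcd m * orderOf (σ ^ m) = orderOf σ := by
      rw [hord]; exact Nat.mul_div_cancel' (Nat.gcd_dvd_left _ _)
    exact Nat.eq_of_mul_eq_mul_right (orderOf_pos (σ ^ m)) (hs.trans h3.symm)

lemma aux_add (μ ν : Multiset ℕ) (m : ℕ) :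
    powPartition (μ + ν) m = powPartition μ m + powPartition ν m := by
  simp [powPartition]

lemma aux_cycleType {α : Type*} [Fintype α] [DecidableEq α] (σ : Perm α) (m : ℕ) :
    (σ ^ m).cycleType = (powPartition σ.cycleType m).filter (· ≠ 1) := by
  induction σ using Perm.cycle_induction_on with
  | base_one => simp [powPartition]
  | base_cycles σ h => exact aux_cycle σ h m
  | induction_disjoint σ τ h hc ih1 ih2 =>
    rw [h.commute.mul_pow, (h.pow_disjoint_pow m m).cycleType_mul, h.cycleType_mul, aux_add,
      Multiset.filter_add, ih1, ih2]

lemma aux_sum (ν : Multiset ℕ) (m : ℕ) : (powPartition ν m).sum = ν.sum := by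
  induction ν using Multiset.induction_on with
  | empty => simp [powPartition]
  | cons a s ih =>
    have : powPartition (a ::ₘ s) m =
        Multiset.replicate (a.gcd m) (a / a.gcd m) + powPartition s m := by
      simp [powPartition]
    rw [this, Multiset.sum_add, ih, Multiset.sum_replicate, Multiset.sum_cons, smul_eq_mul,
      Nat.mul_div_cancel' (Nat.gcd_dvd_left _ _)]

lemma aux_fullsum {n : ℕ} (σ : Perm (Fin n)) : (fullCycleType σ).sum = n := by
  have := σ.sum_cycleType_le
  simp only [Fintype.card_fin] at this
  simp [fullCycleType]
  omega

lemma aux_full {n : ℕ} (σ : Perm (Fin n)) (m : ℕ) :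
    fullCycleType (σ ^ m) = powPartition (fullCycleType σ) m := by
  have h1 : powPartition (fullCycleType σ) m = powPartition σ.cycleType m +
      Multiset.replicate (n - σ.cycleType.sum) 1 := by
    rw [fullCycleType, aux_add]
    congr 1
    simp only [powPartition]
    generalize n - σ.cycleType.sum = k
    induction k with
    | zero => simp
    | succ k ih => rw [Multiset.replicate_succ, Multiset.cons_bind, ih]; simp
  have h2 : (powPartition (fullCycleType σ) m).filter (· ≠ 1) = (σ ^ m).cycleType := by
    rw [h1, Multiset.filter_add, ← aux_cycleType]
    have : (Multiset.replicate (n - σ.cycleType.sum) 1).filter (· ≠ 1) = 0 := by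
      rw [Multiset.filter_eq_nil]
      intro a ha
      simpa using Multiset.eq_of_mem_replicate ha
    rw [this, add_zero]
  have h3 := Multiset.filter_add_not (· ≠ 1) (powPartition (fullCycleType σ) m)
  have h4 : (powPartition (fullCycleType σ) m).filter (fun a => ¬ (a ≠ 1)) =
      Multiset.replicate (Multiset.card ((powPartition (fullCycleType σ) m).filter
        (fun a => ¬ (a ≠ 1)))) 1 :=
    Multiset.eq_replicate_of_mem fun a ha => by simpa using (Multiset.mem_filter.1 ha).2
  have h5 := aux_sum (fullCycleType σ) m
  rw [aux_fullsum] at h5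
  rw [h2, h4] at h3
  rw [← h3] at h5 ⊢
  rw [Multiset.sum_add, Multiset.sum_replicate, smul_eq_mul, mul_one] at h5
  rw [fullCycleType]
  congr 2
  omega

/-- For a prime `p` and a partition `ν` of `n`, `z_{ν^p} ≤ n!·p^{(1−n)/p}·z_ν`;
equivalently, `z_{cycleType(σ^p)} ≤ n!·p^{(1−n)/p}·z_{cycleType(σ)}` for all `σ ∈ Sₙ`. -/
theorem zPart_pow_prime_le (p n : ℕ) (hp : p.Prime) (hn : 1 ≤ n) :
    (∀ ν : Nat.Partition n,
      (zPart (powPartition ν.parts p) : ℝ) ≤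
        (n.factorial : ℝ) * (p : ℝ) ^ ((1 - (n : ℝ)) / (p : ℝ)) * (zPart ν.parts : ℝ)) ∧
    (∀ σ : Perm (Fin n),
      (zPart (fullCycleType (σ ^ p)) : ℝ) ≤
        (n.factorial : ℝ) * (p : ℝ) ^ ((1 - (n : ℝ)) / (p : ℝ)) *
          (zPart (fullCycleType σ) : ℝ)) := by
  refine ⟨aux_part1 p n hp hn, fun σ => ?_⟩
  rw [aux_full]
  refine aux_part1 p n hp hn ⟨fullCycleType σ, ?_, aux_fullsum σ⟩
  intro i hi
  rcases Multiset.mem_add.1 hi with h | h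
  · exact lt_trans zero_lt_one (Perm.one_lt_of_mem_cycleType h)
  · rw [Multiset.eq_of_mem_replicate h]; exact zero_lt_one
end

section
/- Let ν₁, ν₂ be partitions of n and let g₁, g₂ ∈ Sₙ have cycle types ν₁, ν₂ respectively. Then |T_{g₁,g₂}(1)| = z_{ν₁} if ν₁ = ν₂ and 0 otherwise. Moreover, for every prime p, |T_{g₁,g₂}(p)| ≤ p^{(1−n)/p} · n! · √(z_{ν₁} · z_{ν₂}) (with p^{(1−n)/p} the real power), and for every j ≥ 1, |T_{g₁,g₂}(j)| ≤ n!. -/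
open Equiv Finset

/-- `TpairSet g₁ g₂ j` is the set of permutations `σ` with `g₁ʲ σ g₂ʲ = σ` and
`g₁ⁱ σ g₂ⁱ ≠ σ` for all `1 ≤ i < j`. -/
def TpairSet {n : ℕ} (g₁ g₂ : Perm (Fin n)) (j : ℕ) : Set (Perm (Fin n)) :=
  {σ | g₁ ^ j * σ * g₂ ^ j = σ ∧ ∀ i : ℕ, 1 ≤ i → i < j → g₁ ^ i * σ * g₂ ^ i ≠ σ}

lemma zPart_eq_prod (ν : Multiset ℕ) (S : Finset ℕ) (h : ν.toFinset ⊆ S) :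
    zPart ν = ∏ j ∈ S, j ^ ν.count j * (ν.count j).factorial := by
  unfold zPart
  apply Finset.prod_subset h
  intro x _ hx
  rw [Multiset.mem_toFinset] at hx
  simp [Multiset.count_eq_zero_of_notMem hx]

lemma zPart_cons (ν : Multiset ℕ) (k : ℕ) :
    zPart (k ::ₘ ν) = zPart ν * (k * (ν.count k + 1)) := by
  have h1 : k ∈ (k ::ₘ ν).toFinset := by simp
  rw [zPart_eq_prod ν (k ::ₘ ν).toFinset (by simp), zPart,
    ← Finset.mul_prod_erase _ _ h1, ← Finset.mul_prod_erase _ _ h1]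
  have : ∏ x ∈ (k ::ₘ ν).toFinset.erase k, x ^ (k ::ₘ ν).count x * ((k ::ₘ ν).count x).factorial
      = ∏ x ∈ (k ::ₘ ν).toFinset.erase k, x ^ ν.count x * (ν.count x).factorial := by
    apply Finset.prod_congr rfl
    intro x hx
    rw [Multiset.count_cons_of_ne (Finset.ne_of_mem_erase hx)]
  rw [this, Multiset.count_cons_self, Nat.factorial_succ, pow_succ]
  ring

lemma zPart_zero : zPart 0 = 1 := by simp [zPart]

lemma count_mul_le_sum (ν : Multiset ℕ) (k : ℕ) : k * ν.count k ≤ ν.sum := by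
  induction ν using Multiset.induction_on with
  | empty => simp
  | cons a s ih =>
    rw [Multiset.count_cons, Multiset.sum_cons]
    split_ifs with h
    · subst h; rw [mul_add]; omega
    · rw [add_zero]; omega

lemma zPart_cons_le (ν : Multiset ℕ) (k : ℕ) :
    zPart (k ::ₘ ν) ≤ zPart ν * (ν.sum + k) := by
  rw [zPart_cons]
  have := count_mul_le_sum ν k
  gcongr
  rw [mul_add]; omega

lemma le_zPart_cons (ν : Multiset ℕ) (k : ℕ) :
    zPart ν * k ≤ zPart (k ::ₘ ν) := by
  rw [zPart_cons]
  gcongr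
  nlinarith [Nat.zero_le (ν.count k)]

lemma zPart_replicate_one (b : ℕ) : zPart (Multiset.replicate b 1) = b.factorial := by
  induction b with
  | zero => simp [zPart]
  | succ b ih =>
    rw [Multiset.replicate_succ, zPart_cons, ih, Multiset.count_replicate_self, Nat.factorial_succ]
    ring

lemma zPart_add_replicate_one (ν : Multiset ℕ) (h : ν.count 1 = 0) (b : ℕ) :
    zPart (ν + Multiset.replicate b 1) = zPart ν * b.factorial := by
  induction b with
  | zero => simp
  | succ b ih =>
    rw [Multiset.replicate_succ, Multiset.add_cons, zPart_cons, ih, Multiset.count_add,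
      Multiset.count_replicate_self, Nat.factorial_succ, h]
    ring

lemma zPart_replicate_add (ν : Multiset ℕ) (k t : ℕ) :
    zPart (Multiset.replicate t k + ν) * ν.sum.factorial
      ≤ zPart ν * (ν.sum + t * k).factorial := by
  induction t with
  | zero => simp
  | succ t ih =>
    rcases Nat.eq_zero_or_pos k with rfl | hk
    · rw [Multiset.replicate_succ, Multiset.cons_add]
      have := zPart_cons_le (Multiset.replicate t 0 + ν) 0
      rw [zPart_cons]; simp
    rw [Multiset.replicate_succ, Multiset.cons_add]
    have h1 := zPart_cons_le (Multiset.replicate t k + ν) k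
    have h2 : (Multiset.replicate t k + ν).sum + k = ν.sum + (t + 1) * k := by
      simp; ring
    rw [h2] at h1
    have h3 : (ν.sum + (t + 1) * k).factorial =
        (ν.sum + (t + 1) * k) * (ν.sum + (t + 1) * k - 1).factorial :=
      (Nat.mul_factorial_pred (by positivity)).symm
    have h4 : (ν.sum + t * k).factorial ≤ (ν.sum + (t + 1) * k - 1).factorial := by
      apply Nat.factorial_le
      rw [add_mul]; omega
    rw [h3]
    calc _ ≤ zPart (Multiset.replicate t k + ν) * (ν.sum + (t + 1) * k) * ν.sum.factorial := by
            gcongr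
      _ = (zPart (Multiset.replicate t k + ν) * ν.sum.factorial) * (ν.sum + (t + 1) * k) := by ring
      _ ≤ (zPart ν * (ν.sum + t * k).factorial) * (ν.sum + (t + 1) * k) := by gcongr
      _ ≤ (zPart ν * (ν.sum + (t + 1) * k - 1).factorial) * (ν.sum + (t + 1) * k) := by gcongr
      _ = _ := by ring

lemma zPart_replicate_add' (ν : Multiset ℕ) (k p : ℕ) (hk : 0 < k) (hp : 0 < p) :
    zPart (Multiset.replicate p k + ν) * ν.sum.factorial * p ^ (k - 1)
      ≤ zPart ν * (ν.sum + p * k).factorial := by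
  obtain ⟨t, rfl⟩ : ∃ t, p = t + 1 := ⟨p - 1, by omega⟩
  have ih := zPart_replicate_add ν k t
  rw [Multiset.replicate_succ, Multiset.cons_add]
  have h1 := zPart_cons_le (Multiset.replicate t k + ν) k
  have h2 : (Multiset.replicate t k + ν).sum + k = ν.sum + (t + 1) * k := by
    simp; ring
  rw [h2] at h1
  have h3 : (ν.sum + (t + 1) * k).factorial =
      (ν.sum + (t + 1) * k) * (ν.sum + (t + 1) * k - 1).factorial :=
    (Nat.mul_factorial_pred (by positivity)).symm
  have h4 : (ν.sum + t * k).factorial * (t + 1) ^ (k - 1)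
      ≤ (ν.sum + (t + 1) * k - 1).factorial := by
    have h5 : ν.sum + (t + 1) * k - 1 = ν.sum + t * k + (k - 1) := by
      rw [add_mul]; omega
    rw [h5]
    refine le_trans ?_ Nat.factorial_mul_pow_le_factorial
    gcongr
    have := Nat.le_mul_of_pos_right t hk
    omega
  rw [h3]
  calc _ ≤ zPart (Multiset.replicate t k + ν) * (ν.sum + (t + 1) * k) * ν.sum.factorial
            * (t + 1) ^ (k - 1) := by gcongr
    _ = (zPart (Multiset.replicate t k + ν) * ν.sum.factorial) * (ν.sum + (t + 1) * k)
            * (t + 1) ^ (k - 1) := by ring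
    _ ≤ (zPart ν * (ν.sum + t * k).factorial) * (ν.sum + (t + 1) * k) * (t + 1) ^ (k - 1) := by
          gcongr
    _ = zPart ν * ((ν.sum + t * k).factorial * (t + 1) ^ (k - 1)) * (ν.sum + (t + 1) * k) := by
          ring
    _ ≤ (zPart ν * (ν.sum + (t + 1) * k - 1).factorial) * (ν.sum + (t + 1) * k) := by gcongr
    _ = _ := by ring

/-- The parts of the `p`-th power of an `l`-cycle. -/
def powParts (p l : ℕ) : Multiset ℕ :=
  if p ∣ l then Multiset.replicate p (l / p) else {l}

lemma powParts_sum (p l : ℕ) : (powParts p l).sum = l := by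
  unfold powParts
  split_ifs with h
  · simp [Nat.mul_div_cancel' h]
  · simp

lemma bind_powParts_sum (p : ℕ) (μ : Multiset ℕ) : (μ.bind (powParts p)).sum = μ.sum := by
  rw [Multiset.sum_bind]; simp [powParts_sum]

lemma two_pow_le_fact (n : ℕ) : 2 ^ n ≤ 2 * n.factorial := by
  rcases n with _ | n
  · simp
  · have := Nat.factorial_mul_pow_le_factorial (m := 1) (n := n)
    rw [pow_succ, add_comm n 1]; simp at this; omega

lemma main_ineq (p : ℕ) (hp : p.Prime) (q : ℝ) (hq1 : 1 ≤ q) (hq2 : q ≤ 2) (hqp : q ^ p = p)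
    (b : ℕ) (μ : Multiset ℕ) (hμ : ∀ l ∈ μ, 2 ≤ l) :
    q ^ (μ.sum + b) * (zPart (μ.bind (powParts p) + Multiset.replicate b 1) : ℝ)
      ≤ q * ((μ.sum + b).factorial * zPart (μ + Multiset.replicate b 1)) := by
  have hkey : ∀ m : ℕ, q ^ m ≤ q * (m.factorial : ℝ) := by
    intro m
    rcases m with _ | m
    · simpa using hq1
    have := Nat.factorial_mul_pow_le_factorial (m := 1) (n := m)
    have h' : (2 : ℝ) ^ m ≤ ((m + 1).factorial : ℝ) := by
      rw [add_comm m 1]; exact_mod_cast (by simpa using this)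
    rw [pow_succ']
    gcongr
    exact (pow_le_pow_left₀ (by linarith) hq2 m).trans h'
  induction μ using Multiset.induction_on with
  | empty =>
    simp only [Multiset.sum_zero, zero_add, Multiset.zero_bind]
    rw [zPart_replicate_one, ← mul_assoc]
    gcongr
    exact hkey b
  | cons l μ ih =>
    have ih := ih (fun x hx => hμ x (Multiset.mem_cons_of_mem hx))
    have hl : 2 ≤ l := hμ l (Multiset.mem_cons_self _ _)
    rw [Multiset.cons_bind, Multiset.sum_cons, Multiset.cons_add, add_assoc, add_assoc]
    set ν := μ + Multiset.replicate b 1 with hν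
    set lam := μ.bind (powParts p) + Multiset.replicate b 1 with hlam
    set N := μ.sum + b with hN
    have hsum : lam.sum = N := by rw [hlam, hN, Multiset.sum_add, bind_powParts_sum]; simp
    have hz := le_zPart_cons ν l
    have hzR : (zPart ν : ℝ) * l ≤ zPart (l ::ₘ ν) := by exact_mod_cast hz
    by_cases hd : p ∣ l
    · obtain ⟨k, rfl⟩ := hd
      have hp0 := hp.pos
      have hk : 0 < k := by
        rcases Nat.eq_zero_or_pos k with rfl | h
        · simp at hl
        · exact h
      have e : powParts p (p * k) = Multiset.replicate p k := by
        unfold powParts; rw [if_pos (dvd_mul_right _ _), Nat.mul_div_cancel_left _ hp0]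
      rw [e]
      have h1 := zPart_replicate_add' lam k p hk hp0
      rw [hsum] at h1
      have h1R : (zPart (Multiset.replicate p k + lam) : ℝ) * N.factorial * (p : ℝ) ^ (k - 1)
        ≤ zPart lam * (N + p * k).factorial := by exact_mod_cast h1
      have hpk : q ^ (p * k) = p * (p : ℝ) ^ (k - 1) := by
        rw [pow_mul, hqp, ← pow_succ', Nat.sub_add_cancel hk]
      rw [pow_add, hpk, add_comm (p * k) N]
      have hF : (0 : ℝ) < N.factorial := by exact_mod_cast N.factorial_pos
      refine le_of_mul_le_mul_right ?_ hF
      have hk1 : (1 : ℝ) ≤ k := by exact_mod_cast hk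
      push_cast at hzR
      calc (p : ℝ) * (p : ℝ) ^ (k - 1) * q ^ N * zPart (Multiset.replicate p k + lam) * N.factorial
          = p * q ^ N * (zPart (Multiset.replicate p k + lam) * N.factorial * (p : ℝ) ^ (k - 1)) := by
            ring
        _ ≤ p * q ^ N * (zPart lam * (N + p * k).factorial) := by gcongr
        _ = p * (N + p * k).factorial * (q ^ N * zPart lam) := by ring
        _ ≤ p * (N + p * k).factorial * (q * (N.factorial * zPart ν)) := by gcongr
        _ = q * ((N + p * k).factorial * (zPart ν * (p * 1))) * N.factorial := by ring
        _ ≤ q * ((N + p * k).factorial * (zPart ν * (p * k))) * N.factorial := by gcongr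
        _ ≤ q * ((N + p * k).factorial * zPart ((p * k) ::ₘ ν)) * N.factorial := by gcongr
    · have e : powParts p l = {l} := by unfold powParts; rw [if_neg hd]
      rw [e, Multiset.singleton_add]
      rcases Nat.eq_zero_or_pos N with h0 | hNpos
      · have hb : b = 0 := by omega
        have hs : μ.sum = 0 := by omega
        have hm : μ = 0 := by
          by_contra hne
          obtain ⟨x, hx⟩ := Multiset.exists_mem_of_ne_zero hne
          have := hμ x (Multiset.mem_cons_of_mem hx)
          have := Multiset.le_sum_of_mem hx
          omega
        have e1 : lam = 0 := by simp [hlam, hm, hb]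
        have e2 : ν = 0 := by simp [hν, hm, hb]
        rw [h0, e1, e2, add_zero, ← mul_assoc]
        gcongr
        exact hkey l
      · have h1 := zPart_cons_le lam l
        rw [hsum] at h1
        have h2 : N.factorial * 2 ^ (l - 1) ≤ (N + l - 1).factorial := by
          have : N + l - 1 = N + (l - 1) := by omega
          rw [this]
          refine le_trans ?_ Nat.factorial_mul_pow_le_factorial
          gcongr
          omega
        have h3 : (N + l).factorial = (N + l) * (N + l - 1).factorial :=
          (Nat.mul_factorial_pred (by omega)).symm
        have h4 : (N + l) * (N.factorial * 2 ^ l) ≤ (N + l).factorial * l := by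
          have : 2 ^ l = 2 ^ (l - 1) * 2 := by rw [← pow_succ]; congr 1; omega
          rw [h3, this]
          calc _ = (N + l) * (N.factorial * 2 ^ (l - 1)) * 2 := by ring
            _ ≤ _ := by gcongr
        have h1R : (zPart (l ::ₘ lam) : ℝ) ≤ zPart lam * (N + l) := by exact_mod_cast h1
        have h4R : ((N : ℝ) + l) * (N.factorial * 2 ^ l) ≤ (N + l).factorial * l := by
          exact_mod_cast h4
        rw [pow_add, add_comm l N]
        calc q ^ l * q ^ N * (zPart (l ::ₘ lam) : ℝ)
            ≤ 2 ^ l * q ^ N * (zPart lam * (N + l)) := by gcongr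
          _ = 2 ^ l * (N + l) * (q ^ N * zPart lam) := by ring
          _ ≤ 2 ^ l * (N + l) * (q * (N.factorial * zPart ν)) := by gcongr
          _ = q * zPart ν * (((N : ℝ) + l) * (N.factorial * 2 ^ l)) := by ring
          _ ≤ q * zPart ν * ((N + l).factorial * l) := by gcongr
          _ = q * ((N + l).factorial * (zPart ν * l)) := by ring
          _ ≤ _ := by gcongr

lemma cycleType_pow_cycle {n p : ℕ} (hp : p.Prime) (c : Perm (Fin n)) (hc : c.IsCycle) :
    ∃ r, (c ^ p).cycleType + Multiset.replicate r 1 = c.cycleType.bind (powParts p) := by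
  have hord : orderOf c = #c.support := hc.orderOf
  rw [hc.cycleType, Multiset.singleton_bind, ← hord]
  by_cases hd : p ∣ orderOf c
  · obtain ⟨k, hk⟩ := hd
    have hp0 := hp.pos
    have hopos : 0 < orderOf c := orderOf_pos c
    have hkpos : 0 < k := by
      rcases Nat.eq_zero_or_pos k with rfl | h
      · rw [mul_zero] at hk; omega
      · exact h
    have e : powParts p (orderOf c) = Multiset.replicate p k := by
      unfold powParts; rw [hk, if_pos (dvd_mul_right _ _), Nat.mul_div_cancel_left _ hp0]
    rw [e]
    rcases Nat.lt_or_ge 1 k with h1 | h1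
    · refine ⟨0, ?_⟩
      have hall : ∀ x ∈ (c ^ p).cycleType, x = k := by
        intro x hx
        have hx1 := Perm.dvd_of_mem_cycleType hx
        have hop : orderOf (c ^ p) = k := by
          rw [orderOf_pow_of_dvd hp0.ne' ⟨k, hk⟩, hk, Nat.mul_div_cancel_left _ hp0]
        rw [hop] at hx1
        refine Nat.dvd_antisymm hx1 ?_
        rw [Perm.cycleType_def, Multiset.mem_map] at hx
        obtain ⟨d, hd, hdx⟩ := hx
        have hd := (Perm.mem_cycleFactorsFinset_iff.1 (by rwa [Finset.mem_val] at hd))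
        have hdx : orderOf d = x := by rw [hd.1.orderOf]; exact hdx
        obtain ⟨y, hy⟩ := hd.1.nonempty_support
        have hpw := Perm.pow_eq_on_of_mem_support (f := d) (g := c ^ p)
          (fun z hz => hd.2 z (Finset.mem_inter.1 hz).1) x y (by
            refine Finset.mem_inter.2 ⟨hy, ?_⟩
            rw [Perm.mem_support, ← hd.2 y hy]
            exact Perm.mem_support.1 hy)
        rw [← hdx, pow_orderOf_eq_one, hdx, ← pow_mul] at hpw
        have hyc : c y ≠ y := by
          have : y ∈ (c ^ p).support := by
            rw [Perm.mem_support, ← hd.2 y hy]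
            exact Perm.mem_support.1 hy
          exact Perm.mem_support.1 (Perm.support_pow_le c p this)
        have h := (hc.pow_eq_one_iff' hyc).2 hpw.symm
        have h := orderOf_dvd_of_pow_eq_one h
        rw [hk] at h
        exact Nat.dvd_of_mul_dvd_mul_left hp0 h
      have hrep := Multiset.eq_replicate_card.2 hall
      have hsum := Perm.sum_cycleType (c ^ p)
      have hsupp : (c ^ p).support = c.support := hc.support_pow_eq_iff.2 (by
        intro h
        have := Nat.le_of_dvd hp0 h
        rw [hk] at this
        nlinarith)
      rw [hsupp, ← hord, hk, hrep] at hsum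
      simp only [Multiset.sum_replicate, smul_eq_mul] at hsum
      have := Nat.eq_of_mul_eq_mul_right hkpos hsum
      rw [hrep, this]; simp
    · have hk1 : k = 1 := by omega
      subst hk1
      refine ⟨p, ?_⟩
      have : c ^ p = 1 := by rw [mul_one] at hk; rw [← hk]; exact pow_orderOf_eq_one c
      rw [this]; simp
  · refine ⟨0, ?_⟩
    have hcop : p.Coprime (orderOf c) := (Nat.Prime.coprime_iff_not_dvd hp).2 hd
    have h := hc.pow_iff.2 hcop
    rw [h.cycleType, ← h.orderOf, Nat.Coprime.orderOf_pow hcop.symm]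
    simp [powParts, hd]

lemma cycleType_pow_prime {n p : ℕ} (hp : p.Prime) (g : Perm (Fin n)) :
    ∃ r, (g ^ p).cycleType + Multiset.replicate r 1 = g.cycleType.bind (powParts p) := by
  induction g using Perm.cycle_induction_on with
  | base_one => exact ⟨0, by simp⟩
  | base_cycles σ hσ => exact cycleType_pow_cycle hp σ hσ
  | induction_disjoint σ τ hd _ h1 h2 =>
    obtain ⟨r, hr⟩ := h1
    obtain ⟨s, hs⟩ := h2
    refine ⟨r + s, ?_⟩
    rw [hd.commute.mul_pow, (hd.pow_disjoint_pow p p).cycleType_mul, hd.cycleType_mul,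
      Multiset.add_bind, ← hr, ← hs, Multiset.replicate_add]
    abel

lemma fullCycleType_pow {n p : ℕ} (hp : p.Prime) (g : Perm (Fin n)) :
    fullCycleType (g ^ p) =
      g.cycleType.bind (powParts p) + Multiset.replicate (n - g.cycleType.sum) 1 := by
  obtain ⟨r, hr⟩ := cycleType_pow_prime hp g
  unfold fullCycleType
  have h1 := congrArg Multiset.sum hr
  rw [bind_powParts_sum] at h1
  simp [Perm.sum_cycleType] at h1
  have h2 := g.sum_cycleType_le
  simp only [Fintype.card_fin, Perm.sum_cycleType] at h2
  rw [← hr, add_assoc, ← Multiset.replicate_add]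
  congr 2
  simp only [Perm.sum_cycleType]
  omega

lemma zPart_fullCycleType {n : ℕ} (g : Perm (Fin n)) :
    zPart (fullCycleType g) = Nat.card (Subgroup.centralizer {g}) := by
  rw [Perm.nat_card_centralizer, fullCycleType, zPart_add_replicate_one, Fintype.card_fin]
  · rw [zPart, Finset.prod_mul_distrib, ← Finset.prod_multiset_count]
    ring
  · rw [Multiset.count_eq_zero]
    intro h
    have := Perm.two_le_of_mem_cycleType h
    omega

lemma fullCycleType_eq_iff {n : ℕ} (a b : Perm (Fin n)) :
    fullCycleType a = fullCycleType b ↔ IsConj a b⁻¹ := by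
  rw [Perm.isConj_iff_cycleType_eq, Perm.cycleType_inv]
  constructor
  · intro h
    have key : ∀ g : Perm (Fin n), (fullCycleType g).filter (fun x => 2 ≤ x) = g.cycleType := by
      intro g
      unfold fullCycleType
      rw [Multiset.filter_add, Multiset.filter_eq_self.2
        (fun x hx => Perm.two_le_of_mem_cycleType hx), Multiset.filter_eq_nil.2, add_zero]
      intro x hx
      rw [Multiset.eq_of_mem_replicate hx]; omega
    rw [← key a, h, key b]
  · intro h
    rw [fullCycleType, fullCycleType, h]

lemma card_fix {n : ℕ} (a b : Perm (Fin n)) :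
    Nat.card {σ : Perm (Fin n) | a * σ * b = σ} =
      if fullCycleType a = fullCycleType b then zPart (fullCycleType a) else 0 := by
  split_ifs with h
  · rw [zPart_fullCycleType]
    obtain ⟨c, hc⟩ := isConj_iff.1 ((fullCycleType_eq_iff a b).1 h)
    have hb : b = c * a⁻¹ * c⁻¹ := by
      rw [← inv_inv b, ← hc]; group
    symm
    refine Nat.card_congr ((Equiv.mulRight c⁻¹).subtypeEquiv ?_)
    intro x
    simp only [Subgroup.mem_centralizer_singleton_iff, Set.mem_ofPred_eq, Equiv.coe_mulRight]
    rw [hb]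
    have e : a * (x * c⁻¹) * (c * a⁻¹ * c⁻¹) = a * x * a⁻¹ * c⁻¹ := by group
    change _ ↔ a * (x * c⁻¹) * (c * a⁻¹ * c⁻¹) = x * c⁻¹
    rw [e, mul_left_inj, mul_inv_eq_iff_eq_mul]
    exact eq_comm
  · rw [Nat.card_eq_zero]
    left
    constructor
    rintro ⟨σ, hσ⟩
    apply h
    rw [fullCycleType_eq_iff, isConj_iff]
    refine ⟨σ⁻¹, ?_⟩
    have hσ : a * σ * b = σ := hσ
    rw [inv_inv, eq_inv_iff_mul_eq_one, mul_assoc, mul_assoc, ← mul_assoc a, hσ, inv_mul_cancel]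

lemma zPart_pow_le {n p : ℕ} (hp : p.Prime) (g : Perm (Fin n)) :
    (zPart (fullCycleType (g ^ p)) : ℝ) ≤
      (p : ℝ) ^ ((1 - (n : ℝ)) / (p : ℝ)) * (n.factorial : ℝ) * zPart (fullCycleType g) := by
  have hp0 : (0 : ℝ) < p := by exact_mod_cast hp.pos
  have hp1 : (1 : ℝ) ≤ p := by exact_mod_cast hp.one_lt.le
  set q : ℝ := (p : ℝ) ^ ((1 : ℝ) / p) with hq
  have hqpos : 0 < q := Real.rpow_pos_of_pos hp0 _
  have hqp : q ^ p = p := by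
    rw [hq, ← Real.rpow_natCast, ← Real.rpow_mul hp0.le, one_div, inv_mul_cancel₀ hp0.ne',
      Real.rpow_one]
  have hq1 : 1 ≤ q := Real.one_le_rpow hp1 (by positivity)
  have hq2 : q ≤ 2 := by
    refine le_of_pow_le_pow_left₀ hp.ne_zero (by norm_num) ?_
    rw [hqp]
    exact_mod_cast (Nat.lt_two_pow_self (n := p)).le
  have h := main_ineq p hp q hq1 hq2 hqp (n - g.cycleType.sum) g.cycleType
    (fun l hl => Perm.two_le_of_mem_cycleType hl)
  have h2 := g.sum_cycleType_le
  rw [Fintype.card_fin] at h2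
  rw [← fullCycleType_pow hp, Nat.add_sub_cancel' h2] at h
  change _ ≤ q * (_ * (zPart (fullCycleType g) : ℝ)) at h
  have e : (p : ℝ) ^ ((1 - (n : ℝ)) / (p : ℝ)) = q / q ^ n := by
    rw [hq, ← Real.rpow_natCast, ← Real.rpow_mul hp0.le, ← Real.rpow_sub hp0]
    congr 1; ring
  rw [e, div_mul_eq_mul_div, div_mul_eq_mul_div, le_div_iff₀ (by positivity)]
  linarith

/-- With `ν₁, ν₂` the cycle types of `g₁, g₂`: `|T_{g₁,g₂}(1)| = z_{ν₁}δ_{ν₁,ν₂}`; for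
every prime `p`, `|T_{g₁,g₂}(p)| ≤ p^{(1−n)/p}·n!·√(z_{ν₁}z_{ν₂})`; and
`|T_{g₁,g₂}(j)| ≤ n!` for every `j ≥ 1`. -/
theorem card_TpairSet_bounds {n : ℕ} (g₁ g₂ : Perm (Fin n)) :
    (Nat.card (TpairSet g₁ g₂ 1) =
        if fullCycleType g₁ = fullCycleType g₂ then zPart (fullCycleType g₁) else 0) ∧
    (∀ p : ℕ, p.Prime →
      (Nat.card (TpairSet g₁ g₂ p) : ℝ) ≤
        (p : ℝ) ^ ((1 - (n : ℝ)) / (p : ℝ)) * (n.factorial : ℝ) *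
          Real.sqrt ((zPart (fullCycleType g₁) : ℝ) * (zPart (fullCycleType g₂) : ℝ))) ∧
    (∀ j : ℕ, 1 ≤ j → Nat.card (TpairSet g₁ g₂ j) ≤ n.factorial) := by
  refine ⟨?_, ?_, ?_⟩
  · rw [← card_fix]
    congr 2
    ext σ
    simp only [TpairSet, Set.mem_ofPred_eq, pow_one, and_iff_left_iff_imp]
    intro _ i h1 h2
    omega
  · intro p hp
    have hsub : TpairSet g₁ g₂ p ⊆ {σ : Perm (Fin n) | g₁ ^ p * σ * g₂ ^ p = σ} :=
      fun σ h => h.1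
    have hc : Nat.card (TpairSet g₁ g₂ p) ≤ _ := Nat.card_mono (Set.toFinite _) hsub
    rw [card_fix] at hc
    have hcR : (Nat.card (TpairSet g₁ g₂ p) : ℝ) ≤ _ := Nat.cast_le.2 hc
    refine hcR.trans ?_
    split_ifs with h
    · have h1 := zPart_pow_le hp g₁
      have h2 := zPart_pow_le hp g₂
      rw [← h] at h2
      set K : ℝ := (p : ℝ) ^ ((1 - (n : ℝ)) / (p : ℝ)) * (n.factorial : ℝ) with hK
      have hK0 : 0 ≤ K := by positivity
      rw [← Real.sqrt_sq hK0, ← Real.sqrt_mul (by positivity)]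
      apply Real.le_sqrt_of_sq_le
      calc _ = (zPart (fullCycleType (g₁ ^ p)) : ℝ) * zPart (fullCycleType (g₁ ^ p)) := by ring
        _ ≤ (K * zPart (fullCycleType g₁)) * (K * zPart (fullCycleType g₂)) := by gcongr
        _ = _ := by ring
    · simp only [Nat.cast_zero]
      positivity
  · intro j _
    have h : Nat.card (TpairSet g₁ g₂ j) ≤ Nat.card (Perm (Fin n)) :=
      Nat.card_le_card_of_injective _ Subtype.val_injective
    rwa [Nat.card_perm, Nat.card_fin] at h
end

section
/- Let Xₙ := (Σ_{ν ⊢ n} z_ν) − n!, where the sum is over all integer partitions ν of n. Then Xₙ = n!·(2/n² + o(n⁻²)) as n → ∞; equivalently, n²·Xₙ/n! → 2 as n → ∞. -/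
open Finset Filter

/-- Sum of `z` over partitions of `k` without parts equal to one. -/
def zB (k : ℕ) : ℕ :=
  ∑ p : Nat.Partition k with p.parts.count 1 = 0, zPart p.parts

theorem zPart_add_ones (μ : Multiset ℕ) (h : μ.count 1 = 0) (m : ℕ) :
    zPart (μ + Multiset.replicate m 1) = m.factorial * zPart μ := by
  have h1 : (1:ℕ) ∉ μ.toFinset := by
    rw [Multiset.mem_toFinset]; exact Multiset.count_eq_zero.mp h
  have hsub : (μ + Multiset.replicate m 1).toFinset ⊆ insert 1 μ.toFinset := by
    intro x hx
    simp only [Multiset.mem_toFinset, Multiset.mem_add, Finset.mem_insert] at hx ⊢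
    rcases hx with hx | hx
    · exact Or.inr hx
    · exact Or.inl (Multiset.eq_of_mem_replicate hx)
  unfold zPart
  rw [Finset.prod_subset hsub, Finset.prod_insert h1]
  · congr 1
    · simp [h]
    · apply Finset.prod_congr rfl
      intro j hj
      have : 1 ≠ j := by rintro rfl; exact h1 hj
      simp [Multiset.count_add, Multiset.count_replicate, this]
  · intro x _ hx
    rw [Multiset.mem_toFinset] at hx
    rw [Multiset.count_eq_zero.mpr hx]; simp

theorem zPart_le (k : ℕ) (p : Nat.Partition k) (h : p.parts.count 1 = 0) :
    zPart p.parts ≤ 2 ^ k * (k / 2).factorial := by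
  unfold zPart
  rw [Finset.prod_mul_distrib, ← Finset.prod_multiset_count]
  apply Nat.mul_le_mul
  · have : ∀ s : Multiset ℕ, s.prod ≤ 2 ^ s.sum := by
      intro s
      induction s using Multiset.induction_on with
      | empty => simp
      | cons a s ih =>
        rw [Multiset.prod_cons, Multiset.sum_cons, pow_add]
        exact Nat.mul_le_mul (Nat.lt_two_pow_self).le ih
    simpa [p.parts_sum] using this p.parts
  · refine (Nat.le_of_dvd (Nat.factorial_pos _) (Nat.prod_factorial_dvd_factorial_sum _ _)).trans ?_
    apply Nat.factorial_le
    rw [Multiset.toFinset_sum_count_eq]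
    have : Multiset.card p.parts • 2 ≤ p.parts.sum := by
      apply Multiset.card_nsmul_le_sum
      intro x hx
      have h0 := p.parts_pos hx
      have : x ≠ 1 := by rintro rfl; exact Multiset.count_eq_zero.mp h hx
      omega
    rw [p.parts_sum] at this
    simp at this
    omega

theorem zB_le (k : ℕ) : zB k ≤ 4 ^ k * (k / 2).factorial := by
  have hc : Fintype.card (Nat.Partition k) ≤ 2 ^ k := by
    refine (Fintype.card_le_of_surjective _ Nat.Partition.ofComposition_surj).trans ?_
    rw [composition_card]
    exact Nat.pow_le_pow_right (by norm_num) (by omega)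
  unfold zB
  calc _ ≤ ∑ p : Nat.Partition k with p.parts.count 1 = 0, 2 ^ k * (k / 2).factorial := by
        apply Finset.sum_le_sum
        intro p hp
        exact zPart_le k p (by simpa using hp)
    _ ≤ 2 ^ k * (2 ^ k * (k / 2).factorial) := by
        rw [Finset.sum_const, smul_eq_mul]
        exact Nat.mul_le_mul_right _ ((Finset.card_le_univ _).trans hc)
    _ = _ := by rw [← mul_assoc, ← mul_pow]; norm_num

theorem zB_zero : zB 0 = 1 := by
  simp [zB, zPart, Finset.sum_filter]

theorem zB_one : zB 1 = 0 := by
  simp [zB, Finset.sum_filter]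

theorem zB_two : zB 2 = 2 := by
  have : (Finset.univ.filter fun p : Nat.Partition 2 => p.parts.count 1 = 0)
      = {Nat.Partition.indiscrete 2} := by
    ext p
    simp only [Finset.mem_filter, Finset.mem_univ, true_and, Finset.mem_singleton]
    constructor
    · intro h
      apply Nat.Partition.ext
      have h2 : ∀ x ∈ p.parts, x = 2 := by
        intro x hx
        have h0 := p.parts_pos hx
        have h1 : x ≠ 1 := by rintro rfl; exact Multiset.count_eq_zero.mp h hx
        have h3 := Multiset.single_le_sum (fun y _ => Nat.zero_le y) x hx
        rw [p.parts_sum] at h3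
        omega
      have h4 := Multiset.eq_replicate_card.mpr h2
      have h5 := p.parts_sum
      rw [h4, Multiset.sum_replicate, smul_eq_mul] at h5
      have h6 : Multiset.card p.parts = 1 := by omega
      rw [h4, h6]
      simp [Nat.Partition.indiscrete_parts]
    · rintro rfl
      simp [Nat.Partition.indiscrete_parts]
  rw [zB, this, Finset.sum_singleton, Nat.Partition.indiscrete_parts (by norm_num)]
  simp [zPart]

theorem sum_z_eq (n : ℕ) :
    ∑ ν : Nat.Partition n, zPart ν.parts
      = ∑ k ∈ range (n + 1), (n - k).factorial * zB k := by
  have hcount : ∀ ν : Nat.Partition n, ν.parts.count 1 ≤ n := by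
    intro ν
    have : ν.parts.count 1 ≤ ν.parts.sum := by
      refine (Multiset.count_le_card _ _).trans ?_
      have := Multiset.card_nsmul_le_sum (s := ν.parts) (a := 1) (fun x hx => ν.parts_pos hx)
      simpa using this
    rwa [ν.parts_sum] at this
  rw [← Finset.sum_fiberwise_of_maps_to (s := Finset.univ) (t := range (n + 1))
    (g := fun ν : Nat.Partition n => n - ν.parts.count 1)
    (fun ν _ => by simp)]
  apply Finset.sum_congr rfl
  intro k hk
  have hk : k ≤ n := by simp at hk; omega
  rw [zB, Finset.mul_sum]
  symm
  refine Finset.sum_bij (fun p _ => (⟨p.parts + Multiset.replicate (n - k) 1, ?_, ?_⟩ : Nat.Partition n))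
    ?_ ?_ ?_ ?_
  · intro i hi
    rw [Multiset.mem_add] at hi
    rcases hi with hi | hi
    · exact p.parts_pos hi
    · rw [Multiset.eq_of_mem_replicate hi]; norm_num
  · simp [p.parts_sum]; omega
  · intro p hp
    simp only [Finset.mem_filter, Finset.mem_univ, true_and] at hp ⊢
    simp only [Multiset.count_add, hp, Multiset.count_replicate_self]; omega
  · intro p _ q _ h
    simp only [Nat.Partition.mk.injEq] at h
    exact Nat.Partition.ext (by simpa using h)
  · intro ν hν
    simp only [Finset.mem_filter, Finset.mem_univ, true_and] at hν
    have hc := hcount ν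
    have e : ν.parts.count 1 = n - k := by omega
    have hsplit : ν.parts.filter (fun x => ¬ (1 = x)) + Multiset.replicate (n - k) 1 = ν.parts := by
      rw [← e, ← Multiset.filter_eq, add_comm, Multiset.filter_add_not]
    refine ⟨⟨ν.parts.filter (fun x => ¬ (1 = x)), ?_, ?_⟩, ?_, ?_⟩
    · intro i hi
      exact ν.parts_pos (Multiset.mem_of_mem_filter hi)
    · have := congrArg Multiset.sum hsplit
      rw [ν.parts_sum] at this
      simp at this
      omega
    · simp
    · exact Nat.Partition.ext hsplit
  · intro p hp
    exact (zPart_add_ones _ (by simpa using hp) _).symm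

theorem summable_bound :
    Summable (fun k : ℕ => (8 : ℝ) * (8 ^ k * (k / 2).factorial / k.factorial)) := by
  apply Summable.mul_left
  have h1 : Summable (fun m : ℕ => (8:ℝ) * ((64:ℝ) ^ m / m.factorial)) :=
    (Real.summable_pow_div_factorial 64).mul_left 8
  have key : Summable (fun k : ℕ => (8:ℝ) * ((64:ℝ) ^ (k / 2) / (k / 2).factorial)) := by
    rw [← (Nat.divModEquiv 2).symm.summable_iff]
    have : Summable (fun x : ℕ × Fin 2 => (8:ℝ) * ((64:ℝ) ^ x.1 / x.1.factorial)) := by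
      rw [← (Equiv.prodComm (Fin 2) ℕ).summable_iff]
      rw [summable_prod_of_nonneg (fun x => by dsimp; positivity)]
      exact ⟨fun _ => h1, Summable.of_finite⟩
    refine this.congr ?_
    rintro ⟨m, i⟩
    have : (m * 2 + (i:ℕ)) / 2 = m := by omega
    simp [Nat.divModEquiv, this]
  refine Summable.of_nonneg_of_le (fun k => by positivity) (fun k => ?_) key
  have h8 : (8:ℝ) ^ k ≤ 8 * 64 ^ (k / 2) := by
    calc (8:ℝ) ^ k ≤ 8 ^ (1 + 2 * (k / 2)) := pow_le_pow_right₀ (by norm_num) (by omega)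
      _ = _ := by rw [pow_add, pow_mul]; norm_num
  have hf : ((k/2).factorial : ℝ) * (k/2).factorial ≤ k.factorial := by
    have h := Nat.factorial_mul_factorial_dvd_factorial_add (k/2) (k/2)
    have h2 := (Nat.le_of_dvd (Nat.factorial_pos _) h).trans
      (Nat.factorial_le (show k/2 + k/2 ≤ k by omega))
    exact_mod_cast h2
  rw [← mul_div_assoc, div_le_div_iff₀ (by positivity) (by positivity)]
  calc (8:ℝ) ^ k * (k/2).factorial * (k/2).factorial
      = 8 ^ k * ((k/2).factorial * (k/2).factorial) := by ring
    _ ≤ (8 * 64 ^ (k/2)) * k.factorial := by gcongr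

theorem choose_bound (n k : ℕ) (h2 : 2 ≤ k) (hk : k ≤ n) :
    n ^ 2 ≤ 8 * 2 ^ k * n.choose k := by
  by_cases h : n ≤ k + 1
  · have hc : 1 ≤ n.choose k := Nat.choose_pos hk
    have : (k+1)^2 ≤ 8 * 2 ^ k := by
      clear h hc hk
      induction k, h2 using Nat.le_induction with
      | base => norm_num
      | succ k hk ih => rw [pow_succ 2 k]; nlinarith
    calc n ^ 2 ≤ (k+1)^2 := Nat.pow_le_pow_left h 2
      _ ≤ 8 * 2 ^ k := this
      _ ≤ _ := Nat.le_mul_of_pos_right _ hc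
  · have hc : n.choose 2 ≤ n.choose k := by
      rcases le_total k (n / 2) with h' | h'
      · clear h hk
        induction k, h2 using Nat.le_induction with
        | base => exact le_rfl
        | succ k hk ih =>
          exact (ih (by omega)).trans (Nat.choose_le_succ_of_lt_half_left (by omega))
      · rw [← Nat.choose_symm hk]
        have : ∀ j, 2 ≤ j → j ≤ n / 2 → n.choose 2 ≤ n.choose j := by
          intro j hj
          induction j, hj using Nat.le_induction with
          | base => intro _; exact le_rfl
          | succ k hk ih =>
            intro h
            exact (ih (by omega)).trans (Nat.choose_le_succ_of_lt_half_left (by omega))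
        by_cases h3 : n - k ≤ n / 2
        · exact this _ (by omega) h3
        · rw [Nat.choose_symm hk]; exact this _ h2 (by omega)
    have h4 : n ^ 2 ≤ 4 * n.choose 2 := by
      obtain ⟨m, rfl⟩ : ∃ m, n = m + 2 := ⟨n - 2, by omega⟩
      have := Nat.triangle_succ (m + 1)
      have e : (m+2).choose 2 * 2 = (m+2)*(m+1) := by
        have := Nat.add_one_mul_choose_eq (m+1) 1
        simp at this
        nlinarith
      nlinarith
    have : 1 ≤ 2 ^ k := Nat.one_le_two_pow
    nlinarith

theorem lim_term (k : ℕ) (h2 : 2 ≤ k) :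
    Tendsto (fun n : ℕ => (n:ℝ)^2 * ((n - k).factorial * zB k) / n.factorial) atTop
      (nhds (if k = 2 then 2 else 0)) := by
  have base : Tendsto (fun n : ℕ => (n:ℝ)^2 * (n-2).factorial / n.factorial) atTop (nhds 1) := by
    have h : Tendsto (fun n : ℕ => (1:ℝ) + 1 / ((n:ℝ) + 1)) atTop (nhds (1 + 0)) :=
      tendsto_const_nhds.add tendsto_one_div_add_atTop_nhds_zero_nat
    rw [← tendsto_add_atTop_iff_nat 2]
    rw [add_zero] at h
    refine h.congr ?_
    intro n
    have : (n.factorial : ℝ) ≠ 0 := by positivity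
    have : (n:ℝ) + 1 ≠ 0 := by positivity
    have : (n:ℝ) + 2 ≠ 0 := by positivity
    have e : n + 2 - 2 = n := by omega
    rw [e, Nat.factorial_succ, Nat.factorial_succ]
    push_cast
    have : (n:ℝ) + 1 + 1 ≠ 0 := by positivity
    field_simp
    ring
  split_ifs with hk
  · subst hk
    have := base.mul_const 2
    rw [one_mul] at this
    refine this.congr ?_
    intro n
    rw [zB_two]; push_cast; ring
  · have hk3 : 3 ≤ k := by omega
    have h : Tendsto (fun n : ℕ => ((n:ℝ)^2 * (n-2).factorial / n.factorial) *
        ((zB k : ℝ) * ((n - k).factorial / (n-2).factorial))) atTop (nhds (1 * (zB k * 0))) := by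
      refine base.mul (Tendsto.const_mul _ ?_)
      have h0 : Tendsto (fun n : ℕ => 1 / ((n:ℝ) + 1)) atTop (nhds 0) :=
        tendsto_one_div_add_atTop_nhds_zero_nat
      rw [← tendsto_add_atTop_iff_nat 3]
      refine squeeze_zero (fun n => by positivity) (fun n => ?_) h0
      have e : n + 3 - 2 = n + 1 := by omega
      rw [e, Nat.factorial_succ, div_le_div_iff₀ (by positivity) (by positivity)]
      have : ((n + 3 - k).factorial : ℝ) ≤ n.factorial := by
        exact_mod_cast Nat.factorial_le (by omega)
      push_cast
      nlinarith
    simp only [mul_zero] at h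
    refine h.congr ?_
    intro n
    have : ((n-2).factorial : ℝ) ≠ 0 := by positivity
    field_simp

/-- With `Xₙ = (Σ_{ν ⊢ n} z_ν) − n!`, we have `Xₙ = n!·(2/n² + o(n⁻²))`; equivalently,
`n²·Xₙ/n! → 2` as `n → ∞`. -/
theorem sum_z_asymptotic :
    Tendsto (fun n : ℕ =>
      (n : ℝ) ^ 2 *
        ((∑ ν : Nat.Partition n, (zPart ν.parts : ℝ)) - (n.factorial : ℝ)) /
        (n.factorial : ℝ))
      atTop (nhds 2) := by
  let f : ℕ → ℕ → ℝ := fun n k =>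
    if 2 ≤ k ∧ k ≤ n then (n:ℝ)^2 * ((n - k).factorial * zB k) / n.factorial else 0
  have hf : ∀ n, 2 ≤ n → ∑' k, f n k = (n : ℝ) ^ 2 *
        ((∑ ν : Nat.Partition n, (zPart ν.parts : ℝ)) - (n.factorial : ℝ)) /
        (n.factorial : ℝ) := by
    intro n hn
    rw [tsum_eq_sum (s := range (n + 1))]
    · have e := congrArg (Nat.cast (R := ℝ)) (sum_z_eq n)
      push_cast at e
      rw [e]
      obtain ⟨m, rfl⟩ : ∃ m, n = m + 2 := ⟨n - 2, by omega⟩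
      have hs : ∀ g : ℕ → ℝ, ∑ k ∈ range (m + 2 + 1), g k
          = ∑ k ∈ range (m + 1), g (k + 2) + g 1 + g 0 := by
        intro g
        rw [Finset.sum_range_succ', Finset.sum_range_succ']
      rw [hs, hs]
      have f0 : f (m + 2) 0 = 0 := by simp [f]
      have f1 : f (m + 2) 1 = 0 := by simp [f]
      rw [f0, f1, zB_zero, zB_one]
      simp only [Nat.sub_zero, Nat.cast_zero, Nat.cast_one, mul_zero, mul_one, add_zero,
        add_sub_cancel_right]
      rw [Finset.mul_sum, Finset.sum_div]
      apply Finset.sum_congr rfl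
      intro k hk
      simp only [f]
      rw [if_pos]
      simp at hk; omega
    · intro k hk
      simp at hk
      simp only [f]
      rw [if_neg]; omega
  have hlim : Tendsto (fun n => ∑' k, f n k) atTop (nhds (∑' k, if k = 2 then (2:ℝ) else 0)) := by
    refine tendsto_tsum_of_dominated_convergence summable_bound ?_ ?_
    · intro k
      by_cases h2 : 2 ≤ k
      · refine (lim_term k h2).congr' ?_
        filter_upwards [eventually_ge_atTop k] with n hn
        simp [f, h2, hn]
      · have : k ≠ 2 := by omega
        simp [f, h2, this]
    · refine Eventually.of_forall (fun n k => ?_)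
      simp only [f]
      split_ifs with h
      · obtain ⟨h2, hk⟩ := h
        rw [Real.norm_of_nonneg (by positivity)]
        have hb : (zB k : ℝ) ≤ 4 ^ k * (k/2).factorial := by exact_mod_cast zB_le k
        have hc : (n:ℝ)^2 ≤ 8 * 2 ^ k * n.choose k := by exact_mod_cast choose_bound n k h2 hk
        have hn : (n.factorial : ℝ) = n.choose k * k.factorial * (n-k).factorial := by
          exact_mod_cast (Nat.choose_mul_factorial_mul_factorial hk).symm
        rw [← mul_div_assoc, div_le_div_iff₀ (by positivity) (by positivity), hn]
        calc (n:ℝ)^2 * ((n - k).factorial * zB k) * k.factorial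
            ≤ (8 * 2 ^ k * n.choose k) * ((n - k).factorial * (4 ^ k * (k/2).factorial)) * k.factorial := by
              gcongr
          _ = _ := by
              have : (8:ℝ)^k = 2^k * 4^k := by rw [← mul_pow]; norm_num
              rw [this]; ring
      · simp only [norm_zero]; positivity
  rw [tsum_ite_eq] at hlim
  refine hlim.congr' ?_
  filter_upwards [eventually_ge_atTop 2] with n hn
  exact hf n hn
end

section
/- There exists a universal constant C > 0 (independent of n and k) such that for all n ≥ 1 and all integers k with 3 ≤ k ≤ n! − 3, T(n,k) ≤ (1 + C/n²) · (1/n!²) · binom(n!,k). -/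
open Equiv Finset

namespace TUB
section gen
variable {α : Type*} [Fintype α] [DecidableEq α]

open Classical in
noncomputable def invs (g : Perm α) (k : ℕ) : Finset (Finset α) :=
  univ.filter (fun X => X.card = k ∧ ∀ x, g x ∈ X ↔ x ∈ X)

noncomputable def F (g : Perm α) (k : ℕ) : ℕ := (invs g k).card

def fx (g : Perm α) : ℕ := (univ.filter fun x => g x = x).card

open Classical in
noncomputable def orb (g : Perm α) (x : α) : Finset α := univ.filter (fun y => g.SameCycle x y)

lemma mem_invs {g : Perm α} {k : ℕ} {X : Finset α} :
    X ∈ invs g k ↔ X.card = k ∧ ∀ x, g x ∈ X ↔ x ∈ X := by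
  simp [invs]

lemma mem_orb {g : Perm α} {x y : α} : y ∈ orb g x ↔ g.SameCycle x y := by simp [orb]

lemma orb_pos (g : Perm α) (x : α) : 1 ≤ (orb g x).card :=
  Finset.card_pos.mpr ⟨x, mem_orb.mpr (Equiv.Perm.SameCycle.refl g x)⟩

lemma pow_orb (g : Perm α) (x : α) : (g ^ (orb g x).card) x = x := by
  by_cases hx : g x = x
  · exact Equiv.Perm.pow_apply_eq_self_of_apply_eq_self hx _
  · have : orb g x = (g.cycleOf x).support := by
      ext y
      rw [mem_orb, Equiv.Perm.mem_support_cycleOf_iff' hx]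
    rw [this]
    have := Equiv.Perm.pow_mod_card_support_cycleOf_self_apply g (g.cycleOf x).support.card x
    simpa using this.symm

lemma same_mem {g : Perm α} {X : Finset α} (h : ∀ x, g x ∈ X ↔ x ∈ X) {x y : α}
    (hxy : g.SameCycle x y) : x ∈ X ↔ y ∈ X := by
  obtain ⟨i, rfl⟩ := hxy
  have hn : ∀ (m : ℕ) (z : α), (g ^ m) z ∈ X ↔ z ∈ X := by
    intro m
    induction m with
    | zero => simp
    | succ m ih => intro z; rw [pow_succ', Perm.mul_apply, h, ih]
  rcases Int.eq_nat_or_neg i with ⟨m, rfl | rfl⟩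
  · simpa using (hn m x).symm
  · have := hn m ((g ^ (-(m:ℤ))) x)
    rw [← this]
    simp

lemma rec_le (g : Perm α) (k : ℕ) :
    k * F g k ≤ ∑ x : α, if (orb g x).card ≤ k then F g (k - (orb g x).card) else 0 := by
  classical
  have h1 : k * F g k = ∑ x : α, ((invs g k).filter (fun X => x ∈ X)).card := by
    have := Finset.sum_card_bipartiteAbove_eq_sum_card_bipartiteBelow
      (s := (univ : Finset α)) (t := invs g k) (fun x X => x ∈ X)
    simp only [Finset.bipartiteAbove, Finset.bipartiteBelow] at this
    rw [this, F, mul_comm, ← smul_eq_mul, ← Finset.sum_const]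
    refine Finset.sum_congr rfl fun X hX => ?_
    simp [(mem_invs.mp hX).1]
  rw [h1]
  refine Finset.sum_le_sum fun x _ => ?_
  have hsub : ∀ X ∈ (invs g k).filter (fun X => x ∈ X), orb g x ⊆ X := by
    intro X hX y hy
    rw [Finset.mem_filter, mem_invs] at hX
    exact (same_mem hX.1.2 (mem_orb.mp hy)).mp hX.2
  split_ifs with hc
  · refine Finset.card_le_card_of_injOn (fun X => X \ orb g x) ?_ ?_
    · intro X hX
      have hs := hsub X hX
      rw [Finset.mem_coe, Finset.mem_filter, mem_invs] at hX
      rw [Finset.mem_coe, mem_invs]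
      refine ⟨by rw [Finset.card_sdiff_of_subset hs, hX.1.1], fun y => ?_⟩
      simp only [Finset.mem_sdiff, mem_orb, hX.1.2 y, Equiv.Perm.sameCycle_apply_right]
    · intro X hX Y hY hXY
      have h1 := Finset.sdiff_union_of_subset (hsub X hX)
      have h2 := Finset.sdiff_union_of_subset (hsub Y hY)
      simp only at hXY
      rw [← h1, ← h2, hXY]
  · rw [Nat.le_zero, Finset.card_eq_zero, Finset.eq_empty_iff_forall_notMem]
    intro X hX
    have := Finset.card_le_card (hsub X hX)
    rw [Finset.mem_filter, mem_invs] at hX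
    omega

lemma F_zero (g : Perm α) : F g 0 = 1 := by
  rw [F, Finset.card_eq_one]
  refine ⟨∅, ?_⟩
  ext X
  rw [mem_invs]
  simp only [Finset.card_eq_zero, Finset.mem_singleton]
  constructor
  · exact fun h => h.1
  · rintro rfl; simp

lemma F_compl (g : Perm α) {k : ℕ} (hk : k ≤ Fintype.card α) :
    F g k ≤ F g (Fintype.card α - k) := by
  refine Finset.card_le_card_of_injOn (fun X => Xᶜ) ?_ ?_
  · intro X hX
    rw [Finset.mem_coe, mem_invs] at hX ⊢
    refine ⟨by rw [Finset.card_compl, hX.1], fun x => by simp [hX.2 x]⟩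
  · intro X _ Y _ h
    simpa using h

lemma fx_le (g : Perm α) : fx g ≤ Fintype.card α := Finset.card_le_univ _

lemma sum_ite_le (g : Perm α) (d : ℕ) (c : ℕ) :
    (∑ x : α, if (orb g x).card = d then c else 0) ≤ fx (g ^ d) * c := by
  rw [← Finset.sum_filter, Finset.sum_const, smul_eq_mul]
  refine Nat.mul_le_mul_right _ (Finset.card_le_card ?_)
  intro x hx
  simp only [Finset.mem_filter, Finset.mem_univ, true_and] at hx ⊢
  rw [← hx]; exact pow_orb g x

lemma F_one (g : Perm α) : F g 1 ≤ fx g := by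
  have h := rec_le g 1
  rw [one_mul] at h
  refine h.trans ?_
  have := sum_ite_le g 1 1
  rw [pow_one, mul_one] at this
  refine le_trans (Finset.sum_le_sum fun x _ => ?_) this
  have h1 := orb_pos g x
  split_ifs with h2 h3 h3
  · rw [h3, F_zero]
  · omega
  · omega
  · omega

lemma F_two (g : Perm α) : 2 * F g 2 ≤ fx g * F g 1 + fx (g ^ 2) := by
  refine (rec_le g 2).trans ?_
  have a1 := sum_ite_le g 1 (F g 1)
  have a2 := sum_ite_le g 2 1
  rw [pow_one] at a1
  rw [mul_one] at a2
  refine le_trans ?_ (add_le_add a1 a2)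
  rw [← Finset.sum_add_distrib]
  refine Finset.sum_le_sum fun x _ => ?_
  have h1 := orb_pos g x
  split_ifs with h2 h3 h3 h4 h5 <;> first | omega | simp_all [F_zero]

lemma F_three (g : Perm α) : 3 * F g 3 ≤ fx g * F g 2 + fx (g ^ 2) * F g 1 + fx (g ^ 3) := by
  refine (rec_le g 3).trans ?_
  have a1 := sum_ite_le g 1 (F g 2)
  have a2 := sum_ite_le g 2 (F g 1)
  have a3 := sum_ite_le g 3 1
  rw [pow_one] at a1
  rw [mul_one] at a3
  refine le_trans ?_ (add_le_add (add_le_add a1 a2) a3)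
  rw [← Finset.sum_add_distrib, ← Finset.sum_add_distrib]
  refine Finset.sum_le_sum fun x _ => ?_
  have h1 := orb_pos g x
  by_cases h : (orb g x).card ≤ 3
  · have : (orb g x).card = 1 ∨ (orb g x).card = 2 ∨ (orb g x).card = 3 := by omega
    rcases this with h | h | h <;> simp [h, F_zero]
  · simp [h]

lemma F_four (g : Perm α) : 4 * F g 4 ≤ fx g * F g 3 + fx (g ^ 2) * F g 2 + fx (g ^ 3) * F g 1
    + fx (g ^ 4) := by
  refine (rec_le g 4).trans ?_
  have a1 := sum_ite_le g 1 (F g 3)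
  have a2 := sum_ite_le g 2 (F g 2)
  have a3 := sum_ite_le g 3 (F g 1)
  have a4 := sum_ite_le g 4 1
  rw [pow_one] at a1
  rw [mul_one] at a4
  refine le_trans ?_ (add_le_add (add_le_add (add_le_add a1 a2) a3) a4)
  rw [← Finset.sum_add_distrib, ← Finset.sum_add_distrib, ← Finset.sum_add_distrib]
  refine Finset.sum_le_sum fun x _ => ?_
  have h1 := orb_pos g x
  by_cases h : (orb g x).card ≤ 4
  · have : (orb g x).card = 1 ∨ (orb g x).card = 2 ∨ (orb g x).card = 3 ∨ (orb g x).card = 4 := by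
      omega
    rcases this with h | h | h | h <;> simp [h, F_zero]
  · simp [h]

/-- total number of invariant sets -/
lemma F_le_two_pow (g : Perm α) (k p : ℕ) (h : Fintype.card α + fx g ≤ 2 * p) :
    F g k ≤ 2 ^ p := by
  classical
  let s := Equiv.Perm.SameCycle.setoid g
  let π : α → Quotient s := fun x => Quotient.mk s x
  have hπ : ∀ x y, π x = π y ↔ g.SameCycle x y := fun x y => by
    simp only [π]; rw [Quotient.eq]; rfl
  have hq : 2 * Fintype.card (Quotient s) ≤ Fintype.card α + fx g := by
    have e1 : Fintype.card α = ∑ q : Quotient s, (univ.filter (fun x => π x = q)).card := by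
      rw [← Finset.card_univ]
      exact Finset.card_eq_sum_card_fiberwise (fun x _ => Finset.mem_coe.mpr (Finset.mem_univ _))
    have e2 : fx g = ∑ q : Quotient s,
        ((univ.filter fun x => g x = x).filter (fun x => π x = q)).card :=
      Finset.card_eq_sum_card_fiberwise (fun x _ => Finset.mem_coe.mpr (Finset.mem_univ _))
    rw [e2, e1, ← Finset.sum_add_distrib, mul_comm, ← smul_eq_mul, ← Finset.card_univ,
      ← Finset.sum_const]
    refine Finset.sum_le_sum fun q _ => ?_
    obtain ⟨x, rfl⟩ := Quotient.exists_rep q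
    by_cases hx : g x = x
    · have a : 0 < (univ.filter (fun y => π y = Quotient.mk s x)).card :=
        Finset.card_pos.mpr ⟨x, by simp [π]⟩
      have b : 0 < ((univ.filter fun x => g x = x).filter
          (fun y => π y = Quotient.mk s x)).card :=
        Finset.card_pos.mpr ⟨x, by simp [π, hx]⟩
      omega
    · have a : 1 < (univ.filter (fun y => π y = Quotient.mk s x)).card := by
        rw [Finset.one_lt_card]
        refine ⟨x, by simp [π], g x, ?_, fun h => hx h.symm⟩
        simp only [Finset.mem_filter, Finset.mem_univ, true_and]
        change π (g x) = π x
        rw [hπ]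
        exact (Equiv.Perm.sameCycle_apply_left).mpr (Equiv.Perm.SameCycle.refl g x)
      omega
  have : F g k ≤ (univ : Finset (Finset (Quotient s))).card := by
    refine Finset.card_le_card_of_injOn (fun X => X.image π) (fun _ _ => by simp) ?_
    intro X hX Y hY hXY
    rw [Finset.mem_coe, mem_invs] at hX hY
    have key : ∀ X : Finset α, (∀ x, g x ∈ X ↔ x ∈ X) → ∀ x, x ∈ X ↔ π x ∈ X.image π := by
      intro X hX x
      rw [Finset.mem_image]
      constructor
      · exact fun h => ⟨x, h, rfl⟩
      · rintro ⟨y, hy, hxy⟩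
        exact (same_mem hX ((hπ _ _).mp hxy)).mp hy
    ext x
    simp only at hXY
    rw [key X hX.2, key Y hY.2, hXY]
  refine this.trans ?_
  rw [Finset.card_univ, Fintype.card_finset]
  exact Nat.pow_le_pow_right (by norm_num) (by omega)

end gen
end TUB


namespace TUB

lemma psi_mono (N : ℕ) (R : ℝ) (hR0 : 0 < R) (hRN : 100 ≤ R * N) (j : ℕ) (hj : 3 * (j + 1) ≤ N) :
    R ^ (min j 5) * (N.choose j : ℝ) ≤ R ^ (min (j + 1) 5) * (N.choose (j + 1) : ℝ) := by
  have e : (N.choose (j + 1) : ℝ) * (j + 1) = N.choose j * (N - j) := by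
    have := Nat.choose_succ_right_eq N j
    have h2 : ((N - j : ℕ) : ℝ) = N - j := by rw [Nat.cast_sub (by omega)]
    rw [← h2]; exact_mod_cast this
  have hb : (0:ℝ) ≤ N.choose j := by positivity
  have hb' : (0:ℝ) ≤ N.choose (j+1) := by positivity
  have hjN : (3:ℝ) * (j + 1) ≤ N := by exact_mod_cast hj
  have hj0 : (0:ℝ) ≤ j := by positivity
  by_cases h5 : j < 5
  · rw [min_eq_left (by omega), min_eq_left (by omega), pow_succ, mul_assoc]
    refine mul_le_mul_of_nonneg_left ?_ (by positivity)
    have hj5 : (j:ℝ) + 1 ≤ 5 := by exact_mod_cast h5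
    have : (N.choose j : ℝ) * (j + 1) ≤ R * N.choose (j + 1) * (j + 1) := by
      rw [mul_assoc R, e]
      have : (j:ℝ) + 1 ≤ R * (N - j) := by nlinarith
      nlinarith
    exact le_of_mul_le_mul_right this (by positivity)
  · rw [min_eq_right (by omega), min_eq_right (by omega)]
    refine mul_le_mul_of_nonneg_left ?_ (by positivity)
    have : (N.choose j : ℝ) * (j + 1) ≤ N.choose (j + 1) * (j + 1) := by
      rw [e]
      refine mul_le_mul_of_nonneg_left (by linarith) hb
    exact le_of_mul_le_mul_right this (by positivity)

lemma psi_mono' (N : ℕ) (R : ℝ) (hR0 : 0 < R) (hRN : 100 ≤ R * N) (j i : ℕ) (hji : j ≤ i)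
    (hi : 3 * i ≤ N) :
    R ^ (min j 5) * (N.choose j : ℝ) ≤ R ^ (min i 5) * (N.choose i : ℝ) := by
  induction i, hji using Nat.le_induction with
  | base => exact le_rfl
  | succ i _ ih => exact (ih (by omega)).trans (psi_mono N R hR0 hRN i hi)

lemma psi_step (N f : ℕ) (R : ℝ) (hR0 : 0 < R) (hN : 1000 ≤ N) (hRN : 100 ≤ R * N)
    (hR1 : 10 * f ≤ R * N)
    (hR2 : 100 ≤ R ^ 2 * N) (hf : 30 * f ≤ N) (j : ℕ) (hj : 3 * (j + 2) ≤ N) :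
    f * (R ^ (min (j + 1) 5) * (N.choose (j + 1) : ℝ)) + N * (R ^ (min j 5) * (N.choose j : ℝ))
      ≤ (j + 2 : ℝ) * (R ^ (min (j + 2) 5) * (N.choose (j + 2) : ℝ)) := by
  have e : (N.choose (j + 1) : ℝ) * (j + 1) = N.choose j * (N - j) := by
    have := Nat.choose_succ_right_eq N j
    have h2 : ((N - j : ℕ) : ℝ) = N - j := by rw [Nat.cast_sub (by omega)]
    rw [← h2]; exact_mod_cast this
  have e2 : (N.choose (j + 2) : ℝ) * (j + 2) = N.choose (j + 1) * (N - (j + 1)) := by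
    have := Nat.choose_succ_right_eq N (j + 1)
    have h2 : ((N - (j + 1) : ℕ) : ℝ) = N - (j + 1) := by
      rw [Nat.cast_sub (by omega)]; push_cast; ring
    rw [← h2]; exact_mod_cast this
  have hjN : (3:ℝ) * (j + 2) ≤ N := by exact_mod_cast hj
  have hN' : (1000:ℝ) ≤ N := by exact_mod_cast hN
  have hf' : (30:ℝ) * f ≤ N := by exact_mod_cast hf
  have hj0 : (0:ℝ) ≤ j := by positivity
  have hf0 : (0:ℝ) ≤ f := by positivity
  set b0 : ℝ := ((N.choose j : ℕ) : ℝ)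
  set b1 : ℝ := ((N.choose (j + 1) : ℕ) : ℝ)
  set b2 : ℝ := ((N.choose (j + 2) : ℕ) : ℝ)
  have hb0 : 0 ≤ b0 := by positivity
  have hb1 : 0 ≤ b1 := by positivity
  have hb2 : 0 ≤ b2 := by positivity
  have c1 : (2 / 3 : ℝ) * N * b1 ≤ (j + 2) * b2 := by nlinarith
  have c0 : (2 / 3 : ℝ) * N * b0 ≤ (j + 1) * b1 := by nlinarith
  -- part a
  have pa : f * R ^ (min (j + 1) 5) ≤ (N / 10) * R ^ (min (j + 2) 5) := by
    by_cases h : j + 2 ≤ 5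
    · rw [min_eq_left (by omega), min_eq_left h, pow_succ R (j + 1)]
      have : 0 ≤ R ^ (j + 1) := by positivity
      nlinarith
    · rw [min_eq_right (by omega), min_eq_right (by omega)]
      have : 0 ≤ R ^ 5 := by positivity
      nlinarith
  have pb : (j + 1) * R ^ (min j 5) ≤ (N / 3) * R ^ (min (j + 2) 5) := by
    by_cases h : j + 2 ≤ 5
    · rw [min_eq_left (by omega), min_eq_left h, pow_add R j 2]
      have : 0 ≤ R ^ j := by positivity
      have h5 : (j:ℝ) + 2 ≤ 5 := by exact_mod_cast h
      nlinarith
    · by_cases h6 : j = 4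
      · subst h6
        norm_num
        have : 0 ≤ R ^ 4 := by positivity
        have e5 : R ^ 5 = R ^ 4 * R := by ring
        rw [e5]
        nlinarith
      · rw [min_eq_right (by omega), min_eq_right (by omega)]
        have : 0 ≤ R ^ 5 := by positivity
        nlinarith
  set P2 := R ^ (min (j + 2) 5)
  set P1 := R ^ (min (j + 1) 5)
  set P0 := R ^ (min j 5)
  have hP2 : 0 ≤ P2 := by positivity
  have hP0 : 0 ≤ P0 := by positivity
  have A : f * (P1 * b1) ≤ (3 / 20) * ((j + 2) * (P2 * b2)) := by
    calc f * (P1 * b1) = (f * P1) * b1 := by ring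
      _ ≤ (N / 10 * P2) * b1 := mul_le_mul_of_nonneg_right pa hb1
      _ = (3 / 20) * P2 * ((2 / 3) * N * b1) := by ring
      _ ≤ (3 / 20) * P2 * ((j + 2) * b2) := mul_le_mul_of_nonneg_left c1 (by positivity)
      _ = _ := by ring
  have B : N * (P0 * b0) ≤ (3 / 4) * ((j + 2) * (P2 * b2)) := by
    calc N * (P0 * b0) = (3 / 2) * P0 * ((2 / 3) * N * b0) := by ring
      _ ≤ (3 / 2) * P0 * ((j + 1) * b1) := mul_le_mul_of_nonneg_left c0 (by positivity)
      _ = (3 / 2) * ((j + 1) * P0) * b1 := by ring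
      _ ≤ (3 / 2) * (N / 3 * P2) * b1 := by gcongr
      _ = (3 / 4) * P2 * ((2 / 3) * N * b1) := by ring
      _ ≤ (3 / 4) * P2 * ((j + 2) * b2) := mul_le_mul_of_nonneg_left c1 (by positivity)
      _ = _ := by ring
  have : 0 ≤ (j + 2) * (P2 * b2) := by positivity
  linarith

section gen
variable {α : Type*} [Fintype α] [DecidableEq α]

lemma F_small (g : Perm α) (N : ℕ) (hc : Fintype.card α = N) (R : ℝ) (hR0 : 0 < R)
    (hN : 1000 ≤ N) (hR1 : 10 * fx g ≤ R * N) (hR2 : 100 ≤ R ^ 2 * N) (hf : 30 * fx g ≤ N) :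
    ∀ k, 3 * k ≤ N → (F g k : ℝ) ≤ R ^ (min k 5) * (N.choose k : ℝ) := by
  have hRN : 100 ≤ R * N := by
    have hN' : (1000:ℝ) ≤ N := by exact_mod_cast hN
    have : (100:ℝ) ^ 2 ≤ (R * N) ^ 2 := by nlinarith
    exact le_of_sq_le_sq this (by positivity)
  intro k
  induction k using Nat.strong_induction_on with
  | _ k ih =>
  intro hk
  match k, ih, hk with
  | 0, _, _ => simp [F_zero]
  | 1, _, _ =>
    have h1 : (F g 1 : ℝ) ≤ fx g := by exact_mod_cast F_one g
    have : (0:ℝ) ≤ fx g := by positivity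
    simp
    linarith
  | j + 2, ih, hk =>
    have hstep := psi_step N (fx g) R hR0 hN hRN hR1 hR2 hf j hk
    set ψ : ℕ → ℝ := fun k => R ^ (min k 5) * (N.choose k : ℝ) with hψ
    have hr : ((j + 2 : ℕ) : ℝ) * F g (j + 2) ≤ ∑ x : α,
        if (orb g x).card ≤ j + 2 then (F g (j + 2 - (orb g x).card) : ℝ) else 0 := by
      exact_mod_cast rec_le g (j + 2)
    have hψ0 : ∀ i, 0 ≤ ψ i := fun i => by simp only [hψ]; positivity
    have h2 : (∑ x : α,
        if (orb g x).card ≤ j + 2 then (F g (j + 2 - (orb g x).card) : ℝ) else 0) ≤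
        ∑ x : α, ((if g x = x then ψ (j + 1) else 0) + ψ j) := by
      refine Finset.sum_le_sum fun x _ => ?_
      have h1 := orb_pos g x
      split_ifs with a b b
      · by_cases hcx : (orb g x).card = 1
        · rw [hcx]
          have := ih (j + 1) (by omega) (by omega)
          have := hψ0 j
          simp only [hψ] at *
          exact le_add_of_le_of_nonneg (by simpa using (by assumption)) this
        · have := (ih (j + 2 - (orb g x).card) (by omega) (by omega)).trans
            (psi_mono' N R hR0 hRN _ j (by omega) (by omega))
          have := hψ0 (j + 1)
          simp only [hψ] at *
          linarith
      · by_cases hcx : (orb g x).card = 1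
        · have := pow_orb g x
          rw [hcx, pow_one] at this
          exact absurd this b
        · have := (ih (j + 2 - (orb g x).card) (by omega) (by omega)).trans
            (psi_mono' N R hR0 hRN _ j (by omega) (by omega))
          simp only [hψ] at *
          linarith
      · exact add_nonneg (hψ0 _) (hψ0 _)
      · simpa using hψ0 j
    have h3 : ∑ x : α, ((if g x = x then ψ (j + 1) else 0) + ψ j) =
        fx g * ψ (j + 1) + N * ψ j := by
      rw [Finset.sum_add_distrib, ← Finset.sum_filter, Finset.sum_const, Finset.sum_const,
        Finset.card_univ, hc, nsmul_eq_mul, nsmul_eq_mul]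
      rfl
    rw [h3] at h2
    have h4 : ((j + 2 : ℕ) : ℝ) * F g (j + 2) ≤ ((j + 2 : ℕ) : ℝ) * ψ (j + 2) := by
      refine (hr.trans h2).trans ?_
      push_cast
      exact hstep
    exact le_of_mul_le_mul_left h4 (by positivity)
end gen

lemma three_pow_le_choose (m : ℕ) : 3 ^ m ≤ (3 * m).choose m := by
  induction m with
  | zero => simp
  | succ m ih =>
    have h := Nat.add_one_mul_choose_eq (3 * m + 2) m
    have h1 : (3 * m + 2 + 1) = 3 * (m + 1) := by ring
    rw [h1] at h
    have h2 : (3 * (m + 1)).choose (m + 1) = 3 * (3 * m + 2).choose m := by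
      have : (m + 1) * ((3 * (m + 1)).choose (m + 1)) = (m + 1) * (3 * (3 * m + 2).choose m) := by
        rw [mul_comm, ← h]; ring
      exact Nat.eq_of_mul_eq_mul_left (by omega) this
    rw [h2, pow_succ, mul_comm]
    exact Nat.mul_le_mul_left _ (ih.trans (Nat.choose_le_choose _ (by omega)))

lemma choose_mono_half (N i k : ℕ) (hik : i ≤ k) (hk : 2 * k ≤ N) : N.choose i ≤ N.choose k := by
  induction k, hik using Nat.le_induction with
  | base => exact le_rfl
  | succ k _ ih =>
    exact (ih (by omega)).trans (Nat.choose_le_succ_of_lt_half_left (by omega))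

lemma exists_A : ∃ A : ℝ, 1 ≤ A ∧ ∀ p : ℕ, ((60 * p : ℕ) : ℝ) ^ 3 * (2 ^ 31) ^ p ≤ A * (3 ^ 20) ^ p := by
  have h := tendsto_pow_const_mul_const_pow_of_abs_lt_one 3 (r := (2/3:ℝ)) (by rw [abs_of_pos] <;> norm_num)
  obtain ⟨B, hB⟩ := h.bddAbove_range
  refine ⟨max 1 (60 ^ 3 * B), le_max_left _ _, fun p => ?_⟩
  have h1 : (p:ℝ) ^ 3 * (2 / 3) ^ p ≤ B := hB ⟨p, rfl⟩
  have h2 : ((2:ℝ) ^ 31) ^ p ≤ (2 / 3) ^ p * (3 ^ 20) ^ p := by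
    rw [← mul_pow]
    exact pow_le_pow_left₀ (by norm_num) (by norm_num) _
  push_cast
  calc (60 * (p:ℝ)) ^ 3 * (2 ^ 31) ^ p ≤ (60 * (p:ℝ)) ^ 3 * ((2 / 3) ^ p * (3 ^ 20) ^ p) := by gcongr
    _ = 60 ^ 3 * ((p:ℝ) ^ 3 * (2 / 3) ^ p) * (3 ^ 20) ^ p := by ring
    _ ≤ 60 ^ 3 * B * (3 ^ 20) ^ p := by gcongr
    _ ≤ _ := by gcongr; exact le_max_right _ _

/-- Uniform bound for `k ≥ 5`. -/
lemma F_large : ∃ A : ℝ, 1 ≤ A ∧ ∀ {α : Type} [Fintype α] [DecidableEq α] (g : Perm α) (p N : ℕ),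
    Fintype.card α = N → N = 60 * p → 1000 ≤ N → 30 * fx g ≤ N → ∀ k, 5 ≤ k → 2 * k ≤ N →
    (F g k : ℝ) ≤ A * ((fx g / N : ℝ) ^ 3 + 1 / (N ^ 2 * √N)) * N.choose k := by
  obtain ⟨A0, hA1, hA⟩ := exists_A
  refine ⟨max A0 (10 ^ 5), le_max_of_le_left hA1, ?_⟩
  intro α _ _ g p N hc hp hN hf k hk5 hk
  have hN' : (1000:ℝ) ≤ N := by exact_mod_cast hN
  have hN0 : (0:ℝ) < N := by linarith
  have hs : 0 < √(N:ℝ) := Real.sqrt_pos.mpr hN0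
  have hss : √(N:ℝ) * √N = N := Real.mul_self_sqrt hN0.le
  have hf' : (30:ℝ) * fx g ≤ N := by exact_mod_cast hf
  have hf0 : (0:ℝ) ≤ fx g := by positivity
  by_cases h3 : 3 * k ≤ N
  · set m : ℝ := max (fx g / N : ℝ) (1 / √N) with hm
    have hm1 : (fx g / N : ℝ) ≤ m := le_max_left _ _
    have hm2 : 1 / √(N:ℝ) ≤ m := le_max_right _ _
    have hm0 : 0 < m := lt_of_lt_of_le (by positivity) hm2
    have h := F_small g N hc (10 * m) (by positivity) hN ?_ ?_ hf k h3
    · rw [min_eq_right hk5] at h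
      refine h.trans ?_
      refine mul_le_mul_of_nonneg_right ?_ (by positivity)
      have h5 : m ^ 5 ≤ (fx g / N : ℝ) ^ 3 + 1 / (N ^ 2 * √N) := by
        have q0 : (0:ℝ) ≤ fx g / N := by positivity
        have q1 : (fx g / N : ℝ) ≤ 1 := by rw [div_le_one hN0]; linarith
        rcases max_choice (fx g / N : ℝ) (1 / √N) with h | h
        · rw [hm, h]
          have : (fx g / N : ℝ) ^ 5 ≤ (fx g / N : ℝ) ^ 3 := pow_le_pow_of_le_one q0 q1 (by norm_num)
          have : 0 ≤ 1 / ((N:ℝ) ^ 2 * √N) := by positivity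
          linarith
        · rw [hm, h]
          have : (1 / √(N:ℝ)) ^ 5 = 1 / ((N:ℝ) ^ 2 * √N) := by
            rw [div_pow, one_pow]
            congr 1
            calc √(N:ℝ) ^ 5 = (√(N:ℝ) * √N) ^ 2 * √N := by ring
              _ = _ := by rw [hss]
          rw [this]
          have : 0 ≤ (fx g / N : ℝ) ^ 3 := by positivity
          linarith
      calc (10 * m) ^ 5 = 10 ^ 5 * m ^ 5 := by ring
        _ ≤ max A0 (10 ^ 5) * m ^ 5 := by gcongr; exact le_max_right _ _
        _ ≤ _ := by gcongr
    · rw [div_le_iff₀ hN0] at hm1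
      linarith
    · have : (1 / √(N:ℝ)) ^ 2 ≤ m ^ 2 := by gcongr
      rw [div_pow, one_pow, Real.sq_sqrt hN0.le, div_le_iff₀ hN0] at this
      nlinarith
  · have h1 := F_le_two_pow g k (31 * p) (by omega)
    have h2 : 3 ^ (20 * p) ≤ N.choose k := by
      refine (three_pow_le_choose (20 * p)).trans ?_
      rw [show 3 * (20 * p) = N by omega]
      exact choose_mono_half N _ _ (by omega) hk
    have h1' : (F g k : ℝ) ≤ (2 ^ 31) ^ p := by rw [← pow_mul]; exact_mod_cast h1
    have h2' : ((3:ℝ) ^ 20) ^ p ≤ N.choose k := by rw [← pow_mul]; exact_mod_cast h2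
    have h3 := hA p
    rw [← hp] at h3
    have h4 : (N:ℝ) ^ 3 * F g k ≤ A0 * N.choose k := by
      calc (N:ℝ) ^ 3 * F g k ≤ N ^ 3 * (2 ^ 31) ^ p := by gcongr
        _ ≤ _ := h3
        _ ≤ _ := by gcongr
    have hb : (0:ℝ) ≤ N.choose k := by positivity
    have hsN : √(N:ℝ) ≤ N := by nlinarith [Real.sqrt_nonneg (N:ℝ), Real.one_le_sqrt.mpr (by linarith : (1:ℝ) ≤ N)]
    calc (F g k : ℝ) ≤ A0 * (1 / N ^ 3) * N.choose k := by
          rw [mul_one_div, div_mul_eq_mul_div, le_div_iff₀ (by positivity)]; linarith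
      _ ≤ A0 * (1 / (N ^ 2 * √N)) * N.choose k := by
          gcongr
          calc (N:ℝ) ^ 2 * √N ≤ N ^ 2 * N := by gcongr
            _ = (N:ℝ) ^ 3 := by ring
      _ ≤ _ := by
          gcongr
          · exact le_max_left _ _
          · have : 0 ≤ (fx g / N : ℝ) ^ 3 := by positivity
            linarith
end TUB


namespace TUB

lemma exists_pow_le (c : ℝ) : ∃ B : ℝ, 1 ≤ B ∧ ∀ m : ℕ, c ^ m ≤ B * (m.factorial : ℝ) := by
  obtain ⟨B, hB⟩ := (FloorSemiring.tendsto_pow_div_factorial_atTop c).bddAbove_range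
  refine ⟨max 1 B, le_max_left _ _, fun m => ?_⟩
  have h : c ^ m / (m.factorial : ℝ) ≤ B := hB ⟨m, rfl⟩
  rw [div_le_iff₀ (by positivity)] at h
  refine h.trans ?_
  gcongr
  exact le_max_right _ _

lemma choose_two_le (n j : ℕ) (h2 : 2 ≤ j) (hj : j + 2 ≤ n) : n.choose 2 ≤ n.choose j := by
  by_cases h : 2 * j ≤ n
  · exact choose_mono_half n 2 j h2 h
  · rw [← Nat.choose_symm (show j ≤ n by omega)]
    exact choose_mono_half n 2 _ (by omega) (by omega)

lemma exists_D : ∃ D : ℝ, 1 ≤ D ∧ ∀ n j : ℕ, 2 ≤ j → j ≤ n →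
    (8:ℝ) ^ j * ((n - j).factorial * (j / 2).factorial) * n ^ 2 ≤ D * n.factorial := by
  obtain ⟨B, hB1, hB⟩ := exists_pow_le 1024
  refine ⟨4 * 32 * B, by linarith, fun n j h2 hj => ?_⟩
  have hB' : (32:ℝ) ^ j ≤ 32 * B * (j / 2).factorial := by
    have h := hB (j / 2)
    have : (32:ℝ) ^ j ≤ 32 ^ (2 * (j / 2) + 1) := pow_le_pow_right₀ (by norm_num) (by omega)
    rw [pow_succ, pow_mul] at this
    norm_num at this
    linarith
  have key : (8:ℝ) ^ j * n ^ 2 ≤ 4 * 32 * B * (n.choose j * (j / 2).factorial) := by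
    by_cases hjn : j + 2 ≤ n
    · have h1 : (n.choose 2 : ℝ) ≤ n.choose j := by exact_mod_cast choose_two_le n j h2 hjn
      rw [Nat.cast_choose_two] at h1
      have hn : (2:ℝ) ≤ n := by exact_mod_cast (by omega : 2 ≤ n)
      have h3 : (n:ℝ) ^ 2 ≤ 4 * n.choose j := by nlinarith
      have h8 : (8:ℝ) ^ j ≤ 32 ^ j := pow_le_pow_left₀ (by norm_num) (by norm_num) _
      calc (8:ℝ) ^ j * n ^ 2 ≤ (32 * B * (j / 2).factorial) * (4 * n.choose j) := by
            gcongr; exact h8.trans hB'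
        _ = _ := by ring
    · have h1 : (1:ℝ) ≤ n.choose j := by exact_mod_cast Nat.choose_pos hj
      have h3 : (n:ℝ) ≤ 2 ^ j := by
        have : n ≤ 2 ^ j := by have := Nat.lt_two_pow_self (n := j); omega
        exact_mod_cast this
      calc (8:ℝ) ^ j * n ^ 2 ≤ 8 ^ j * (2 ^ j) ^ 2 := by gcongr
        _ = 32 ^ j := by rw [← pow_mul, mul_comm j 2, pow_mul, ← mul_pow]; norm_num
        _ ≤ 32 * B * (j / 2).factorial := hB'
        _ ≤ 4 * (32 * B * (j / 2).factorial) * n.choose j := by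
            have : 0 ≤ 32 * B * (j / 2).factorial := by positivity
            nlinarith
        _ = _ := by ring
  have hfac : (n.choose j : ℝ) * ((j / 2).factorial * (j / 2).factorial) * (n - j).factorial ≤ n.factorial := by
    have h1 := Nat.choose_mul_factorial_mul_factorial hj
    have h2 : (j / 2).factorial * (j / 2).factorial ≤ j.factorial :=
      (Nat.mul_le_mul_left _ (Nat.factorial_le (by omega : j / 2 ≤ j - j / 2))).trans
        (Nat.le_of_dvd (Nat.factorial_pos _) (Nat.factorial_mul_factorial_dvd_factorial (by omega)))
    have : n.choose j * ((j / 2).factorial * (j / 2).factorial) * (n - j).factorial ≤ n.factorial := by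
      rw [← h1]
      gcongr
    exact_mod_cast this
  calc (8:ℝ) ^ j * ((n - j).factorial * (j / 2).factorial) * n ^ 2
      = ((8:ℝ) ^ j * n ^ 2) * ((n - j).factorial * (j / 2).factorial) := by ring
    _ ≤ (4 * 32 * B * (n.choose j * (j / 2).factorial)) * ((n - j).factorial * (j / 2).factorial) := by
        gcongr
    _ = 4 * 32 * B * ((n.choose j : ℝ) * ((j / 2).factorial * (j / 2).factorial) * (n - j).factorial) := by ring
    _ ≤ _ := by gcongr

noncomputable def cent {n : ℕ} (g : Perm (Fin n)) : ℕ := Nat.card (Subgroup.centralizer {g})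

lemma prod_le_two_pow (m : Multiset ℕ) : m.prod ≤ 2 ^ m.sum := by
  induction m using Multiset.induction with
  | empty => simp
  | cons a s ih =>
    rw [Multiset.prod_cons, Multiset.sum_cons, pow_add]
    exact Nat.mul_le_mul Nat.lt_two_pow_self.le ih

lemma cent_le {n : ℕ} (g : Perm (Fin n)) :
    cent g ≤ (n - g.support.card).factorial * 2 ^ g.support.card * (g.support.card / 2).factorial := by
  rw [cent, Equiv.Perm.nat_card_centralizer, Fintype.card_fin, ← Equiv.Perm.sum_cycleType]
  refine Nat.mul_le_mul (Nat.mul_le_mul_left _ (prod_le_two_pow _)) ?_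
  refine (Nat.le_of_dvd (Nat.factorial_pos _) (Nat.prod_factorial_dvd_factorial_sum _ _)).trans ?_
  apply Nat.factorial_le
  rw [Multiset.toFinset_sum_count_eq]
  have := Multiset.card_nsmul_le_sum (s := g.cycleType) (a := 2)
    (fun x hx => Equiv.Perm.two_le_of_mem_cycleType hx)
  rw [smul_eq_mul] at this
  omega

lemma sum_cent_ct {n : ℕ} (m : Multiset ℕ) :
    ∑ g ∈ (univ : Finset (Perm (Fin n))).filter (fun g => g.cycleType = m), cent g ≤ n.factorial := by
  have h := Equiv.Perm.card_of_cycleType_mul_eq (Fin n) m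
  rw [Fintype.card_fin] at h
  have : ∀ g ∈ (univ : Finset (Perm (Fin n))).filter (fun g => g.cycleType = m), cent g =
      (n - m.sum).factorial * m.prod * ∏ i ∈ m.toFinset, (Multiset.count i m).factorial := by
    intro g hg
    rw [Finset.mem_filter] at hg
    rw [cent, Equiv.Perm.nat_card_centralizer, Fintype.card_fin, hg.2]
  rw [Finset.sum_congr rfl this, Finset.sum_const, smul_eq_mul, h]
  split_ifs <;> simp

lemma card_ct {n : ℕ} (j : ℕ) :
    (((univ : Finset (Perm (Fin n))).filter (fun g => g.support.card = j)).image
      Equiv.Perm.cycleType).card ≤ 2 ^ j := by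
  have h : (((univ : Finset (Perm (Fin n))).filter (fun g => g.support.card = j)).image
      Equiv.Perm.cycleType) ⊆ (univ : Finset (Nat.Partition j)).image Nat.Partition.parts := by
    intro m hm
    rw [Finset.mem_image] at hm ⊢
    obtain ⟨g, hg, rfl⟩ := hm
    rw [Finset.mem_filter] at hg
    refine ⟨⟨g.cycleType, fun hi => by
      have := Equiv.Perm.two_le_of_mem_cycleType hi; omega, ?_⟩, Finset.mem_univ _, rfl⟩
    rw [Equiv.Perm.sum_cycleType, hg.2]
  refine (Finset.card_le_card h).trans (Finset.card_image_le.trans ?_)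
  rw [Finset.card_univ]
  refine (Fintype.card_le_of_surjective _ (Nat.Partition.ofComposition_surj (n := j))).trans ?_
  rw [composition_card]
  exact Nat.pow_le_pow_right (by norm_num) (by omega)

lemma sum_cent_supp {n : ℕ} (j : ℕ) :
    ∑ g ∈ (univ : Finset (Perm (Fin n))).filter (fun g => g.support.card = j), cent g
      ≤ 2 ^ j * n.factorial := by
  rw [← Finset.sum_fiberwise_of_maps_to (g := Equiv.Perm.cycleType)
    (fun g hg => Finset.mem_image_of_mem _ hg)]
  refine (Finset.sum_le_card_nsmul _ _ n.factorial fun m _ => ?_).trans ?_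
  · refine le_trans (Finset.sum_le_sum_of_subset ?_) (sum_cent_ct m)
    intro g hg
    simp only [Finset.mem_filter, Finset.mem_univ, true_and] at hg ⊢
    exact hg.2
  · rw [smul_eq_mul]
    exact Nat.mul_le_mul_right _ (card_ct j)

lemma cent_bounds : ∃ D : ℝ, 1 ≤ D ∧ ∀ n : ℕ, 1 ≤ n →
    (∀ g : Perm (Fin n), g ≠ 1 → (cent g : ℝ) ≤ D / n ^ 2 * n.factorial) ∧
    ∑ g ∈ (univ : Finset (Perm (Fin n))).filter (fun g => g ≠ 1), (cent g : ℝ) ^ 2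
      ≤ D / n ^ 2 * n.factorial ^ 2 := by
  obtain ⟨D, hD1, hD⟩ := exists_D
  refine ⟨2 * D, by linarith, fun n hn => ?_⟩
  have hn0 : (0:ℝ) < n := by exact_mod_cast hn
  have hb : ∀ g : Perm (Fin n), g ≠ 1 →
      (4:ℝ) ^ g.support.card * (cent g : ℝ) ≤ D / n ^ 2 * n.factorial := by
    intro g hg
    have h2 : 2 ≤ g.support.card := Equiv.Perm.two_le_card_support_of_ne_one hg
    have hj : g.support.card ≤ n := by
      simpa using Finset.card_le_univ g.support
    have h := hD n _ h2 hj
    have hc : (cent g : ℝ) ≤ (n - g.support.card).factorial * 2 ^ g.support.card * (g.support.card / 2).factorial := by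
      exact_mod_cast cent_le g
    rw [div_mul_eq_mul_div, le_div_iff₀ (by positivity)]
    refine le_trans ?_ h
    refine mul_le_mul_of_nonneg_right ?_ (by positivity)
    refine (mul_le_mul_of_nonneg_left hc (by positivity)).trans (le_of_eq ?_)
    have : (8:ℝ) ^ g.support.card = 4 ^ g.support.card * 2 ^ g.support.card := by
      rw [← mul_pow]; norm_num
    rw [this]; ring
  constructor
  · intro g hg
    have h := hb g hg
    have h1 : (1:ℝ) ≤ 4 ^ g.support.card := one_le_pow₀ (by norm_num)
    have h0 : (0:ℝ) ≤ cent g := by positivity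
    have : D / n ^ 2 * n.factorial ≤ 2 * D / n ^ 2 * n.factorial := by gcongr; linarith
    nlinarith
  · rw [← Finset.sum_fiberwise_of_maps_to (g := fun g : Perm (Fin n) => g.support.card)
      (t := Finset.range (n + 1)) (fun g _ => by
        rw [Finset.mem_range, Nat.lt_succ_iff]; simpa using Finset.card_le_univ g.support)]
    have hj : ∀ j ∈ Finset.range (n + 1), ∑ g ∈ ((univ : Finset (Perm (Fin n))).filter
        (fun g => g ≠ 1)).filter (fun g => g.support.card = j), (cent g : ℝ) ^ 2 ≤
        D / n ^ 2 * n.factorial ^ 2 * (1 / 2) ^ j := by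
      intro j _
      have hs : (∑ g ∈ (univ : Finset (Perm (Fin n))).filter (fun g => g.support.card = j), (cent g : ℝ))
        ≤ 2 ^ j * n.factorial := by exact_mod_cast sum_cent_supp j
      calc _ ≤ ∑ g ∈ ((univ : Finset (Perm (Fin n))).filter
        (fun g => g ≠ 1)).filter (fun g => g.support.card = j),
            (D / n ^ 2 * n.factorial * (1 / 4) ^ j) * (cent g : ℝ) := by
            refine Finset.sum_le_sum fun g hg => ?_
            simp only [Finset.mem_filter, Finset.mem_univ, true_and] at hg
            have := hb g hg.1
            rw [hg.2] at this
            rw [pow_two]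
            refine mul_le_mul_of_nonneg_right ?_ (by positivity)
            rw [one_div, inv_pow, ← div_eq_mul_inv, le_div_iff₀ (by positivity)]
            linarith
        _ = (D / n ^ 2 * n.factorial * (1 / 4) ^ j) * ∑ g ∈ ((univ : Finset (Perm (Fin n))).filter
        (fun g => g ≠ 1)).filter (fun g => g.support.card = j), (cent g : ℝ) := by
            rw [Finset.mul_sum]
        _ ≤ (D / n ^ 2 * n.factorial * (1 / 4) ^ j) * (2 ^ j * n.factorial) := by
            refine mul_le_mul_of_nonneg_left (le_trans ?_ hs) (by positivity)
            refine Finset.sum_le_sum_of_subset_of_nonneg ?_ (fun _ _ _ => by positivity)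
            intro g hg
            simp only [Finset.mem_filter, Finset.mem_univ, true_and] at hg ⊢
            exact hg.2
        _ = _ := by
            have : ((1:ℝ) / 2) ^ j = (1 / 4) ^ j * 2 ^ j := by rw [← mul_pow]; norm_num
            rw [this]; ring
    refine (Finset.sum_le_sum hj).trans ?_
    rw [← Finset.mul_sum]
    have hg : ∑ j ∈ Finset.range (n + 1), ((1:ℝ) / 2) ^ j ≤ 2 := sum_geometric_two_le _
    calc _ ≤ D / n ^ 2 * n.factorial ^ 2 * 2 := by gcongr
      _ = _ := by ring

def tor (n p : ℕ) : ℕ := ((univ : Finset (Perm (Fin n))).filter (fun g => g ^ p = 1)).card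

lemma tor_le (n p : ℕ) [hp : Fact p.Prime] (hp3 : p ≤ 3) :
    tor n p * (n / 6).factorial ≤ (n + 1) * n.factorial := by
  have hp2 := hp.out.two_le
  have hmaps : ∀ g ∈ (univ : Finset (Perm (Fin n))).filter (fun g => g ^ p = 1),
      g.cycleType ∈ (Finset.range (n + 1)).image (fun a => Multiset.replicate a p) := by
    intro g hg
    rw [Finset.mem_filter, Equiv.Perm.pow_prime_eq_one_iff] at hg
    have h1 := Multiset.eq_replicate_card.mpr hg.2
    rw [Finset.mem_image]
    refine ⟨g.cycleType.card, ?_, h1.symm⟩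
    have h2 := Equiv.Perm.sum_cycleType g
    rw [h1, Multiset.sum_replicate, smul_eq_mul] at h2
    have h3 : g.support.card ≤ n := by simpa using Finset.card_le_univ g.support
    rw [Finset.mem_range]
    nlinarith
  rw [tor, Finset.card_eq_sum_card_fiberwise hmaps, Finset.sum_mul]
  refine (Finset.sum_le_card_nsmul _ _ n.factorial fun m hm => ?_).trans ?_
  · rw [Finset.mem_image] at hm
    obtain ⟨a, _, rfl⟩ := hm
    have h := Equiv.Perm.card_of_cycleType_mul_eq (Fin n) (Multiset.replicate a p)
    rw [Fintype.card_fin] at h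
    have hle : (univ.filter fun g : Perm (Fin n) => g.cycleType = Multiset.replicate a p).card *
        ((n - (Multiset.replicate a p).sum).factorial * (Multiset.replicate a p).prod *
          ∏ i ∈ (Multiset.replicate a p).toFinset, (Multiset.count i (Multiset.replicate a p)).factorial)
          ≤ n.factorial := by
      rw [h]; split_ifs <;> simp
    refine le_trans (Nat.mul_le_mul (Finset.card_le_card ?_) ?_) hle
    · intro g hg
      simp only [Finset.mem_filter, Finset.mem_univ, true_and] at hg ⊢
      exact hg.2
    · rw [Multiset.sum_replicate, Multiset.prod_replicate, smul_eq_mul]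
      have hpa : 1 ≤ p ^ a := Nat.one_le_pow _ _ (by omega)
      have hprod : 1 ≤ ∏ i ∈ (Multiset.replicate a p).toFinset, (Multiset.count i (Multiset.replicate a p)).factorial :=
        Nat.one_le_iff_ne_zero.mpr (Finset.prod_ne_zero_iff.mpr fun i _ => Nat.factorial_ne_zero _)
      by_cases ha : a ≤ n / 6
      · have h1 : (n / 6).factorial ≤ (n - a * p).factorial := by
          apply Nat.factorial_le
          have : a * p ≤ a * 3 := Nat.mul_le_mul_left _ hp3
          omega
        calc (n / 6).factorial ≤ (n - a * p).factorial := h1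
          _ ≤ (n - a * p).factorial * p ^ a := Nat.le_mul_of_pos_right _ hpa
          _ ≤ _ := Nat.le_mul_of_pos_right _ hprod
      · have h1 : (n / 6).factorial ≤ a.factorial := Nat.factorial_le (by omega)
        have ha0 : a ≠ 0 := by omega
        have h2 : ∏ i ∈ (Multiset.replicate a p).toFinset, (Multiset.count i (Multiset.replicate a p)).factorial = a.factorial := by
          have : (Multiset.replicate a p).toFinset = {p} := by
            ext x; simp [Multiset.mem_replicate, ha0]
          rw [this, Finset.prod_singleton, Multiset.count_replicate_self]
        rw [h2]
        refine h1.trans (Nat.le_mul_of_pos_left _ ?_)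
        exact Nat.mul_pos (Nat.factorial_pos _) hpa
  · rw [smul_eq_mul]
    refine Nat.mul_le_mul_right _ (Finset.card_image_le.trans ?_)
    simp

lemma tor_bound : ∃ E : ℝ, 1 ≤ E ∧ ∀ n : ℕ, 1 ≤ n →
    (tor n 2 : ℝ) ≤ E / n ^ 2 * n.factorial ∧ (tor n 3 : ℝ) ≤ E / n ^ 2 * n.factorial := by
  obtain ⟨B, hB1, hB⟩ := exists_pow_le (8 ^ 6)
  refine ⟨8 ^ 6 * B, by linarith, fun n hn => ?_⟩
  have hn0 : (0:ℝ) < n := by exact_mod_cast hn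
  have key : ((n:ℝ) + 1) * n ^ 2 ≤ 8 ^ 6 * B * (n / 6).factorial := by
    have h1 : (n:ℝ) + 1 ≤ 2 ^ n := by exact_mod_cast Nat.lt_two_pow_self (n := n)
    calc ((n:ℝ) + 1) * n ^ 2 ≤ 2 ^ n * (2 ^ n) ^ 2 := by
          gcongr; linarith
      _ = 8 ^ n := by rw [← pow_mul, mul_comm n 2, pow_mul, ← mul_pow]; norm_num
      _ ≤ 8 ^ (6 * (n / 6) + 6) := pow_le_pow_right₀ (by norm_num) (by omega)
      _ = 8 ^ 6 * (8 ^ 6) ^ (n / 6) := by rw [pow_add, pow_mul]; ring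
      _ ≤ 8 ^ 6 * (B * (n / 6).factorial) := by gcongr; exact hB _
      _ = _ := by ring
  have main : ∀ p : ℕ, p.Prime → p ≤ 3 → (tor n p : ℝ) ≤ 8 ^ 6 * B / n ^ 2 * n.factorial := by
    intro p hp hp3
    have : Fact p.Prime := ⟨hp⟩
    have h : (tor n p : ℝ) * (n / 6).factorial ≤ (n + 1) * n.factorial := by
      exact_mod_cast tor_le n p hp3
    rw [div_mul_eq_mul_div, le_div_iff₀ (by positivity)]
    have hf : (0:ℝ) < (n / 6).factorial := by positivity
    refine le_of_mul_le_mul_right ?_ hf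
    calc (tor n p : ℝ) * n ^ 2 * (n / 6).factorial = ((tor n p : ℝ) * (n / 6).factorial) * n ^ 2 := by ring
      _ ≤ (((n:ℝ) + 1) * n.factorial) * (n:ℝ) ^ 2 := by gcongr
      _ = (((n:ℝ) + 1) * n ^ 2) * n.factorial := by ring
      _ ≤ (8 ^ 6 * B * (n / 6).factorial) * n.factorial := by gcongr
      _ = _ := by ring
  exact ⟨main 2 Nat.prime_two (by norm_num), main 3 Nat.prime_three le_rfl⟩

end TUB


namespace TUB

def act (n : ℕ) : Perm (Fin n) × Perm (Fin n) →* Perm (Perm (Fin n)) where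
  toFun p := (Equiv.mulLeft p.1).trans (Equiv.mulRight p.2⁻¹)
  map_one' := by ext1 σ; simp
  map_mul' p q := by ext1 σ; simp [mul_assoc]

lemma act_apply {n : ℕ} (p : Perm (Fin n) × Perm (Fin n)) (σ : Perm (Fin n)) :
    act n p σ = p.1 * σ * p.2⁻¹ := rfl

def mact (n k : ℕ) : MulAction (Perm (Fin n) × Perm (Fin n))
    {s : Finset (Perm (Fin n)) // s.card = k} where
  smul p x := ⟨x.1.map (act n p).toEmbedding, by rw [Finset.card_map, x.2]⟩
  one_smul x := by
    apply Subtype.ext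
    change x.1.map (act n 1).toEmbedding = x.1
    rw [map_one]
    exact Finset.map_refl
  mul_smul p q x := by
    apply Subtype.ext
    change x.1.map (act n (p * q)).toEmbedding =
      (x.1.map (act n q).toEmbedding).map (act n p).toEmbedding
    rw [Finset.map_map]
    congr 1

lemma burnside (n k : ℕ) :
    T n k * (n.factorial * n.factorial) ≤ ∑ p : Perm (Fin n) × Perm (Fin n), F (act n p) k := by
  classical
  letI := mact n k
  have h := MulAction.sum_card_fixedBy_eq_card_orbits_mul_card_group
    (Perm (Fin n) × Perm (Fin n)) {s : Finset (Perm (Fin n)) // s.card = k}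
  rw [Fintype.card_prod, Fintype.card_perm, Fintype.card_fin] at h
  have h1 : T n k ≤ Fintype.card (Quotient (MulAction.orbitRel
      (Perm (Fin n) × Perm (Fin n)) {s : Finset (Perm (Fin n)) // s.card = k})) := by
    rw [T, ← Nat.card_eq_fintype_card]
    let φ : Quotient (MulAction.orbitRel
      (Perm (Fin n) × Perm (Fin n)) {s : Finset (Perm (Fin n)) // s.card = k}) →
        Quot (permSetRel n k) := Quotient.lift (fun x => Quot.mk _ x) (by
        intro x y hxy
        obtain ⟨p, hp⟩ := hxy
        refine (Quot.sound ?_).symm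
        refine ⟨p.1, p.2⁻¹, ?_⟩
        rw [← hp]
        change _ = y.1.map (act n p).toEmbedding
        rw [Finset.map_eq_image]
        rfl)
    refine Nat.card_le_card_of_surjective φ ?_
    intro q
    obtain ⟨x, rfl⟩ := Quot.exists_rep q
    exact ⟨Quotient.mk _ x, rfl⟩
  refine (Nat.mul_le_mul_right _ h1).trans ?_
  rw [← h]
  refine Finset.sum_le_sum fun p _ => ?_
  rw [F, ← Fintype.card_coe]
  refine Fintype.card_le_of_injective (fun x => ⟨x.1.1, ?_⟩) ?_
  · have hx : x.1.1.map (act n p).toEmbedding = x.1.1 := congrArg Subtype.val x.2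
    rw [mem_invs]
    refine ⟨x.1.2, fun σ => ?_⟩
    have := Finset.mem_map' (act n p).toEmbedding (a := σ) (s := x.1.1)
    rw [hx] at this
    exact this
  · intro x y hxy
    apply Subtype.ext
    apply Subtype.ext
    simpa using hxy

lemma T_le_choose (n k : ℕ) : T n k ≤ n.factorial.choose k := by
  have h : T n k ≤ Nat.card {s : Finset (Perm (Fin n)) // s.card = k} :=
    Nat.card_le_card_of_surjective (Quot.mk _) Quot.mk_surjective
  refine h.trans ?_
  rw [Nat.card_eq_fintype_card, Fintype.card_finset_len, Fintype.card_perm, Fintype.card_fin]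

lemma F_le_choose {α : Type*} [Fintype α] [DecidableEq α] (g : Perm α) (k : ℕ) :
    F g k ≤ (Fintype.card α).choose k := by
  rw [← Finset.card_univ, ← Finset.card_powersetCard]
  refine Finset.card_le_card fun X hX => ?_
  rw [mem_invs] at hX
  simp [Finset.mem_powersetCard, hX.1]

lemma fx_act_le {n : ℕ} (p : Perm (Fin n) × Perm (Fin n)) : fx (act n p) ≤ cent p.1 := by
  classical
  rw [fx]
  rcases Finset.eq_empty_or_nonempty (univ.filter fun x => act n p x = x) with h | ⟨τ, hτ⟩
  · rw [h]; simp
  · rw [cent, Nat.card_eq_fintype_card, ← Fintype.card_coe]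
    have hτ' : p.1 * τ * p.2⁻¹ = τ := by
      have := (Finset.mem_filter.mp hτ).2
      rwa [act_apply] at this
    have hp2 : p.2 = τ⁻¹ * p.1 * τ := by
      rw [mul_inv_eq_iff_eq_mul] at hτ'
      rw [mul_assoc, hτ']; group
    refine Fintype.card_le_of_injective (fun σ => ⟨σ.1 * τ⁻¹, ?_⟩) ?_
    · have hσ := σ.2
      rw [Finset.mem_filter, act_apply, mul_inv_eq_iff_eq_mul, hp2] at hσ
      rw [Subgroup.mem_centralizer_singleton_iff]
      have h2 := hσ.2
      calc σ.1 * τ⁻¹ * p.1 = (σ.1 * (τ⁻¹ * p.1 * τ)) * τ⁻¹ := by group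
        _ = (p.1 * σ.1) * τ⁻¹ := by rw [← h2]
        _ = _ := by group
    · intro σ ρ h
      apply Subtype.ext
      simpa using h

lemma fx_act_eq_zero {n : ℕ} (p : Perm (Fin n) × Perm (Fin n)) (hp : p ≠ 1) (h1 : p.1 = 1) :
    fx (act n p) = 0 := by
  rw [fx, Finset.card_eq_zero, Finset.eq_empty_iff_forall_notMem]
  intro σ hσ
  rw [Finset.mem_filter, act_apply, h1, one_mul, mul_inv_eq_iff_eq_mul] at hσ
  have : p.2 = 1 := by simpa using hσ.2
  exact hp (Prod.ext h1 this)

lemma sum_fx {n : ℕ} (a : Perm (Fin n)) :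
    ∑ b : Perm (Fin n), fx (act n (a, b)) ≤ n.factorial := by
  classical
  have h := Finset.sum_card_bipartiteAbove_eq_sum_card_bipartiteBelow
      (s := (univ : Finset (Perm (Fin n)))) (t := (univ : Finset (Perm (Fin n))))
      (fun b σ => act n (a, b) σ = σ)
  simp only [Finset.bipartiteAbove, Finset.bipartiteBelow] at h
  simp only [fx]
  rw [h]
  refine (Finset.sum_le_card_nsmul _ _ 1 fun σ _ => ?_).trans ?_
  · rw [Finset.card_le_one]
    intro b hb c hc
    have hb := (Finset.mem_filter.mp hb).2
    have hc := (Finset.mem_filter.mp hc).2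
    rw [act_apply] at hb hc
    have := hb.trans hc.symm
    simpa using this
  · simp [Finset.card_univ, Fintype.card_perm]

section sums
variable {n : ℕ}

lemma sum_fx3 :
    ∑ p ∈ (univ : Finset (Perm (Fin n) × Perm (Fin n))).filter (fun p => p ≠ 1),
      (fx (act n p) : ℝ) ^ 3 ≤
    n.factorial * ∑ g ∈ (univ : Finset (Perm (Fin n))).filter (fun g => g ≠ 1), (cent g : ℝ) ^ 2 := by
  calc _ ≤ ∑ p : Perm (Fin n) × Perm (Fin n),
        (if p.1 ≠ 1 then (cent p.1 : ℝ) ^ 2 else 0) * fx (act n p) := by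
        rw [Finset.sum_filter]
        refine Finset.sum_le_sum fun p _ => ?_
        by_cases h1 : p.1 = 1
        · by_cases hp : p ≠ 1
          · simp [fx_act_eq_zero p hp h1]
          · simp [h1, hp]
        · have hp : p ≠ 1 := fun h => h1 (by rw [h]; rfl)
          rw [if_pos hp, if_pos h1]
          have : (fx (act n p) : ℝ) ≤ cent p.1 := by exact_mod_cast fx_act_le p
          rw [pow_succ]
          gcongr
    _ = ∑ a : Perm (Fin n), (if a ≠ 1 then (cent a : ℝ) ^ 2 else 0) *
          ∑ b : Perm (Fin n), (fx (act n (a, b)) : ℝ) := by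
        rw [Fintype.sum_prod_type]
        refine Finset.sum_congr rfl fun a _ => ?_
        rw [Finset.mul_sum]
    _ ≤ ∑ a : Perm (Fin n), (if a ≠ 1 then (cent a : ℝ) ^ 2 else 0) * n.factorial := by
        refine Finset.sum_le_sum fun a _ => ?_
        refine mul_le_mul_of_nonneg_left ?_ (by split_ifs <;> positivity)
        exact_mod_cast sum_fx a
    _ = _ := by rw [← Finset.sum_mul, Finset.sum_filter, mul_comm]

lemma sum_fx1 : ∑ p : Perm (Fin n) × Perm (Fin n), (fx (act n p) : ℝ) ≤ (n.factorial : ℝ) ^ 2 := by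
  have : ∑ p : Perm (Fin n) × Perm (Fin n), fx (act n p) ≤ n.factorial ^ 2 := by
    rw [Fintype.sum_prod_type]
    refine (Finset.sum_le_card_nsmul _ _ n.factorial fun a _ => sum_fx a).trans ?_
    rw [Finset.card_univ, Fintype.card_perm, Fintype.card_fin, smul_eq_mul, pow_two]
  exact_mod_cast this

lemma sum_fx2 : ∑ p : Perm (Fin n) × Perm (Fin n), (if p ^ 2 = 1 then (1:ℝ) else 0) * fx (act n p)
    ≤ n.factorial * tor n 2 := by
  have : ∑ p : Perm (Fin n) × Perm (Fin n), (if p ^ 2 = 1 then 1 else 0) * fx (act n p)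
    ≤ n.factorial * tor n 2 := by
    rw [Fintype.sum_prod_type]
    calc _ ≤ ∑ a : Perm (Fin n), (if a ^ 2 = 1 then 1 else 0) * n.factorial := by
          refine Finset.sum_le_sum fun a _ => ?_
          refine le_trans ?_ (Nat.mul_le_mul_left _ (sum_fx a))
          rw [Finset.mul_sum]
          refine Finset.sum_le_sum fun b _ => Nat.mul_le_mul_right _ ?_
          by_cases h : a ^ 2 = 1
          · rw [if_pos h]; split_ifs <;> simp
          · rw [if_neg h, if_neg]
            intro h'
            exact h (congrArg Prod.fst h')
      _ = _ := by
          rw [← Finset.sum_mul, Finset.sum_boole, mul_comm]; rfl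
  exact_mod_cast this

lemma sum_tor (m : ℕ) : ∑ p : Perm (Fin n) × Perm (Fin n), (if p ^ m = 1 then (1:ℝ) else 0)
    ≤ (tor n m : ℝ) ^ 2 := by
  rw [Finset.sum_boole]
  have : ((univ : Finset (Perm (Fin n) × Perm (Fin n))).filter (fun p => p ^ m = 1)).card
      ≤ tor n m ^ 2 := by
    rw [pow_two, tor, ← Finset.card_product]
    refine Finset.card_le_card fun p hp => ?_
    simp only [Finset.mem_filter, Finset.mem_univ, true_and, Finset.mem_product] at hp ⊢
    exact ⟨congrArg Prod.fst hp, congrArg Prod.snd hp⟩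
  exact_mod_cast this
end sums

lemma choose_three_ge (N : ℕ) (hN : 1000 ≤ N) : (N:ℝ) ^ 3 ≤ 12 * N.choose 3 := by
  have h := Nat.pow_le_choose (α := ℝ) 3 N
  have hN' : (1000:ℝ) ≤ N := by exact_mod_cast hN
  rw [show ((N + 1 - 3 : ℕ) : ℝ) = N - 2 by rw [Nat.cast_sub (by omega)]; push_cast; ring,
    show Nat.factorial 3 = 6 from rfl] at h
  push_cast at h
  nlinarith [mul_nonneg (sub_nonneg.mpr hN') (sub_nonneg.mpr hN'), mul_nonneg (mul_nonneg (sub_nonneg.mpr hN') (sub_nonneg.mpr hN')) (sub_nonneg.mpr hN')]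

lemma choose_four_ge (N : ℕ) (hN : 1000 ≤ N) : (N:ℝ) ^ 4 ≤ 48 * N.choose 4 := by
  have h := choose_three_ge N hN
  have hN' : (1000:ℝ) ≤ N := by exact_mod_cast hN
  have e := Nat.choose_succ_right_eq N 3
  have e' : (N.choose 4 : ℝ) * 4 = N.choose 3 * (N - 3) := by
    have h2 : ((N - 3 : ℕ) : ℝ) = N - 3 := by rw [Nat.cast_sub (by omega)]; norm_num
    rw [← h2]; exact_mod_cast e
  have e5 : (N.choose 5 : ℝ) = N.choose 5 := rfl
  have h6 := Nat.pow_le_choose (α := ℝ) 4 N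
  rw [show ((N + 1 - 4 : ℕ) : ℝ) = N - 3 by rw [Nat.cast_sub (by omega)]; push_cast; ring,
    show Nat.factorial 4 = 24 from rfl] at h6
  push_cast at h6
  have : (N:ℝ) ^ 2 ≤ 7 / 5 * (N - 3) ^ 2 := by nlinarith
  have : (N:ℝ) ^ 2 * (N:ℝ) ^ 2 ≤ (7 / 5 * (N - 3) ^ 2) * (7 / 5 * (N - 3) ^ 2) := by gcongr
  nlinarith [sq_nonneg (((N:ℝ) - 3) ^ 2)]

set_option maxHeartbeats 2000000 in
lemma pointwise : ∃ A : ℝ, 1 ≤ A ∧ ∀ {α : Type} [Fintype α] [DecidableEq α] (g : Perm α) (p N : ℕ)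
    (δ i2 i3 : ℝ),
    Fintype.card α = N → N = 60 * p → 1000 ≤ N → 30 * fx g ≤ N → 0 ≤ i2 → 0 ≤ i3 →
    1 / √N ≤ δ → (fx (g ^ 2) : ℝ) ≤ (δ + i2) * N → (fx (g ^ 3) : ℝ) ≤ (δ + i3) * N →
    ∀ k, 3 ≤ k → 2 * k ≤ N →
    (F g k : ℝ) ≤ A * ((fx g ^ 3) / N ^ 3 + δ * fx g / N ^ 2 + i2 * fx g / N ^ 2 + δ / N ^ 2
      + i3 / N ^ 2 + i2 / N ^ 2) * N.choose k := by
  obtain ⟨A, hA1, hA⟩ := F_large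
  refine ⟨A + 240, by linarith, ?_⟩
  intro α _ _ g p N δ i2 i3 hc hp hN hf hi2 hi3 hδ he2 he3 k hk3 hk
  have hN' : (1000:ℝ) ≤ N := by exact_mod_cast hN
  have hN0 : (0:ℝ) < N := by linarith
  have hs : 0 < √(N:ℝ) := Real.sqrt_pos.mpr hN0
  have hδ0 : 0 < δ := lt_of_lt_of_le (by positivity) hδ
  set f : ℝ := (fx g : ℝ) with hfdef
  have hf0 : 0 ≤ f := by positivity
  set Q : ℝ := f ^ 3 / N ^ 3 + δ * f / N ^ 2 + i2 * f / N ^ 2 + δ / N ^ 2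
      + i3 / N ^ 2 + i2 / N ^ 2 with hQ
  have hQ0 : 0 ≤ Q := by positivity
  have hb : (0:ℝ) ≤ N.choose k := by positivity
  have hQ3 : Q * N ^ 3 = f ^ 3 + δ * f * N + i2 * f * N + δ * N + i3 * N + i2 * N := by
    rw [hQ]; field_simp
  have e2N : (fx (g ^ 2) : ℝ) ≤ N := by rw [← hc]; exact_mod_cast fx_le _
  have e3N : (fx (g ^ 3) : ℝ) ≤ N := by rw [← hc]; exact_mod_cast fx_le _
  have e4N : (fx (g ^ 4) : ℝ) ≤ N := by rw [← hc]; exact_mod_cast fx_le _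
  have F1 : (F g 1 : ℝ) ≤ f := by rw [hfdef]; exact_mod_cast F_one g
  have F2 : 2 * (F g 2 : ℝ) ≤ f * F g 1 + fx (g ^ 2) := by rw [hfdef]; exact_mod_cast F_two g
  have F3 : 3 * (F g 3 : ℝ) ≤ f * F g 2 + fx (g ^ 2) * F g 1 + fx (g ^ 3) := by
    rw [hfdef]; exact_mod_cast F_three g
  have F4 : 4 * (F g 4 : ℝ) ≤ f * F g 3 + fx (g ^ 2) * F g 2 + fx (g ^ 3) * F g 1 + fx (g ^ 4) := by
    rw [hfdef]; exact_mod_cast F_four g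
  have hff : f ≤ f ^ 3 ∧ f ^ 2 ≤ f ^ 3 := by
    constructor
    · rw [hfdef]; exact_mod_cast Nat.le_self_pow (by norm_num) _
    · rw [hfdef]; norm_cast
      rcases Nat.eq_zero_or_pos (fx g) with h | h
      · rw [h]; norm_num
      · exact Nat.pow_le_pow_right h (by norm_num)
  have hfN : f ≤ N := by rw [hfdef, ← hc]; exact_mod_cast fx_le _
  set e2 : ℝ := (fx (g ^ 2) : ℝ)
  set e3 : ℝ := (fx (g ^ 3) : ℝ)
  set e4 : ℝ := (fx (g ^ 4) : ℝ)
  have he20 : 0 ≤ e2 := by positivity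
  have he30 : 0 ≤ e3 := by positivity
  have F2' : (F g 2 : ℝ) ≤ f ^ 2 + e2 := by
    have : f * F g 1 ≤ f * f := by gcongr
    have : (0:ℝ) ≤ F g 2 := by positivity
    nlinarith
  have F3' : (F g 3 : ℝ) ≤ f ^ 3 + f * e2 + e3 := by
    have a1 : f * F g 2 ≤ f * (f ^ 2 + e2) := by gcongr
    have a2 : e2 * F g 1 ≤ e2 * f := by gcongr
    have : 0 ≤ f ^ 3 := by positivity
    have : 0 ≤ f * e2 := by positivity
    nlinarith
  by_cases h5 : 5 ≤ k
  · have h := hA g p N hc hp hN hf k h5 hk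
    refine h.trans (mul_le_mul_of_nonneg_right ?_ hb)
    have : (f / N) ^ 3 + 1 / (N ^ 2 * √N) ≤ Q := by
      have h1 : 1 / ((N:ℝ) ^ 2 * √N) ≤ δ / N ^ 2 := by
        rw [mul_comm, ← div_div]; gcongr
      have h2 : 0 ≤ δ * f / N ^ 2 := by positivity
      have h3 : 0 ≤ i2 * f / N ^ 2 := by positivity
      have h4 : 0 ≤ i3 / N ^ 2 := by positivity
      have h5 : 0 ≤ i2 / N ^ 2 := by positivity
      rw [div_pow, hQ]
      linarith
    calc _ ≤ A * Q := by gcongr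
      _ ≤ _ := by nlinarith
  · have : k = 3 ∨ k = 4 := by omega
    rcases this with rfl | rfl
    · have h1 : (F g 3 : ℝ) ≤ Q * N ^ 3 := by
        rw [hQ3]
        have : f * e2 ≤ f * ((δ + i2) * N) := by gcongr
        have : 0 ≤ i2 * N := by positivity
        nlinarith
      have h2 := choose_three_ge N hN
      calc (F g 3 : ℝ) ≤ Q * N ^ 3 := h1
        _ ≤ Q * (12 * N.choose 3) := by gcongr
        _ = 12 * Q * N.choose 3 := by ring
        _ ≤ _ := by gcongr; linarith
    · have h1 : (F g 4 : ℝ) ≤ 5 * (Q * N ^ 4) := by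
        have hQ4 : Q * N ^ 4 = (f ^ 3 + δ * f * N + i2 * f * N + δ * N + i3 * N + i2 * N) * N := by
          rw [← hQ3]; ring
        have c1 : f * F g 3 ≤ f ^ 3 * N + f ^ 3 * N + f ^ 3 * N := by
          calc f * F g 3 ≤ f * (f ^ 3 + f * e2 + e3) := by gcongr
            _ = f ^ 3 * f + f ^ 2 * e2 + f * e3 := by ring
            _ ≤ f ^ 3 * N + f ^ 3 * N + f ^ 3 * N := by
              have m1 := mul_le_mul_of_nonneg_left hfN (by positivity : 0 ≤ f ^ 3)
              have m2 := mul_le_mul hff.2 e2N he20 (by positivity)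
              have m3 := mul_le_mul hff.1 e3N he30 (by positivity)
              exact add_le_add (add_le_add m1 m2) m3
        have c2 : e2 * F g 2 ≤ f ^ 3 * N + (δ + i2) * N * N := by
          calc e2 * F g 2 ≤ e2 * (f ^ 2 + e2) := by gcongr
            _ = f ^ 2 * e2 + e2 * e2 := by ring
            _ ≤ f ^ 3 * N + (δ + i2) * N * N := by
              have m2 := mul_le_mul hff.2 e2N he20 (by positivity)
              have m3 := mul_le_mul he2 e2N he20 (by positivity)
              exact add_le_add m2 m3
        have c3 : e3 * F g 1 ≤ f ^ 3 * N := by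
          calc e3 * F g 1 ≤ N * f ^ 3 := by
                gcongr
                exact F1.trans hff.1
            _ = _ := by ring
        have c4 : e4 ≤ δ * N * N := by
          refine e4N.trans ?_
          have : 1 ≤ δ * N := by
            have hss : √(N:ℝ) * √N = N := Real.mul_self_sqrt hN0.le
            rw [div_le_iff₀ hs] at hδ
            have : 1 ≤ √(N:ℝ) := Real.one_le_sqrt.mpr (by linarith)
            calc (1:ℝ) ≤ δ * √N := hδ
              _ ≤ δ * (√N * √N) := by gcongr; nlinarith
              _ = _ := by rw [hss]
          nlinarith
        rw [hQ4]
        have d1 : 0 ≤ δ * f * N * N := by positivity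
        have d2 : 0 ≤ i2 * f * N * N := by positivity
        have d3 : 0 ≤ i3 * N * N := by positivity
        have d4 : 0 ≤ f ^ 3 * N := by positivity
        have d5 : 0 ≤ δ * N * N := by positivity
        have d6 : 0 ≤ i2 * N * N := by positivity
        nlinarith
      have h2 := choose_four_ge N hN
      calc (F g 4 : ℝ) ≤ 5 * (Q * N ^ 4) := h1
        _ ≤ 5 * (Q * (48 * N.choose 4)) := by gcongr
        _ = 240 * Q * N.choose 4 := by ring
        _ ≤ _ := by gcongr; linarith

lemma pow_four_le (n : ℕ) (hn : 7 ≤ n) : n ^ 4 ≤ n.factorial := by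
  induction n, hn using Nat.le_induction with
  | base => decide
  | succ n hn ih =>
    rw [Nat.factorial_succ]
    have : (n + 1) ^ 3 ≤ n ^ 4 := by nlinarith [Nat.mul_le_mul hn hn, Nat.mul_le_mul hn (Nat.mul_le_mul hn hn), Nat.mul_le_mul hn (le_refl (n*n)), Nat.mul_le_mul hn (le_refl (n*n*n))]
    calc (n + 1) ^ 4 = (n + 1) * (n + 1) ^ 3 := by ring
      _ ≤ (n + 1) * n.factorial := Nat.mul_le_mul_left _ (this.trans ih)

set_option maxHeartbeats 2000000 in
theorem main_half : ∃ (C : ℝ) (n0 : ℕ), 0 < C ∧ ∀ n : ℕ, n0 ≤ n → ∀ k : ℕ, 3 ≤ k →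
    2 * k ≤ n.factorial → ((∑ p : Perm (Fin n) × Perm (Fin n), F (act n p) k : ℕ) : ℝ) ≤
      (1 + C / (n:ℝ) ^ 2) * n.factorial.choose k := by
  obtain ⟨A, hA1, hA⟩ := pointwise
  obtain ⟨D, hD1, hD⟩ := cent_bounds
  obtain ⟨E, hE1, hE⟩ := tor_bound
  refine ⟨A * (3 * D + E + 2 * E ^ 2), ⌈30 * D⌉₊ + 10, by positivity, ?_⟩
  intro n hn k hk3 hk
  have hn30 : 30 * D ≤ n := (Nat.le_ceil _).trans (by exact_mod_cast (by omega))
  have hn10 : 10 ≤ n := by omega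
  have hn10' : (10:ℝ) ≤ n := by exact_mod_cast hn10
  have hn0 : (0:ℝ) < n := by linarith
  obtain ⟨hc1, hc2⟩ := hD n (by omega)
  obtain ⟨ht2, ht3⟩ := hE n (by omega)
  set N := n.factorial with hNdef
  set δ : ℝ := D / (n:ℝ) ^ 2 with hδdef
  have hδ0 : 0 < δ := by positivity
  have hδ30 : 30 * δ ≤ 1 := by
    rw [hδdef, ← mul_div_assoc, div_le_one (by positivity)]
    nlinarith
  have hN4 : n ^ 4 ≤ N := pow_four_le n (by omega)
  have hN1000 : 1000 ≤ N := le_trans (by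
    calc 1000 ≤ 10 ^ 4 := by norm_num
      _ ≤ n ^ 4 := Nat.pow_le_pow_left hn10 4) hN4
  have hNpos : (0:ℝ) < N := by exact_mod_cast (by omega : 0 < N)
  have hsq : 1 / √(N:ℝ) ≤ δ := by
    have h1 : (n:ℝ) ^ 2 ≤ √(N:ℝ) := by
      apply Real.le_sqrt_of_sq_le
      have : ((n:ℝ)) ^ 4 ≤ N := by exact_mod_cast hN4
      nlinarith
    calc 1 / √(N:ℝ) ≤ 1 / (n:ℝ) ^ 2 := by gcongr
      _ ≤ δ := by rw [hδdef]; gcongr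
  obtain ⟨q, hq⟩ : 60 ∣ N :=
    dvd_trans (by decide : 60 ∣ Nat.factorial 5) (Nat.factorial_dvd_factorial (by omega))
  have hcard : Fintype.card (Perm (Fin n)) = N := by rw [Fintype.card_perm, Fintype.card_fin]
  have hfx : ∀ p : Perm (Fin n) × Perm (Fin n), p ≠ 1 → (fx (act n p) : ℝ) ≤ δ * N := by
    intro p hp
    by_cases h1 : p.1 = 1
    · rw [fx_act_eq_zero p hp h1]; simp; positivity
    · exact le_trans (by exact_mod_cast fx_act_le p) (hc1 p.1 h1)
  have hfxp : ∀ (m : ℕ) (p : Perm (Fin n) × Perm (Fin n)),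
      (fx (act n p ^ m) : ℝ) ≤ (δ + if p ^ m = 1 then (1:ℝ) else 0) * N := by
    intro m p
    rw [← map_pow]
    split_ifs with h
    · have : (fx (act n (p ^ m)) : ℝ) ≤ N := by rw [← hcard]; exact_mod_cast fx_le _
      nlinarith
    · rw [add_zero]; exact hfx _ h
  set b : ℝ := ((N.choose k : ℕ) : ℝ) with hb
  have hb0 : 0 ≤ b := by positivity
  set i2 : Perm (Fin n) × Perm (Fin n) → ℝ := fun p => if p ^ 2 = 1 then (1:ℝ) else 0 with hi2
  set i3 : Perm (Fin n) × Perm (Fin n) → ℝ := fun p => if p ^ 3 = 1 then (1:ℝ) else 0 with hi3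
  have hi20 : ∀ p, 0 ≤ i2 p := fun p => by simp only [hi2]; split_ifs <;> norm_num
  have hi30 : ∀ p, 0 ≤ i3 p := fun p => by simp only [hi3]; split_ifs <;> norm_num
  set f : Perm (Fin n) × Perm (Fin n) → ℝ := fun p => (fx (act n p) : ℝ) with hf
  have hf0 : ∀ p, 0 ≤ f p := fun p => by simp only [hf]; positivity
  have hpt : ∀ p ∈ (univ : Finset (Perm (Fin n) × Perm (Fin n))).filter (fun p => p ≠ 1),
      (F (act n p) k : ℝ) ≤ A * (f p ^ 3 / N ^ 3 + δ * f p / N ^ 2 + i2 p * f p / N ^ 2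
        + δ / N ^ 2 + i3 p / N ^ 2 + i2 p / N ^ 2) * b := by
    intro p hp
    have hp1 : p ≠ 1 := (Finset.mem_filter.mp hp).2
    refine hA (act n p) q N δ (i2 p) (i3 p) hcard hq hN1000 ?_ (hi20 p) (hi30 p) hsq
      (hfxp 2 p) (hfxp 3 p) k hk3 hk
    have h := hfx p hp1
    have : (30:ℝ) * fx (act n p) ≤ N := by nlinarith
    exact_mod_cast this
  have hsum : ∑ p ∈ (univ : Finset (Perm (Fin n) × Perm (Fin n))).filter (fun p => p ≠ 1),
      (f p ^ 3 / N ^ 3 + δ * f p / N ^ 2 + i2 p * f p / N ^ 2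
        + δ / N ^ 2 + i3 p / N ^ 2 + i2 p / N ^ 2) ≤ (3 * D + E + 2 * E ^ 2) / n ^ 2 := by
    have ext : ∀ u : Perm (Fin n) × Perm (Fin n) → ℝ, (∀ p, 0 ≤ u p) →
        ∑ p ∈ (univ : Finset (Perm (Fin n) × Perm (Fin n))).filter (fun p => p ≠ 1), u p
          ≤ ∑ p, u p := fun u hu =>
      Finset.sum_le_sum_of_subset_of_nonneg (Finset.filter_subset _ _) (fun p _ _ => hu p)
    simp only [Finset.sum_add_distrib]
    have ε2 : (E / (n:ℝ) ^ 2) ^ 2 ≤ E ^ 2 / n ^ 2 := by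
      rw [div_pow]
      gcongr
      nlinarith
    have s1 : ∑ p ∈ (univ : Finset (Perm (Fin n) × Perm (Fin n))).filter (fun p => p ≠ 1),
        f p ^ 3 / (N:ℝ) ^ 3 ≤ δ := by
      rw [← Finset.sum_div, div_le_iff₀ (by positivity)]
      refine (sum_fx3 (n := n)).trans ?_
      calc _ ≤ (N:ℝ) * (δ * N ^ 2) := by gcongr
        _ = _ := by ring
    have s2 : ∑ p ∈ (univ : Finset (Perm (Fin n) × Perm (Fin n))).filter (fun p => p ≠ 1),
        δ * f p / (N:ℝ) ^ 2 ≤ δ := by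
      refine (ext _ fun p => by have := hf0 p; positivity).trans ?_
      rw [← Finset.sum_div, div_le_iff₀ (by positivity), ← Finset.mul_sum]
      gcongr
      exact sum_fx1
    have s3 : ∑ p ∈ (univ : Finset (Perm (Fin n) × Perm (Fin n))).filter (fun p => p ≠ 1),
        i2 p * f p / (N:ℝ) ^ 2 ≤ E / n ^ 2 := by
      refine (ext _ fun p => by have := hf0 p; have := hi20 p; positivity).trans ?_
      rw [← Finset.sum_div, div_le_iff₀ (by positivity)]
      refine (sum_fx2 (n := n)).trans ?_
      calc (N:ℝ) * tor n 2 ≤ N * (E / n ^ 2 * N) := by gcongr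
        _ = _ := by ring
    have s4 : ∑ p ∈ (univ : Finset (Perm (Fin n) × Perm (Fin n))).filter (fun p => p ≠ 1),
        δ / (N:ℝ) ^ 2 ≤ δ := by
      refine (ext _ fun p => by positivity).trans ?_
      rw [Finset.sum_const, Finset.card_univ, Fintype.card_prod, hcard, nsmul_eq_mul]
      push_cast
      apply le_of_eq
      field_simp
    have s5 : ∑ p ∈ (univ : Finset (Perm (Fin n) × Perm (Fin n))).filter (fun p => p ≠ 1),
        i3 p / (N:ℝ) ^ 2 ≤ E ^ 2 / n ^ 2 := by
      refine le_trans ?_ ε2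
      refine (ext _ fun p => by have := hi30 p; positivity).trans ?_
      rw [← Finset.sum_div, div_le_iff₀ (by positivity)]
      refine (sum_tor (n := n) 3).trans ?_
      rw [← mul_pow]
      gcongr
    have s6 : ∑ p ∈ (univ : Finset (Perm (Fin n) × Perm (Fin n))).filter (fun p => p ≠ 1),
        i2 p / (N:ℝ) ^ 2 ≤ E ^ 2 / n ^ 2 := by
      refine le_trans ?_ ε2
      refine (ext _ fun p => by have := hi20 p; positivity).trans ?_
      rw [← Finset.sum_div, div_le_iff₀ (by positivity)]
      refine (sum_tor (n := n) 2).trans ?_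
      rw [← mul_pow]
      gcongr
    have e : (3 * D + E + 2 * E ^ 2) / (n:ℝ) ^ 2 =
        δ + δ + E / n ^ 2 + δ + E ^ 2 / n ^ 2 + E ^ 2 / n ^ 2 := by
      rw [hδdef]; ring
    rw [e]
    gcongr
  have hsplit : ∑ p : Perm (Fin n) × Perm (Fin n), (F (act n p) k : ℝ) =
      ∑ p ∈ (univ : Finset (Perm (Fin n) × Perm (Fin n))).filter (fun p => p ≠ 1),
        (F (act n p) k : ℝ) + F (act n 1) k := by
    rw [← Finset.sum_filter_add_sum_filter_not univ (fun p => p ≠ 1)]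
    congr 1
    simp only [not_not]
    rw [Finset.filter_eq' univ (1 : Perm (Fin n) × Perm (Fin n))]
    simp
  push_cast
  rw [hsplit]
  have h1 : (F (act n 1) k : ℝ) ≤ b := by
    have := F_le_choose (act n 1) k
    rw [hcard] at this
    rw [hb]; exact_mod_cast this
  have h2 := (Finset.sum_le_sum hpt)
  rw [← Finset.sum_mul, ← Finset.mul_sum] at h2
  have h3 : A * (∑ p ∈ (univ : Finset (Perm (Fin n) × Perm (Fin n))).filter (fun p => p ≠ 1),
      (f p ^ 3 / N ^ 3 + δ * f p / N ^ 2 + i2 p * f p / N ^ 2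
        + δ / N ^ 2 + i3 p / N ^ 2 + i2 p / N ^ 2)) * b ≤
      A * ((3 * D + E + 2 * E ^ 2) / n ^ 2) * b := by gcongr
  calc _ ≤ A * ((3 * D + E + 2 * E ^ 2) / n ^ 2) * b + b := add_le_add (h2.trans h3) h1
    _ = _ := by ring

end TUB

/-- There is a universal constant `C > 0` such that for all `n ≥ 1` and all
`3 ≤ k ≤ n! − 3`, `T(n,k) ≤ (1 + C/n²)·(1/n!²)·binom(n!,k)`. -/
theorem T_upper_bound_uniform :
    ∃ C : ℝ, 0 < C ∧ ∀ n : ℕ, 1 ≤ n → ∀ k : ℕ, 3 ≤ k → k + 3 ≤ n.factorial →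
      (T n k : ℝ) ≤
        (1 + C / (n : ℝ) ^ 2) * ((n.factorial.choose k : ℝ) / (n.factorial : ℝ) ^ 2) := by
  obtain ⟨C, n0, hC, h⟩ := TUB.main_half
  refine ⟨max C ((n0:ℝ) ^ 2 * (n0.factorial : ℝ) ^ 2), lt_max_of_lt_left hC, ?_⟩
  intro n hn k hk3 hk
  have hn0 : (0:ℝ) < n := by exact_mod_cast hn
  have hN0 : (0:ℝ) < n.factorial := by positivity
  have hb0 : (0:ℝ) ≤ n.factorial.choose k := by positivity
  rw [← mul_div_assoc, le_div_iff₀ (by positivity)]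
  by_cases hnn : n0 ≤ n
  · have hB : (T n k : ℝ) * (n.factorial : ℝ) ^ 2 ≤
        ((∑ p : Perm (Fin n) × Perm (Fin n), TUB.F (TUB.act n p) k : ℕ) : ℝ) := by
      rw [pow_two]
      exact_mod_cast TUB.burnside n k
    refine hB.trans ?_
    have hfin : ((∑ p : Perm (Fin n) × Perm (Fin n), TUB.F (TUB.act n p) k : ℕ) : ℝ) ≤
        (1 + C / (n:ℝ) ^ 2) * n.factorial.choose k := by
      by_cases h2 : 2 * k ≤ n.factorial
      · exact h n hnn k hk3 h2
      · have h3 := h n hnn (n.factorial - k) (by omega) (by omega)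
        rw [Nat.choose_symm (by omega : k ≤ n.factorial)] at h3
        refine le_trans ?_ h3
        have hcard : Fintype.card (Perm (Fin n)) = n.factorial := by
          rw [Fintype.card_perm, Fintype.card_fin]
        have : ∑ p : Perm (Fin n) × Perm (Fin n), TUB.F (TUB.act n p) k ≤
            ∑ p : Perm (Fin n) × Perm (Fin n), TUB.F (TUB.act n p) (n.factorial - k) := by
          refine Finset.sum_le_sum fun p _ => ?_
          have := TUB.F_compl (TUB.act n p) (k := k) (by omega)
          rwa [hcard] at this
        exact_mod_cast this
    refine hfin.trans ?_
    gcongr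
    exact le_max_left _ _
  · have hT : (T n k : ℝ) ≤ n.factorial.choose k := by exact_mod_cast TUB.T_le_choose n k
    have h1 : (n.factorial : ℝ) ≤ n0.factorial := by
      exact_mod_cast Nat.factorial_le (by omega)
    have h2 : (n:ℝ) ≤ n0 := by exact_mod_cast (by omega : n ≤ n0)
    have h3 : (n.factorial : ℝ) ^ 2 ≤ max C ((n0:ℝ) ^ 2 * (n0.factorial : ℝ) ^ 2) / (n:ℝ) ^ 2 := by
      rw [le_div_iff₀ (by positivity)]
      refine le_trans ?_ (le_max_right _ _)
      rw [mul_comm]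
      gcongr
    calc (T n k : ℝ) * (n.factorial : ℝ) ^ 2 ≤ n.factorial.choose k * (n.factorial : ℝ) ^ 2 := by gcongr
      _ = (n.factorial : ℝ) ^ 2 * n.factorial.choose k := by ring
      _ ≤ _ := by gcongr; linarith
end
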